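/- Let γ be a relatively extremal knot in ℝⁿ (n ≥ 2) with image K, and suppose there exists s₀ with κγ(s₀) < sup_s κγ(s). If s₀ ∉ I_c (i.e. γ(s₀) is not a minimal double critical point), then there exist real numbers c ≤ a < s₀ < b ≤ d with d − c ≤ L such that: (a) γ' is constant on [a,b] (γ is a line segment there); (b) γ on [c,a] and γ on [b,d] are planar circular arcs of radius F_k(γ), i.e. of the form s ↦ o + F_k(γ)(cos((s−s₁)/F_k(γ))·u + sin((s−s₁)/F_k(γ))·e) for some point o and orthonormal vectors u,e; and (c) (a − c ≥ π·F_k(γ) or c ∈ I_c) and (d − b ≥ π·F_k(γ) or d ∈ I_c). -/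

import Mathlib

open Set Filter MeasureTheory
open scoped RealInnerProductSpace Topology ENNReal

noncomputable section

/-- Euclidean space `ℝⁿ`. -/
abbrev Euc (n : ℕ) := EuclideanSpace ℝ (Fin n)

/-- Generalized curvature `κγ(s)` of a curve with derivative `γd` and parameter domain `D`:
the limsup, as `x, y → s` with `x ≠ y`, of `∠(γd x, γd y) / |x - y|`, expressed as the
infimum of all eventual bounds. -/
def curvAt {n : ℕ} (γd : ℝ → Euc n) (D : Set ℝ) (s : ℝ) : ℝ :=
  sInf {Λ : ℝ | 0 ≤ Λ ∧ ∃ δ > 0, ∀ x ∈ D, ∀ y ∈ D, x ≠ y →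
    |x - s| < δ → |y - s| < δ →
    InnerProductGeometry.angle (γd x) (γd y) ≤ Λ * |x - y|}

/-- `κγ(s) < Λ`: there are `δ > 0` and `Λ' < Λ` bounding the angle dilation near `s`. -/
def CurvLt {n : ℕ} (γd : ℝ → Euc n) (D : Set ℝ) (s Λ : ℝ) : Prop :=
  ∃ δ > 0, ∃ Λ' < Λ, ∀ x ∈ D, ∀ y ∈ D, x ≠ y → |x - s| < δ → |y - s| < δ →
    InnerProductGeometry.angle (γd x) (γd y) ≤ Λ' * |x - y|

/-- `f` restricted to `[a, c]` is a planar circular arc of radius `1/Λ`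
of length in `[0, 2π/Λ)`. -/
def IsArc {n : ℕ} (Λ : ℝ) (f : ℝ → Euc n) (a c : ℝ) : Prop :=
  c - a < 2 * Real.pi / Λ ∧
  ∃ (o u e : Euc n) (s₁ : ℝ), ‖u‖ = 1 ∧ ‖e‖ = 1 ∧ ⟪u, e⟫ = 0 ∧
    ∀ s ∈ Icc a c,
      f s = o + (Λ⁻¹ * Real.cos (Λ * (s - s₁))) • u + (Λ⁻¹ * Real.sin (Λ * (s - s₁))) • e

/-- `f` restricted to `[a, c]` is a planar circular arc of radius `r`. -/
def IsArcR {n : ℕ} (r : ℝ) (f : ℝ → Euc n) (a c : ℝ) : Prop :=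
  ∃ (o u e : Euc n) (s₁ : ℝ), ‖u‖ = 1 ∧ ‖e‖ = 1 ∧ ⟪u, e⟫ = 0 ∧
    ∀ s ∈ Icc a c,
      f s = o + (r * Real.cos ((s - s₁) / r)) • u + (r * Real.sin ((s - s₁) / r)) • e

/-- `O_p(v, r)`: the union of the open balls of radius `r` tangent to `v^⊥` at `p`. -/
def Odisk {n : ℕ} (p v : Euc n) (r : ℝ) : Set (Euc n) :=
  {x | ∃ w : Euc n, ‖w‖ = 1 ∧ ⟪w, v⟫ = 0 ∧ ‖x - p - r • w‖ < r}

/-- Ball radius `R_O` of the curve `f` (with derivative/tangent field `γd`) on domain `D`. -/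
def RO {n : ℕ} (f γd : ℝ → Euc n) (D : Set ℝ) : ℝ :=
  sInf {r : ℝ | 0 < r ∧ ∃ s ∈ D, ∃ t ∈ D, ∃ w : Euc n,
    ‖w‖ = 1 ∧ ⟪w, γd s⟫ = 0 ∧ ‖f t - f s - r • w‖ < r}

/-- Minimal double critical distance of the curve `f` with tangent field `γd`. -/
def MDC {n : ℕ} (f γd : ℝ → Euc n) : ℝ :=
  sInf {d : ℝ | ∃ x y : ℝ, f x ≠ f y ∧ ⟪f x - f y, γd x⟫ = 0 ∧
    ⟪f x - f y, γd y⟫ = 0 ∧ d = ‖f x - f y‖}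

/-- Normal injectivity radius `i(K, ℝⁿ)` of the curve `f` with tangent field `γd`. -/
def injRad {n : ℕ} (f γd : ℝ → Euc n) : ℝ :=
  sSup ({0} ∪ {r : ℝ | 0 < r ∧ ∀ s t : ℝ, ∀ u w : Euc n,
    ⟪u, γd s⟫ = 0 → ⟪w, γd t⟫ = 0 → ‖u‖ < r → ‖w‖ < r →
    f s + u = f t + w → f s = f t ∧ u = w})

/-- A knot: a simple closed unit-speed `C^{1,1}` curve, as an `L`-periodic map `ℝ → ℝⁿ`,
injective on `[0, L)`, with `‖γ'‖ ≡ 1` and `γ'` Lipschitz. -/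
structure Knot (n : ℕ) where
  L : ℝ
  Lpos : 0 < L
  f : ℝ → Euc n
  fd : ℝ → Euc n
  per : ∀ s, f (s + L) = f s
  perd : ∀ s, fd (s + L) = fd s
  deriv : ∀ s, HasDerivAt f (fd s) s
  unit : ∀ s, ‖fd s‖ = 1
  lipd : ∃ C : NNReal, LipschitzWith C fd
  inj : InjOn f (Ico 0 L)

/-- Ropelength `ℓ_e(γ) = L / R_O(K)`. -/
def Knot.ropelength {n : ℕ} (k : Knot n) : ℝ := k.L / RO k.f k.fd univ

/-- The set `I_c` of parameters realizing the minimal double critical distance. -/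
def Knot.Ic {n : ℕ} (k : Knot n) : Set ℝ :=
  {x | ∃ y : ℝ, k.f x ≠ k.f y ∧ ⟪k.f x - k.f y, k.fd x⟫ = 0 ∧
    ⟪k.f x - k.f y, k.fd y⟫ = 0 ∧ ‖k.f x - k.f y‖ = MDC k.f k.fd}

/-- `sup_s κγ(s)` for a knot. -/
def Knot.supCurv {n : ℕ} (k : Knot n) : ℝ := ⨆ s : ℝ, curvAt k.fd univ s

/-- Analytic focal distance `F_k(γ) = (sup_s κγ(s))⁻¹`. -/
def Knot.Fk {n : ℕ} (k : Knot n) : ℝ := (k.supCurv)⁻¹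

/-- Two knots are in the same knot class: after rescaling their domains to `ℝ/ℤ`
(realized by `1`-periodic maps `ℝ → ℝⁿ`), they are joined by a continuous homotopy
through injective loops. -/
def SameKnotClass {n : ℕ} (k₁ k₂ : Knot n) : Prop :=
  ∃ H : ℝ → ℝ → Euc n,
    ContinuousOn (fun z : ℝ × ℝ => H z.1 z.2) (Icc 0 1 ×ˢ univ) ∧
    (∀ t s, H t (s + 1) = H t s) ∧
    (∀ s, H 0 s = k₁.f (k₁.L * s)) ∧
    (∀ s, H 1 s = k₂.f (k₂.L * s)) ∧
    ∀ t ∈ Icc (0 : ℝ) 1, InjOn (H t) (Ico 0 1)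

/-- A knot is relatively extremal: a relative minimum of ropelength within its knot class
with respect to the `C¹` topology (on rescaled parametrizations). -/
def RelativelyExtremal {n : ℕ} (k : Knot n) : Prop :=
  ∃ ε > 0, ∀ η : Knot n, SameKnotClass k η →
    (∀ s : ℝ, ‖η.f (η.L * s) - k.f (k.L * s)‖ +
      ‖η.L • η.fd (η.L * s) - k.L • k.fd (k.L * s)‖ < ε) →
    k.ropelength ≤ η.ropelength

/-- The class `C(p, q; v, w; Λ)`: unit-speed `C^{1,1}` curves `γ : [0, L] → ℝⁿ`
(`L` not fixed) from `p` to `q` with initial/terminal directions `v, w`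
and `Λ`-Lipschitz derivative (curvature at most `Λ`). -/
structure CurveCC (n : ℕ) (p q v w : Euc n) (Λ : ℝ) where
  L : ℝ
  Lnn : 0 ≤ L
  f : ℝ → Euc n
  fd : ℝ → Euc n
  deriv : ∀ s ∈ Icc (0 : ℝ) L, HasDerivWithinAt f (fd s) (Icc 0 L) s
  unit : ∀ s ∈ Icc (0 : ℝ) L, ‖fd s‖ = 1
  lip : LipschitzOnWith Λ.toNNReal fd (Icc 0 L)
  i0 : f 0 = p
  id0 : fd 0 = v
  iL : f L = q
  idL : fd L = w

/-- A `C¹` closed curve of period `L` with nowhere-vanishing derivative. -/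
structure ClosedC1 (n : ℕ) (L : ℝ) where
  f : ℝ → Euc n
  fd : ℝ → Euc n
  per : ∀ s, f (s + L) = f s
  perd : ∀ s, fd (s + L) = fd s
  deriv : ∀ s, HasDerivAt f (fd s) s
  nz : ∀ s, fd s ≠ 0

/-- A simple closed `C^{1,1}` curve of period `L` with nowhere-vanishing derivative. -/
structure ClosedC11 (n : ℕ) (L : ℝ) extends ClosedC1 n L where
  lipd : ∃ C : NNReal, LipschitzWith C fd
  inj : InjOn f (Ico 0 L)

/-- The unit tangent field of `c` is `C`-Lipschitz with respect to the arclength of `c`. -/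
def TangentLip {n : ℕ} {L : ℝ} (c : ClosedC1 n L) (C : ℝ) : Prop :=
  ∀ x y : ℝ, x ≤ y →
    ‖‖c.fd y‖⁻¹ • c.fd y - ‖c.fd x‖⁻¹ • c.fd x‖ ≤ C * ∫ t in x..y, ‖c.fd t‖

/-- Pointwise geometric focal distance `F_g(γ(s))` of the curve `f` with domain `D`. -/
def FgPt {n : ℕ} (f fd : ℝ → Euc n) (D : Set ℝ) (s : ℝ) : ℝ :=
  sInf {r : ℝ | 0 < r ∧ f s ∈ closure (Odisk (f s) (fd s) r ∩ (f '' D))}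

end

section Sphere

variable {E : Type*} [NormedAddCommGroup E] [InnerProductSpace ℝ E]

/-- A two-point function obeying the triangle inequality and bounded to the right of each point
by the increments of `σ` is bounded globally by these increments. -/
theorem right_local_bound (φ : ℝ → ℝ → ℝ) (σ : ℝ → ℝ)
    (htri : ∀ x y z, φ x z ≤ φ x y + φ y z) (hself : ∀ x, φ x x ≤ 0)
    (hφ : ∀ x, Continuous (φ x)) (hσ : Continuous σ)
    (hloc : ∀ x, ∃ δ > 0, ∀ y, x < y → y < x + δ → φ x y ≤ σ y - σ x)
    {x y : ℝ} (hxy : x ≤ y) : φ x y ≤ σ y - σ x := by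
  have hcl : IsClosed ({z | φ x z ≤ σ z - σ x} ∩ Icc x y) :=
    (isClosed_le (hφ x) (hσ.sub continuous_const)).inter isClosed_Icc
  have h0 : x ∈ {z | φ x z ≤ σ z - σ x} := by
    simpa using hself x
  refine hcl.Icc_subset_of_forall_exists_gt h0 ?_ (right_mem_Icc.2 hxy)
  rintro z ⟨hz, hzI⟩ w hw
  obtain ⟨δ, hδ, h⟩ := hloc z
  have hw' : z < w := hw
  obtain ⟨v, hv1, hv2⟩ := exists_between (lt_min hw' (lt_add_of_pos_right z hδ))
  refine ⟨v, ?_, hv1, (hv2.trans_le (min_le_left _ _)).le⟩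
  have h1 := h v hv1 (hv2.trans_le (min_le_right _ _))
  have h2 := htri x z v
  change φ x v ≤ σ v - σ x
  change φ x z ≤ σ z - σ x at hz
  linarith

theorem norm_sub_eq_two_mul_sin {x y : E} (hx : ‖x‖ = 1) (hy : ‖y‖ = 1) :
    ‖x - y‖ = 2 * Real.sin (InnerProductGeometry.angle x y / 2) := by
  set a := InnerProductGeometry.angle x y with ha
  have hc : ⟪x, y⟫ = Real.cos a := by
    rw [ha, InnerProductGeometry.cos_angle, hx, hy]; simp
  have h0 : 0 ≤ Real.sin (a / 2) := by
    apply Real.sin_nonneg_of_nonneg_of_le_pi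
    · have := InnerProductGeometry.angle_nonneg x y; linarith
    · have := InnerProductGeometry.angle_le_pi x y; linarith [Real.pi_pos]
  have h1 : ‖x - y‖ ^ 2 = (2 * Real.sin (a / 2)) ^ 2 := by
    rw [norm_sub_sq_real, hx, hy, hc, mul_pow, Real.sin_sq_eq_half_sub]
    ring_nf
  exact (pow_left_inj₀ (norm_nonneg _) (by positivity) two_ne_zero).1 h1

theorem norm_sub_le_angle {x y : E} (hx : ‖x‖ = 1) (hy : ‖y‖ = 1) :
    ‖x - y‖ ≤ InnerProductGeometry.angle x y := by
  rw [norm_sub_eq_two_mul_sin hx hy]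
  have := Real.sin_le (x := InnerProductGeometry.angle x y / 2)
    (by have := InnerProductGeometry.angle_nonneg x y; linarith)
  linarith

theorem exists_angle_le_mul_norm_sub {κ : ℝ} (hκ : 1 < κ) :
    ∃ η > 0, ∀ x y : E, ‖x‖ = 1 → ‖y‖ = 1 → ‖x - y‖ < η →
      InnerProductGeometry.angle x y ≤ κ * ‖x - y‖ := by
  have hκ0 : 0 < κ := by linarith
  refine ⟨min 1 ((κ - 1) / κ), lt_min one_pos (div_pos (by linarith) hκ0), ?_⟩
  intro x y hx hy h
  have h1 : ‖x - y‖ < 1 := h.trans_le (min_le_left _ _)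
  have h2 : ‖x - y‖ < (κ - 1) / κ := h.trans_le (min_le_right _ _)
  rw [norm_sub_eq_two_mul_sin hx hy] at *
  set t := InnerProductGeometry.angle x y / 2 with ht
  have ht0 : 0 ≤ t := by have := InnerProductGeometry.angle_nonneg x y; linarith
  have htp : t ≤ Real.pi / 2 := by have := InnerProductGeometry.angle_le_pi x y; linarith
  have hang : InnerProductGeometry.angle x y = 2 * t := by rw [ht]; ring
  rw [hang]
  have hj := Real.mul_le_sin ht0 htp
  have h3 : t ≤ 2 * Real.sin t := by
    have : (1 : ℝ) / 2 * t ≤ 2 / Real.pi * t := by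
      apply mul_le_mul_of_nonneg_right _ ht0
      rw [div_le_div_iff₀ two_pos Real.pi_pos]
      linarith [Real.pi_le_four]
    linarith
  rcases ht0.eq_or_lt with h0 | h0
  · rw [← h0]; simp
  have h4 := Real.sin_gt_sub_cube h0
  have h5 : t < 1 := h3.trans_lt h1
  have h6 : t < (κ - 1) / κ := h3.trans_lt h2
  have h7 : t * κ < κ - 1 := by rwa [lt_div_iff₀ hκ0] at h6
  have h8 : κ * (t - t ^ 3 / 6) ≤ κ * Real.sin t := mul_le_mul_of_nonneg_left h4.le hκ0.le
  have h9 : t ≤ κ * (t - t ^ 3 / 6) := by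
    have : t ^ 2 * κ ≤ κ - 1 := by nlinarith
    nlinarith
  linarith

/-- A path on the unit sphere that is `ρ`-Lipschitz for the chordal distance is `ρ`-Lipschitz for
the angular distance. -/
theorem angle_le_of_norm_sub_le {T : ℝ → E} {ρ : ℝ} (hT : ∀ s, ‖T s‖ = 1)
    (hL : ∀ x y, ‖T x - T y‖ ≤ ρ * |x - y|) (x y : ℝ) :
    InnerProductGeometry.angle (T x) (T y) ≤ ρ * |x - y| := by
  have hρ0 : 0 ≤ ρ := by
    have := (norm_nonneg _).trans (hL 1 0)
    simpa using this
  have hne : ∀ s, T s ≠ 0 := fun s h => by have := hT s; simp [h] at this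
  have hcont : Continuous T := by
    have : LipschitzWith (Real.toNNReal ρ) T := LipschitzWith.of_dist_le_mul fun a b => by
      rw [dist_eq_norm, Real.dist_eq, Real.coe_toNNReal _ hρ0]; exact hL a b
    exact this.continuous
  have key : ∀ κ > 1, ∀ x y, x ≤ y →
      InnerProductGeometry.angle (T x) (T y) ≤ κ * ρ * y - κ * ρ * x := by
    intro κ hκ x y hxy
    obtain ⟨η, hη, h⟩ := exists_angle_le_mul_norm_sub (E := E) hκ
    refine right_local_bound (fun a b => InnerProductGeometry.angle (T a) (T b))
      (fun a => κ * ρ * a) (fun a b c => InnerProductGeometry.angle_le_angle_add_angle _ _ _)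
      (fun a => (InnerProductGeometry.angle_self (hne a)).le) (fun a => ?_) (by fun_prop) ?_ hxy
    · rw [continuous_iff_continuousAt]
      intro b
      have := InnerProductGeometry.continuousAt_angle (x := (T a, T b)) (hne a) (hne b)
      exact ContinuousAt.comp_of_eq (f := fun b => (T a, T b)) this
        (by fun_prop) rfl
    · intro a
      refine ⟨η / (ρ + 1), by positivity, fun b hab hb => ?_⟩
      have h1 : ‖T a - T b‖ ≤ ρ * (b - a) := by
        have := hL a b
        rwa [abs_sub_comm, abs_of_pos (sub_pos.2 hab)] at this
      have h2 : ‖T a - T b‖ < η := by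
        have h3 : b - a < η / (ρ + 1) := by linarith
        rw [lt_div_iff₀ (by positivity)] at h3
        nlinarith
      have := h _ _ (hT a) (hT b) h2
      nlinarith
  have key2 : ∀ x y, x ≤ y → InnerProductGeometry.angle (T x) (T y) ≤ ρ * (y - x) := by
    intro x y hxy
    have hlim : Tendsto (fun κ : ℝ => κ * ρ * y - κ * ρ * x) (𝓝[>] 1) (𝓝 (1 * ρ * y - 1 * ρ * x)) :=
      (Continuous.tendsto (by fun_prop) _).mono_left nhdsWithin_le_nhds
    have := ge_of_tendsto hlim (eventually_mem_nhdsWithin.mono fun κ hκ => key κ hκ x y hxy)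
    linarith
  rcases le_total x y with h | h
  · rw [abs_sub_comm, abs_of_nonneg (sub_nonneg.2 h)]; exact key2 x y h
  · rw [abs_of_nonneg (sub_nonneg.2 h), InnerProductGeometry.angle_comm]; exact key2 y x h

theorem cos_le_inner_of_angle_le {x y : E} {a : ℝ} (hx : ‖x‖ = 1) (hy : ‖y‖ = 1)
    (h : InnerProductGeometry.angle x y ≤ a) (ha : a ≤ Real.pi) : Real.cos a ≤ ⟪x, y⟫ := by
  have hc : ⟪x, y⟫ = Real.cos (InnerProductGeometry.angle x y) := by
    rw [InnerProductGeometry.cos_angle, hx, hy]; simp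
  rw [hc]
  exact Real.cos_le_cos_of_nonneg_of_le_pi (InnerProductGeometry.angle_nonneg _ _) ha h

theorem norm_normalize_sub_le {x y : E} {m : ℝ} (hm : 0 < m) (hx : m ≤ ‖x‖) (hy : m ≤ ‖y‖) :
    ‖‖x‖⁻¹ • x - ‖y‖⁻¹ • y‖ ≤ ‖x - y‖ / m := by
  have hx0 : 0 < ‖x‖ := hm.trans_le hx
  have hy0 : 0 < ‖y‖ := hm.trans_le hy
  rw [le_div_iff₀ hm]
  refine (pow_le_pow_iff_left₀ (by positivity) (norm_nonneg _) two_ne_zero).1 ?_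
  have h1 : ‖‖x‖⁻¹ • x - ‖y‖⁻¹ • y‖ ^ 2 = 2 - 2 * (‖x‖⁻¹ * ‖y‖⁻¹ * ⟪x, y⟫) := by
    rw [norm_sub_sq_real, norm_smul, norm_smul, norm_inv, norm_inv, norm_norm, norm_norm,
      inv_mul_cancel₀ hx0.ne', inv_mul_cancel₀ hy0.ne', real_inner_smul_left,
      real_inner_smul_right]
    ring
  have h2 : ‖x - y‖ ^ 2 = (‖x‖ - ‖y‖) ^ 2
      + ‖x‖ * ‖y‖ * ‖‖x‖⁻¹ • x - ‖y‖⁻¹ • y‖ ^ 2 := by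
    rw [h1, norm_sub_sq_real]; field_simp; ring
  have h3 : m ^ 2 ≤ ‖x‖ * ‖y‖ := by nlinarith
  rw [mul_pow]
  nlinarith [sq_nonneg (‖x‖ - ‖y‖), sq_nonneg ‖‖x‖⁻¹ • x - ‖y‖⁻¹ • y‖]

end Sphere

section BallRadius

theorem sub_le_sub_of_hasDerivAt_le {F G F' G' : ℝ → ℝ} {a b : ℝ} (hab : a ≤ b)
    (hF : ∀ x, HasDerivAt F (F' x) x) (hG : ∀ x, HasDerivAt G (G' x) x)
    (h : ∀ x ∈ Icc a b, F' x ≤ G' x) : F b - F a ≤ G b - G a := by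
  have hd : ∀ x, HasDerivAt (fun x => G x - F x) (G' x - F' x) x := fun x => (hG x).sub (hF x)
  have hmono : MonotoneOn (fun x => G x - F x) (Icc a b) := by
    apply monotoneOn_of_deriv_nonneg (convex_Icc a b)
    · exact fun x _ => (hd x).continuousAt.continuousWithinAt
    · exact fun x _ => (hd x).differentiableAt.differentiableWithinAt
    · intro x hx
      rw [(hd x).deriv]
      exact sub_nonneg.2 (h x (interior_subset hx))
  have := hmono (left_mem_Icc.2 hab) (right_mem_Icc.2 hab) hab
  simp only at this
  linarith

section Local

variable {E : Type*} [NormedAddCommGroup E] [InnerProductSpace ℝ E]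

theorem sq_inner_add_sq_inner_le {u w x : E} (hu : ‖u‖ = 1) (hw : ‖w‖ = 1) (huw : ⟪w, u⟫ = 0) :
    ⟪x, u⟫ ^ 2 + ⟪x, w⟫ ^ 2 ≤ ‖x‖ ^ 2 := by
  have huw' : ⟪u, w⟫ = 0 := by rw [real_inner_comm]; exact huw
  have h : ‖x - ⟪x, u⟫ • u - ⟪x, w⟫ • w‖ ^ 2 = ‖x‖ ^ 2 - (⟪x, u⟫ ^ 2 + ⟪x, w⟫ ^ 2) := by
    rw [norm_sub_sq_real, norm_sub_sq_real]
    simp only [inner_sub_left, real_inner_smul_left, real_inner_smul_right, norm_smul, hu, hw,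
      huw', Real.norm_eq_abs, mul_one, sq_abs]
    ring
  nlinarith [sq_nonneg ‖x - ⟪x, u⟫ • u - ⟪x, w⟫ • w‖]

theorem norm_sub_smul_lt_iff {x w : E} {r : ℝ} (hr : 0 < r) (hw : ‖w‖ = 1) :
    ‖x - r • w‖ < r ↔ ‖x‖ ^ 2 < 2 * r * ⟪x, w⟫ := by
  rw [← pow_lt_pow_iff_left₀ (norm_nonneg _) hr.le two_ne_zero, norm_sub_sq_real,
    real_inner_smul_right, norm_smul, hw, Real.norm_eq_abs, mul_one, sq_abs]
  constructor <;> intro h <;> linarith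

/-- A unit-speed curve of curvature at most `ρ` moves forward and stays outside the tangent balls
of radius `1 / ρ` up to length `π / (2ρ)`. -/
theorem local_ball_forward {g T : ℝ → E} {ρ : ℝ} (hρ : 0 < ρ)
    (hg : ∀ x, HasDerivAt g (T x) x) (hT : ∀ x, ‖T x‖ = 1)
    (hang : ∀ x y, InnerProductGeometry.angle (T x) (T y) ≤ ρ * |x - y|)
    {s t : ℝ} (hst : s < t) (hts : t - s ≤ Real.pi / (2 * ρ)) :
    0 < ⟪g t - g s, T s⟫ ∧ ∀ w : E, ‖w‖ = 1 → ⟪w, T s⟫ = 0 →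
      2 / ρ * ⟪g t - g s, w⟫ ≤ ‖g t - g s‖ ^ 2 := by
  have hpi : ρ * (t - s) ≤ Real.pi / 2 := by
    rw [le_div_iff₀ (by positivity)] at hts; linarith
  have hpos : 0 < ρ * (t - s) := mul_pos hρ (sub_pos.2 hst)
  have hinner : ∀ v x, HasDerivAt (fun x => ⟪g x, v⟫) ⟪T x, v⟫ x := fun v x => by
    simpa using (hg x).inner ℝ (hasDerivAt_const x v)
  have hcos : ∀ x ∈ Icc s t, Real.cos (ρ * (x - s)) ≤ ⟪T x, T s⟫ := by
    intro x hx
    have h1 := hang x s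
    rw [abs_of_nonneg (sub_nonneg.2 hx.1)] at h1
    refine cos_le_inner_of_angle_le (hT x) (hT s) h1 ?_
    have : ρ * (x - s) ≤ ρ * (t - s) := by have := hx.2; gcongr
    linarith [Real.pi_pos]
  have hcos0 : ∀ x ∈ Icc s t, 0 ≤ Real.cos (ρ * (x - s)) ∧ 0 ≤ Real.sin (ρ * (x - s)) := by
    intro x hx
    have h2 : 0 ≤ ρ * (x - s) := mul_nonneg hρ.le (sub_nonneg.2 hx.1)
    have : ρ * (x - s) ≤ ρ * (t - s) := by have := hx.2; gcongr
    exact ⟨Real.cos_nonneg_of_neg_pi_div_two_le_of_le (by linarith [Real.pi_pos]) (by linarith),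
      Real.sin_nonneg_of_nonneg_of_le_pi h2 (by linarith [Real.pi_pos])⟩
  have hd1 : ∀ x, HasDerivAt (fun x => Real.sin (ρ * (x - s)) / ρ) (Real.cos (ρ * (x - s))) x := by
    intro x
    have h := (((hasDerivAt_id x).sub_const s).const_mul ρ).sin.div_const ρ
    simpa [hρ.ne'] using h
  have hd2 : ∀ x, HasDerivAt (fun x => -Real.cos (ρ * (x - s)) / ρ)
      (Real.sin (ρ * (x - s))) x := by
    intro x
    have h := (((hasDerivAt_id x).sub_const s).const_mul ρ).cos.neg.div_const ρ
    simpa [hρ.ne'] using h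
  have hA : Real.sin (ρ * (t - s)) / ρ ≤ ⟪g t - g s, T s⟫ := by
    have := sub_le_sub_of_hasDerivAt_le hst.le hd1 (hinner (T s)) hcos
    simpa [inner_sub_left] using this
  have hsin : 0 < Real.sin (ρ * (t - s)) :=
    Real.sin_pos_of_pos_of_lt_pi hpos (by linarith [Real.pi_pos])
  refine ⟨lt_of_lt_of_le (by positivity) hA, fun w hw hws => ?_⟩
  have hB : ⟪g t - g s, w⟫ ≤ (1 - Real.cos (ρ * (t - s))) / ρ := by
    have := sub_le_sub_of_hasDerivAt_le hst.le (hinner w) hd2 (fun x hx => by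
      have h1 := sq_inner_add_sq_inner_le (x := T x) (hT s) hw hws
      rw [hT x] at h1
      have h2 := hcos x hx
      obtain ⟨h3, h4⟩ := hcos0 x hx
      refine le_of_sq_le_sq ?_ h4
      have h5 : Real.cos (ρ * (x - s)) ^ 2 ≤ ⟪T x, T s⟫ ^ 2 := by gcongr
      have h6 := Real.sin_sq_add_cos_sq (ρ * (x - s))
      linarith)
    rw [← inner_sub_left] at this
    refine this.trans (le_of_eq ?_)
    simp
    ring
  have h1 := sq_inner_add_sq_inner_le (x := g t - g s) (hT s) hw hws
  set A := ⟪g t - g s, T s⟫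
  set B := ⟪g t - g s, w⟫
  have hc := (hcos0 t (right_mem_Icc.2 hst.le)).1
  have h6 := Real.sin_sq_add_cos_sq (ρ * (t - s))
  rw [div_le_iff₀ hρ] at hA
  rw [le_div_iff₀ hρ] at hB
  rw [div_mul_eq_mul_div, div_le_iff₀ hρ]
  have h7 : Real.sin (ρ * (t - s)) ^ 2 ≤ (A * ρ) ^ 2 := by gcongr
  have h8 : Real.cos (ρ * (t - s)) ^ 2 ≤ (1 - B * ρ) ^ 2 := by
    apply pow_le_pow_left₀ hc; linarith
  have h9 : 2 * B * ρ ≤ (A ^ 2 + B ^ 2) * ρ ^ 2 := by nlinarith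
  have h10 : 2 * B ≤ (A ^ 2 + B ^ 2) * ρ := by
    by_contra hcon
    push Not at hcon
    nlinarith
  nlinarith

theorem local_ball {g T : ℝ → E} {ρ : ℝ} (hρ : 0 < ρ)
    (hg : ∀ x, HasDerivAt g (T x) x) (hT : ∀ x, ‖T x‖ = 1)
    (hang : ∀ x y, InnerProductGeometry.angle (T x) (T y) ≤ ρ * |x - y|)
    {s t : ℝ} (hst : s ≠ t) (hts : |t - s| ≤ Real.pi / (2 * ρ)) :
    ⟪g t - g s, T s⟫ ≠ 0 ∧ ∀ w : E, ‖w‖ = 1 → ⟪w, T s⟫ = 0 →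
      2 / ρ * ⟪g t - g s, w⟫ ≤ ‖g t - g s‖ ^ 2 := by
  rcases hst.lt_or_gt with h | h
  · rw [abs_of_pos (sub_pos.2 h)] at hts
    have := local_ball_forward hρ hg hT hang h hts
    exact ⟨this.1.ne', this.2⟩
  · rw [abs_of_neg (sub_neg.2 h)] at hts
    have := local_ball_forward (g := fun x => g (-x)) (T := fun x => -T (-x)) hρ
      (fun x => by
        simpa [Function.comp_def] using (hg (-x)).scomp x (hasDerivAt_neg x)) (fun x => by simp [hT])
      (fun x y => by
        rw [InnerProductGeometry.angle_neg_neg]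
        refine (hang _ _).trans (le_of_eq ?_)
        rw [show -x - -y = -(x - y) by ring, abs_neg]) (s := -s) (t := -t) (by linarith)
        (by linarith)
    simp only [neg_neg, inner_neg_right, neg_eq_zero] at this
    exact ⟨fun h0 => by simp [h0] at this, this.2⟩

theorem two_mul_inner_lt {x u w : E} {ρ R : ℝ} (hR0 : 0 ≤ R) (hR : R < 1 / ρ)
    (hx : ⟪x, u⟫ ≠ 0) (h : 2 / ρ * ⟪x, w⟫ ≤ ‖x‖ ^ 2) : 2 * R * ⟪x, w⟫ < ‖x‖ ^ 2 := by
  have hx0 : x ≠ 0 := fun h0 => hx (by simp [h0])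
  rcases le_or_gt ⟪x, w⟫ 0 with h1 | h1
  · have : 0 < ‖x‖ ^ 2 := by positivity
    nlinarith
  · have : 2 / ρ = 2 * (1 / ρ) := by ring
    rw [this] at h
    nlinarith

/-- If a point is at distance `R < 1 / ρ` from `o` along a normal direction, moving `o` towards
that point produces a nearby foot point at distance less than `R`. -/
theorem eventually_exists_foot {g T : ℝ → E} {ρ : ℝ} (hρ : 0 < ρ)
    (hg : ∀ x, HasDerivAt g (T x) x) (hT : ∀ x, ‖T x‖ = 1)
    (hang : ∀ x y, InnerProductGeometry.angle (T x) (T y) ≤ ρ * |x - y|)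
    {s R h : ℝ} {o v : E} (hR0 : 0 < R) (hR : R < 1 / ρ) (hso : ‖g s - o‖ = R)
    (hperp : ⟪g s - o, T s⟫ = 0) (hv : 0 < ⟪v, g s - o⟫) (hh : 0 < h) :
    ∀ᶠ ε : ℝ in 𝓝[>] 0, ∃ s', |s' - s| ≤ h ∧ ⟪g s' - (o + ε • v), T s'⟫ = 0 ∧
      ‖g s' - (o + ε • v)‖ < R := by
  obtain ⟨h', hh'0, hh'1, hh'2⟩ : ∃ h', 0 < h' ∧ h' ≤ h ∧ h' ≤ Real.pi / (2 * ρ) :=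
    ⟨min h (Real.pi / (2 * ρ)), lt_min hh (by positivity), min_le_left _ _, min_le_right _ _⟩
  have hfar : ∀ t, s ≠ t → |t - s| ≤ h' → R < ‖g t - o‖ := by
    intro t hst ht
    obtain ⟨h1, h2⟩ := local_ball hρ hg hT hang hst (ht.trans hh'2)
    have h3 := h2 (-(R⁻¹ • (g s - o)))
      (by rw [norm_neg, norm_smul, hso, Real.norm_of_nonneg (by positivity)]; field_simp)
      (by rw [inner_neg_left, real_inner_smul_left, hperp]; simp)
    have h4 := two_mul_inner_lt hR0.le hR h1 h3
    rw [inner_neg_right, real_inner_smul_right] at h4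
    have h5 : -⟪g t - g s, g s - o⟫ * 2 < ‖g t - g s‖ ^ 2 := by
      have : 2 * R * -(R⁻¹ * ⟪g t - g s, g s - o⟫) = -⟪g t - g s, g s - o⟫ * 2 := by
        field_simp
      linarith
    refine lt_of_pow_lt_pow_left₀ 2 (norm_nonneg _) ?_
    have h6 : g t - o = (g t - g s) + (g s - o) := by abel
    rw [h6, norm_add_sq_real, hso]
    linarith
  have hcont : ∀ x, Continuous fun ε : ℝ => ‖g x - (o + ε • v)‖ := fun x => by fun_prop
  have hnear : ∀ᶠ ε : ℝ in 𝓝[>] 0, ‖g s - (o + ε • v)‖ < R := by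
    have h1 : ∀ᶠ ε : ℝ in 𝓝[>] 0, ε * ‖v‖ ^ 2 < 2 * ⟪v, g s - o⟫ := by
      have : Tendsto (fun ε : ℝ => ε * ‖v‖ ^ 2) (𝓝[>] 0) (𝓝 (0 * ‖v‖ ^ 2)) :=
        (Continuous.tendsto (by fun_prop) _).mono_left nhdsWithin_le_nhds
      rw [zero_mul] at this
      exact this.eventually (gt_mem_nhds (by positivity))
    filter_upwards [h1, self_mem_nhdsWithin] with ε h2 h3
    have h3' : (0 : ℝ) < ε := h3
    refine lt_of_pow_lt_pow_left₀ 2 hR0.le ?_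
    rw [← sub_sub, norm_sub_sq_real, hso, real_inner_smul_right, real_inner_comm, norm_smul,
      mul_pow, Real.norm_eq_abs, sq_abs]
    nlinarith
  have hend : ∀ x, R < ‖g x - o‖ → ∀ᶠ ε : ℝ in 𝓝[>] 0, R < ‖g x - (o + ε • v)‖ := by
    intro x hx
    have : Tendsto (fun ε : ℝ => ‖g x - (o + ε • v)‖) (𝓝[>] 0) (𝓝 ‖g x - (o + (0 : ℝ) • v)‖) :=
      ((hcont x).tendsto 0).mono_left nhdsWithin_le_nhds
    simp only [zero_smul, add_zero] at this
    exact this.eventually (lt_mem_nhds hx)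
  filter_upwards [hnear, hend (s - h') (hfar _ (by linarith) (by simp [abs_of_pos hh'0])),
    hend (s + h') (hfar _ (by linarith) (by simp [abs_of_pos hh'0]))] with ε h1 h2 h3
  have hgc : Continuous g := continuous_iff_continuousAt.2 fun x => (hg x).continuousAt
  obtain ⟨s', hs', hmin⟩ := isCompact_Icc.exists_isMinOn (s := Icc (s - h') (s + h'))
    ⟨s, by constructor <;> linarith⟩
    (f := fun x => ‖g x - (o + ε • v)‖ ^ 2) (by fun_prop)
  have hval : ‖g s' - (o + ε • v)‖ < R := by
    have := hmin (show s ∈ Icc (s - h') (s + h') by constructor <;> linarith)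
    have h4 := (pow_le_pow_iff_left₀ (norm_nonneg _) (norm_nonneg _) two_ne_zero).1 this
    exact h4.trans_lt h1
  have hint : s' ∈ Ioo (s - h') (s + h') := by
    refine ⟨lt_of_le_of_ne hs'.1 ?_, lt_of_le_of_ne hs'.2 ?_⟩
    · rintro rfl; linarith
    · rintro rfl; linarith
  refine ⟨s', ?_, ?_, hval⟩
  · rw [abs_le]; constructor <;> linarith [hs'.1, hs'.2]
  · have hloc : IsLocalMin (fun x => ‖g x - (o + ε • v)‖ ^ 2) s' :=
      hmin.isLocalMin (Icc_mem_nhds hint.1 hint.2)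
    have hd : HasDerivAt (fun x => ‖g x - (o + ε • v)‖ ^ 2)
        (2 * ⟪g s' - (o + ε • v), T s'⟫) s' := ((hg s').sub_const _).norm_sq
    have := hloc.hasDerivAt_eq_zero hd
    linarith

end Local
end BallRadius

namespace Knot

variable {n : ℕ} (k : Knot n)

theorem continuous_f : Continuous k.f :=
  continuous_iff_continuousAt.2 fun x => (k.deriv x).continuousAt

theorem continuous_fd : Continuous k.fd := by
  obtain ⟨C, hC⟩ := k.lipd
  exact hC.continuous

theorem f_add_int (s : ℝ) (m : ℤ) : k.f (s + m * k.L) = k.f s :=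
  (Function.Periodic.int_mul (f := k.f) (c := k.L) k.per m) s

theorem fd_add_int (s : ℝ) (m : ℤ) : k.fd (s + m * k.L) = k.fd s :=
  (Function.Periodic.int_mul (f := k.fd) (c := k.L) k.perd m) s

theorem exists_int_mem_Ico (a s : ℝ) : ∃ m : ℤ, s + m * k.L ∈ Ico a (a + k.L) := by
  refine ⟨-toIcoDiv k.Lpos a s, ?_⟩
  have := toIcoMod_mem_Ico k.Lpos a s
  rw [toIcoMod, zsmul_eq_mul] at this
  convert this using 1
  push_cast
  ring

theorem exists_int_of_f_eq {x y : ℝ} (h : k.f x = k.f y) : ∃ m : ℤ, y = x + m * k.L := by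
  obtain ⟨a, ha⟩ := k.exists_int_mem_Ico 0 x
  obtain ⟨b, hb⟩ := k.exists_int_mem_Ico 0 y
  rw [zero_add] at ha hb
  have := k.inj ha hb (by rw [k.f_add_int, k.f_add_int, h])
  refine ⟨a - b, ?_⟩
  push_cast
  linarith

theorem f_ne_of_lt {x y : ℝ} (h1 : x < y) (h2 : y < x + k.L) : k.f x ≠ k.f y := by
  intro h
  obtain ⟨m, hm⟩ := k.exists_int_of_f_eq h
  have hL := k.Lpos
  have h3 : 0 < (m : ℝ) := by
    by_contra hcon
    push Not at hcon
    nlinarith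
  have h4 : (m : ℝ) < 1 := by
    by_contra hcon
    push Not at hcon
    nlinarith
  norm_cast at h3 h4
  omega

theorem norm_f_sub_le (x y : ℝ) : ‖k.f x - k.f y‖ ≤ |x - y| := by
  have := Convex.norm_image_sub_le_of_norm_hasDerivWithin_le (f := k.f) (f' := k.fd) (C := 1)
    (s := univ) (x := y) (y := x) (fun z _ => (k.deriv z).hasDerivWithinAt)
    (fun z _ => (k.unit z).le) convex_univ (mem_univ _) (mem_univ _)
  simpa using this

/-- The pairs entering the definition of `MDC`. -/
def IsDoubleCritical (x y : ℝ) : Prop :=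
  k.f x ≠ k.f y ∧ ⟪k.f x - k.f y, k.fd x⟫ = 0 ∧ ⟪k.f x - k.f y, k.fd y⟫ = 0

variable {k} in
theorem IsDoubleCritical.symm {x y : ℝ} (h : k.IsDoubleCritical x y) :
    k.IsDoubleCritical y x := by
  obtain ⟨h1, h2, h3⟩ := h
  refine ⟨h1.symm, ?_, ?_⟩ <;> rw [← neg_sub, inner_neg_left] <;> simp [h2, h3]

theorem isDoubleCritical_add_int (x y : ℝ) (a b : ℤ) :
    k.IsDoubleCritical (x + a * k.L) (y + b * k.L) ↔ k.IsDoubleCritical x y := by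
  simp only [IsDoubleCritical, f_add_int, fd_add_int]

theorem exists_isDoubleCritical : ∃ x y, k.IsDoubleCritical x y := by
  have hf := k.continuous_f
  obtain ⟨⟨x, y⟩, -, hmax⟩ := (isCompact_Icc.prod isCompact_Icc).exists_isMaxOn
    (s := Icc 0 k.L ×ˢ Icc 0 k.L) ⟨(0, 0), by simp [k.Lpos.le]⟩
    (f := fun z : ℝ × ℝ => ‖k.f z.1 - k.f z.2‖ ^ 2) (by fun_prop)
  have hglob : ∀ a b, ‖k.f a - k.f b‖ ^ 2 ≤ ‖k.f x - k.f y‖ ^ 2 := by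
    intro a b
    obtain ⟨i, hi⟩ := k.exists_int_mem_Ico 0 a
    obtain ⟨j, hj⟩ := k.exists_int_mem_Ico 0 b
    rw [zero_add] at hi hj
    have := hmax (show (a + i * k.L, b + j * k.L) ∈ Icc 0 k.L ×ˢ Icc 0 k.L from
      ⟨Ico_subset_Icc_self hi, Ico_subset_Icc_self hj⟩)
    simpa [f_add_int] using this
  refine ⟨x, y, ?_, ?_, ?_⟩
  · intro h
    have h1 := hglob 0 (k.L / 2)
    rw [h, sub_self, norm_zero] at h1
    have h2 : k.f 0 - k.f (k.L / 2) ≠ 0 :=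
      sub_ne_zero.2 (k.f_ne_of_lt (by linarith [k.Lpos]) (by linarith [k.Lpos]))
    have : 0 < ‖k.f 0 - k.f (k.L / 2)‖ ^ 2 := by positivity
    linarith
  · have hd : HasDerivAt (fun a => ‖k.f a - k.f y‖ ^ 2) (2 * ⟪k.f x - k.f y, k.fd x⟫) x :=
      ((k.deriv x).sub_const _).norm_sq
    have hm : IsLocalMax (fun a => ‖k.f a - k.f y‖ ^ 2) x :=
      Eventually.of_forall fun a => hglob a y
    have := hm.hasDerivAt_eq_zero hd
    linarith
  · have hd : HasDerivAt (fun a => ‖k.f x - k.f a‖ ^ 2) (2 * ⟪k.f x - k.f y, -k.fd y⟫) y :=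
      ((k.deriv y).const_sub _).norm_sq
    have hm : IsLocalMax (fun a => ‖k.f x - k.f a‖ ^ 2) y :=
      Eventually.of_forall fun a => hglob x a
    have := hm.hasDerivAt_eq_zero hd
    rw [inner_neg_right] at this
    linarith

/-- The radii of balls tangent to the curve that meet the curve. -/
def radii : Set ℝ := {r : ℝ | 0 < r ∧ ∃ s ∈ (univ : Set ℝ), ∃ t ∈ (univ : Set ℝ), ∃ w : Euc n,
    ‖w‖ = 1 ∧ ⟪w, k.fd s⟫ = 0 ∧ ‖k.f t - k.f s - r • w‖ < r}

theorem RO_eq : RO k.f k.fd univ = sInf k.radii := rfl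

theorem bddBelow_radii : BddBelow k.radii := ⟨0, fun _ h => h.1.le⟩

theorem mem_radii_of_isDoubleCritical {x y r : ℝ} (h : k.IsDoubleCritical x y)
    (hr : ‖k.f x - k.f y‖ / 2 < r) : r ∈ k.radii := by
  have hD : 0 < ‖k.f x - k.f y‖ := norm_pos_iff.2 (sub_ne_zero.2 h.1)
  have hr0 : 0 < r := by linarith
  refine ⟨hr0, y, mem_univ _, x, mem_univ _, ‖k.f x - k.f y‖⁻¹ • (k.f x - k.f y), ?_, ?_, ?_⟩
  · rw [norm_smul, norm_inv, norm_norm, inv_mul_cancel₀ hD.ne']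
  · rw [real_inner_smul_left, h.2.2, mul_zero]
  · rw [norm_sub_smul_lt_iff hr0
      (by rw [norm_smul, norm_inv, norm_norm, inv_mul_cancel₀ hD.ne']), real_inner_smul_right,
      real_inner_self_eq_norm_sq]
    have : 2 * r * (‖k.f x - k.f y‖⁻¹ * ‖k.f x - k.f y‖ ^ 2) = 2 * r * ‖k.f x - k.f y‖ := by
      field_simp
    rw [this]
    nlinarith

theorem radii_nonempty : k.radii.Nonempty := by
  obtain ⟨x, y, h⟩ := k.exists_isDoubleCritical
  exact ⟨_, k.mem_radii_of_isDoubleCritical h (lt_add_one _)⟩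

theorem two_mul_RO_le {x y : ℝ} (h : k.IsDoubleCritical x y) :
    2 * RO k.f k.fd univ ≤ ‖k.f x - k.f y‖ := by
  have : RO k.f k.fd univ ≤ ‖k.f x - k.f y‖ / 2 :=
    le_of_forall_gt_imp_ge_of_dense fun r hr =>
      csInf_le k.bddBelow_radii (k.mem_radii_of_isDoubleCritical h hr)
  linarith

theorem RO_nonneg : 0 ≤ RO k.f k.fd univ := Real.sInf_nonneg fun _ h => h.1.le

theorem two_mul_RO_mul_inner_le (s t : ℝ) {w : Euc n} (hw : ‖w‖ = 1) (hws : ⟪w, k.fd s⟫ = 0) :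
    2 * RO k.f k.fd univ * ⟪k.f t - k.f s, w⟫ ≤ ‖k.f t - k.f s‖ ^ 2 := by
  by_contra! h
  have hRO := k.RO_nonneg
  have hin : 0 < ⟪k.f t - k.f s, w⟫ := by
    by_contra! h1
    nlinarith [sq_nonneg ‖k.f t - k.f s‖]
  have hlim : Tendsto (fun r : ℝ => 2 * r * ⟪k.f t - k.f s, w⟫) (𝓝[<] (RO k.f k.fd univ))
      (𝓝 (2 * RO k.f k.fd univ * ⟪k.f t - k.f s, w⟫)) :=
    (Continuous.tendsto (by fun_prop) _).mono_left nhdsWithin_le_nhds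
  obtain ⟨r, hr1, hr2⟩ := ((hlim.eventually (lt_mem_nhds h)).and self_mem_nhdsWithin).exists
  have hr2' : r < RO k.f k.fd univ := hr2
  have hr0 : 0 < r := by
    by_contra! h1
    nlinarith [sq_nonneg ‖k.f t - k.f s‖]
  have : RO k.f k.fd univ ≤ r := csInf_le k.bddBelow_radii
    ⟨hr0, s, mem_univ _, t, mem_univ _, w, hw, hws, (norm_sub_smul_lt_iff hr0 hw).2 hr1⟩
  linarith

/-- If the ball radius is smaller than the curvature radius bound, it is attained
in the limit by a tangent ball with another curve point on its boundary. -/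
theorem exists_tangent_ball {ρ : ℝ} (hρ : 0 < ρ)
    (hang : ∀ x y, InnerProductGeometry.angle (k.fd x) (k.fd y) ≤ ρ * |x - y|)
    (hRO : RO k.f k.fd univ < 1 / ρ) :
    ∃ s t : ℝ, ∃ w : Euc n, ‖w‖ = 1 ∧ ⟪w, k.fd s⟫ = 0 ∧ k.f s ≠ k.f t ∧
      ‖k.f t - k.f s‖ ^ 2 ≤ 2 * RO k.f k.fd univ * ⟪k.f t - k.f s, w⟫ := by
  obtain ⟨u, -, hu, hmem⟩ := exists_seq_tendsto_sInf k.radii_nonempty k.bddBelow_radii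
  rw [← k.RO_eq] at hu
  have hex : ∀ i, ∃ z : ℝ × ℝ × Euc n, z ∈ Icc 0 k.L ×ˢ Icc 0 k.L ×ˢ Metric.sphere 0 1 ∧
      ⟪z.2.2, k.fd z.1⟫ = 0 ∧
      ‖k.f z.2.1 - k.f z.1‖ ^ 2 < 2 * u i * ⟪k.f z.2.1 - k.f z.1, z.2.2⟫ := by
    intro i
    obtain ⟨h0, s, -, t, -, w, hw, hws, h⟩ := hmem i
    obtain ⟨a, ha⟩ := k.exists_int_mem_Ico 0 s
    obtain ⟨b, hb⟩ := k.exists_int_mem_Ico 0 t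
    rw [zero_add] at ha hb
    refine ⟨(s + a * k.L, t + b * k.L, w), ⟨Ico_subset_Icc_self ha, Ico_subset_Icc_self hb,
      by simpa using hw⟩, ?_, ?_⟩
    · simpa [fd_add_int] using hws
    · simpa [f_add_int] using (norm_sub_smul_lt_iff h0 hw).1 h
  choose z hz1 hz2 hz3 using hex
  obtain ⟨⟨s, t, w⟩, hzK, φ, hφ, hlim⟩ := (isCompact_Icc.prod (isCompact_Icc.prod
    (isCompact_sphere (0 : Euc n) 1))).tendsto_subseq hz1
  have hf := k.continuous_f
  have hfd := k.continuous_fd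
  have hw : ‖w‖ = 1 := by simpa using hzK.2.2
  have hu' : Tendsto (fun i => u (φ i)) atTop (𝓝 (RO k.f k.fd univ)) :=
    hu.comp hφ.tendsto_atTop
  have hlim' : Tendsto (fun i => z (φ i)) atTop (𝓝 (s, t, w)) := hlim
  refine ⟨s, t, w, hw, ?_, ?_, ?_⟩
  · have hc : Continuous fun y : ℝ × ℝ × Euc n => ⟪y.2.2, k.fd y.1⟫ := by fun_prop
    have := (hc.tendsto _).comp hlim'
    exact tendsto_nhds_unique this (by simp [Function.comp_def, hz2])
  · intro heq
    obtain ⟨m, hm⟩ := k.exists_int_of_f_eq heq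
    have hlim1 : Tendsto (fun i => |(z (φ i)).2.1 - ((z (φ i)).1 + m * k.L)|) atTop (𝓝 0) := by
      have hc : Continuous fun y : ℝ × ℝ × Euc n => |y.2.1 - (y.1 + m * k.L)| := by fun_prop
      have := (hc.tendsto _).comp hlim'
      simpa [hm, Function.comp_def] using this
    have hpos : 0 < Real.pi / (2 * ρ) := by positivity
    obtain ⟨i, hi1, hi2⟩ := ((hlim1.eventually (gt_mem_nhds hpos)).and
      (hu'.eventually (gt_mem_nhds hRO))).exists
    have h3 := hz3 (φ i)
    have hne : (z (φ i)).1 + m * k.L ≠ (z (φ i)).2.1 := by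
      intro h
      rw [← h, k.f_add_int] at h3
      simp at h3
    obtain ⟨h4, h5⟩ := local_ball hρ k.deriv k.unit hang hne hi1.le
    rw [k.f_add_int, k.fd_add_int] at h5 h4
    have h6 := two_mul_inner_lt (hmem (φ i)).1.le hi2 h4
      (h5 _ (by simpa using (hz1 (φ i)).2.2) (hz2 _))
    linarith
  · have hc : Continuous fun y : ℝ × ℝ × Euc n => ‖k.f y.2.1 - k.f y.1‖ ^ 2 := by fun_prop
    have hc2 : Continuous fun y : ℝ × ℝ × Euc n => ⟪k.f y.2.1 - k.f y.1, y.2.2⟫ := by fun_prop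
    have A : Tendsto (fun i => ‖k.f (z (φ i)).2.1 - k.f (z (φ i)).1‖ ^ 2) atTop
      (𝓝 (‖k.f t - k.f s‖ ^ 2)) := by
      have := (hc.tendsto (s, t, w)).comp hlim'
      exact this
    have B : Tendsto (fun i => ⟪k.f (z (φ i)).2.1 - k.f (z (φ i)).1, (z (φ i)).2.2⟫) atTop
      (𝓝 ⟪k.f t - k.f s, w⟫) := by
      have := (hc2.tendsto (s, t, w)).comp hlim'
      exact this
    exact le_of_tendsto_of_tendsto' A ((hu'.const_mul 2).mul B) fun i => (hz3 (φ i)).le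

theorem not_two_feet {R : ℝ} {o : Euc n} {s t : ℝ}
    (hR : R < RO k.f k.fd univ) (hst : k.f s ≠ k.f t) (hs : ⟪k.f s - o, k.fd s⟫ = 0)
    (hsR : ‖k.f s - o‖ = R) (hts : ‖k.f t - o‖ ≤ ‖k.f s - o‖) : False := by
  have hR0 : 0 < R := by
    refine lt_of_le_of_ne (hsR ▸ norm_nonneg _) fun h => hst ?_
    rw [hsR, ← h] at hts
    rw [← h] at hsR
    rw [norm_le_zero_iff, sub_eq_zero] at hts
    rw [norm_eq_zero, sub_eq_zero] at hsR
    rw [hsR, hts]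
  have h := k.two_mul_RO_mul_inner_le s t (w := R⁻¹ • (o - k.f s))
    (by rw [norm_smul, norm_sub_rev, hsR, Real.norm_of_nonneg (by positivity)]; field_simp)
    (by rw [real_inner_smul_left, ← neg_sub, inner_neg_left, hs]; simp)
  rw [real_inner_smul_right] at h
  have h1 : ‖k.f t - o‖ ^ 2 ≤ R ^ 2 := by rw [← hsR]; gcongr
  have h2 : ‖k.f t - o‖ ^ 2 = ‖k.f t - k.f s‖ ^ 2 - 2 * ⟪k.f t - k.f s, o - k.f s⟫ + R ^ 2 := by
    have : k.f t - o = (k.f t - k.f s) - (o - k.f s) := by abel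
    rw [this, norm_sub_sq_real, norm_sub_rev o, hsR]
  have h3 : 0 < ‖k.f t - k.f s‖ ^ 2 := by
    have := norm_pos_iff.2 (sub_ne_zero.2 hst.symm); positivity
  have h4 : 2 * RO k.f k.fd univ * ⟪k.f t - k.f s, o - k.f s⟫ ≤ R * ‖k.f t - k.f s‖ ^ 2 := by
    have : 2 * RO k.f k.fd univ * (R⁻¹ * ⟪k.f t - k.f s, o - k.f s⟫) =
      R⁻¹ * (2 * RO k.f k.fd univ * ⟪k.f t - k.f s, o - k.f s⟫) := by ring
    rw [this, inv_mul_le_iff₀ hR0] at h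
    exact h
  have h5 : ‖k.f t - k.f s‖ ^ 2 ≤ 2 * ⟪k.f t - k.f s, o - k.f s⟫ := by linarith
  nlinarith

/-- When the ball radius is smaller than the curvature radius bound, it is half the length of a
double critical chord. -/
theorem exists_isDoubleCritical_of_RO_lt {ρ : ℝ} (hρ : 0 < ρ)
    (hang : ∀ x y, InnerProductGeometry.angle (k.fd x) (k.fd y) ≤ ρ * |x - y|)
    (hRO : RO k.f k.fd univ < 1 / ρ) :
    0 < RO k.f k.fd univ ∧ ∃ x y, k.IsDoubleCritical x y ∧
      ‖k.f x - k.f y‖ = 2 * RO k.f k.fd univ := by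
  obtain ⟨s, t, w, hw, hws, hst, h⟩ := k.exists_tangent_ball hρ hang hRO
  set R := RO k.f k.fd univ with hRdef
  have hD : 0 < ‖k.f t - k.f s‖ := norm_pos_iff.2 (sub_ne_zero.2 hst.symm)
  have hR0 : 0 < R := by
    refine lt_of_le_of_ne k.RO_nonneg fun h0 => ?_
    rw [← h0] at h
    nlinarith
  refine ⟨hR0, ?_⟩
  set o := k.f s + R • w with ho
  have hsq : ∀ x, ‖k.f x - o‖ ^ 2 =
      ‖k.f x - k.f s‖ ^ 2 - 2 * R * ⟪k.f x - k.f s, w⟫ + R ^ 2 := by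
    intro x
    rw [ho, ← sub_sub, norm_sub_sq_real, real_inner_smul_right, norm_smul, hw, Real.norm_eq_abs,
      mul_one, sq_abs]
    ring
  have hge : ∀ x, R ^ 2 ≤ ‖k.f x - o‖ ^ 2 := fun x => by
    have := k.two_mul_RO_mul_inner_le s x hw hws
    rw [hsq]; linarith
  have htR2 : ‖k.f t - o‖ ^ 2 = R ^ 2 := le_antisymm (by rw [hsq]; linarith) (hge t)
  have htR : ‖k.f t - o‖ = R := (pow_left_inj₀ (norm_nonneg _) hR0.le two_ne_zero).1 htR2
  have hus : k.f s - o = -(R • w) := by rw [ho]; abel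
  have hsR : ‖k.f s - o‖ = R := by
    rw [hus, norm_neg, norm_smul, hw, Real.norm_of_nonneg hR0.le, mul_one]
  have hsp : ⟪k.f s - o, k.fd s⟫ = 0 := by
    rw [hus, inner_neg_left, real_inner_smul_left, hws]; simp
  have htp : ⟪k.f t - o, k.fd t⟫ = 0 := by
    have hd : HasDerivAt (fun a => ‖k.f a - o‖ ^ 2) (2 * ⟪k.f t - o, k.fd t⟫) t :=
      ((k.deriv t).sub_const _).norm_sq
    have hm : IsLocalMin (fun a => ‖k.f a - o‖ ^ 2) t :=
      Eventually.of_forall fun a => by simp only [htR2]; exact hge a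
    have := hm.hasDerivAt_eq_zero hd
    linarith
  by_cases hv : (k.f s - o) + (k.f t - o) = 0
  · have h1 : k.f t - o = -(k.f s - o) := by rw [eq_neg_iff_add_eq_zero, add_comm]; exact hv
    have h2 : k.f s - k.f t = (2 : ℝ) • (k.f s - o) := by
      rw [two_smul]; nth_rw 2 [← neg_neg (k.f s - o)]; rw [← h1]; abel
    have h3 : k.f s - k.f t = -((2 : ℝ) • (k.f t - o)) := by rw [h2, h1, smul_neg, neg_neg]
    refine ⟨s, t, ⟨hst, ?_, ?_⟩, ?_⟩
    · rw [h2, real_inner_smul_left, hsp, mul_zero]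
    · rw [h3, inner_neg_left, real_inner_smul_left, htp]; simp
    · rw [h2, norm_smul, hsR]; simp
  · exfalso
    set v := (k.f s - o) + (k.f t - o) with hvdef
    have hv2 : 0 < ‖v‖ ^ 2 := by have := norm_pos_iff.2 hv; positivity
    have hexp : ‖v‖ ^ 2 = 2 * R ^ 2 + 2 * ⟪k.f s - o, k.f t - o⟫ := by
      rw [hvdef, norm_add_sq_real, hsR, htR]; ring
    have hvs : 0 < ⟪v, k.f s - o⟫ := by
      rw [hvdef, inner_add_left, real_inner_self_eq_norm_sq, hsR, real_inner_comm]; linarith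
    have hvt : 0 < ⟪v, k.f t - o⟫ := by
      rw [hvdef, inner_add_left, real_inner_self_eq_norm_sq, htR]; linarith
    have hh : 0 < ‖k.f t - k.f s‖ / 3 := by positivity
    obtain ⟨ε, ⟨s', hs1, hs2, hs3⟩, ⟨t', ht1, ht2, ht3⟩⟩ :=
      ((eventually_exists_foot hρ k.deriv k.unit hang hR0 hRO hsR hsp hvs hh).and
      (eventually_exists_foot hρ k.deriv k.unit hang hR0 hRO htR htp hvt hh)).exists
    have hne : k.f s' ≠ k.f t' := by
      intro heq
      have h1 := (k.norm_f_sub_le s' s).trans hs1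
      have h2 := (k.norm_f_sub_le t' t).trans ht1
      rw [← heq] at h2
      have h3 : ‖k.f t - k.f s‖ ≤ ‖k.f s' - k.f s‖ + ‖k.f s' - k.f t‖ := by
        have : k.f t - k.f s = (k.f s' - k.f s) - (k.f s' - k.f t) := by abel
        rw [this]; exact norm_sub_le _ _
      linarith
    rcases le_total ‖k.f t' - (o + ε • v)‖ ‖k.f s' - (o + ε • v)‖ with hle | hle
    · exact k.not_two_feet hs3 hne hs2 rfl hle
    · exact k.not_two_feet ht3 hne.symm ht2 rfl hle

end Knot

namespace Knot

variable {n : ℕ} (k : Knot n)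

theorem exists_lipschitz_fd : ∃ C : ℝ, 0 < C ∧ ∀ x y, ‖k.fd x - k.fd y‖ ≤ C * |x - y| := by
  obtain ⟨C, hC⟩ := k.lipd
  refine ⟨C + 1, by positivity, fun x y => ?_⟩
  have := hC.dist_le_mul x y
  rw [dist_eq_norm, Real.dist_eq] at this
  nlinarith [abs_nonneg (x - y)]

theorem RO_pos : 0 < RO k.f k.fd univ := by
  obtain ⟨C, hC0, hC⟩ := k.exists_lipschitz_fd
  rcases lt_or_ge (RO k.f k.fd univ) (1 / C) with h | h
  · exact (k.exists_isDoubleCritical_of_RO_lt hC0 (angle_le_of_norm_sub_le k.unit hC) h).1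
  · exact lt_of_lt_of_le (by positivity) h

theorem abs_sub_inner_le {C : ℝ} (hC : ∀ x y, ‖k.fd x - k.fd y‖ ≤ C * |x - y|) (s t : ℝ) :
    |(t - s) - ⟪k.f t - k.f s, k.fd s⟫| ≤ C ^ 2 * |t - s| ^ 3 / 2 := by
  have hd : ∀ x, HasDerivAt (fun x => x - ⟪k.f x, k.fd s⟫) (1 - ⟪k.fd x, k.fd s⟫) x := fun x =>
    (hasDerivAt_id x).sub (by simpa using (k.deriv x).inner ℝ (hasDerivAt_const x (k.fd s)))
  have hb : ∀ x ∈ uIcc s t, ‖1 - ⟪k.fd x, k.fd s⟫‖ ≤ C ^ 2 * |t - s| ^ 2 / 2 := by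
    intro x hx
    have h1 : ‖k.fd x - k.fd s‖ ^ 2 = 2 * (1 - ⟪k.fd x, k.fd s⟫) := by
      rw [norm_sub_sq_real, k.unit, k.unit]; ring
    have h2 : |x - s| ≤ |t - s| := abs_sub_left_of_mem_uIcc hx
    have hC0 : 0 ≤ C := by simpa using (norm_nonneg _).trans (hC 1 0)
    have h3 : ‖k.fd x - k.fd s‖ ^ 2 ≤ (C * |t - s|) ^ 2 := by
      gcongr
      exact (hC x s).trans (by gcongr)
    rw [Real.norm_of_nonneg (by nlinarith [sq_nonneg ‖k.fd x - k.fd s‖])]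
    rw [mul_pow] at h3
    linarith
  have := Convex.norm_image_sub_le_of_norm_hasDerivWithin_le (s := uIcc s t)
    (fun x _ => (hd x).hasDerivWithinAt) hb (convex_uIcc s t) left_mem_uIcc right_mem_uIcc
  rw [Real.norm_eq_abs, Real.norm_eq_abs] at this
  rw [inner_sub_left]
  calc _ = |t - ⟪k.f t, k.fd s⟫ - (s - ⟪k.f s, k.fd s⟫)| := by congr 1; ring
    _ ≤ _ := this
    _ = _ := by ring

theorem norm_smul_fd_sub_le {C : ℝ} (hC : ∀ x y, ‖k.fd x - k.fd y‖ ≤ C * |x - y|) (s t : ℝ) :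
    ‖(t - s) • k.fd s - (k.f t - k.f s)‖ ≤
      C ^ 2 * |t - s| ^ 3 / 2 + |t - s| ^ 2 / (2 * RO k.f k.fd univ) := by
  have hr := k.RO_pos
  set Δ := k.f t - k.f s with hΔ
  set q := Δ - ⟪Δ, k.fd s⟫ • k.fd s with hq
  have hqs : ⟪q, k.fd s⟫ = 0 := by
    rw [hq, inner_sub_left, real_inner_smul_left, real_inner_self_eq_norm_sq, k.unit]; ring
  have hqle : ‖q‖ ≤ |t - s| ^ 2 / (2 * RO k.f k.fd univ) := by
    rcases eq_or_ne q 0 with h0 | h0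
    · rw [h0, norm_zero]; positivity
    · have hq0 : 0 < ‖q‖ := norm_pos_iff.2 h0
      have h1 := k.two_mul_RO_mul_inner_le s t (w := ‖q‖⁻¹ • q)
        (by rw [norm_smul, norm_inv, norm_norm, inv_mul_cancel₀ hq0.ne'])
        (by rw [real_inner_smul_left, hqs, mul_zero])
      have h2 : ⟪Δ, ‖q‖⁻¹ • q⟫ = ‖q‖ := by
        have : Δ = q + ⟪Δ, k.fd s⟫ • k.fd s := by rw [hq]; abel
        rw [this, inner_add_left, real_inner_smul_left, real_inner_smul_right,
          real_inner_smul_right, real_inner_comm q (k.fd s), hqs, real_inner_self_eq_norm_sq]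
        field_simp
        simp
      rw [← hΔ, h2] at h1
      rw [le_div_iff₀ (by positivity)]
      have h3 : ‖Δ‖ ^ 2 ≤ |t - s| ^ 2 := by gcongr; exact k.norm_f_sub_le t s
      linarith
  have : (t - s) • k.fd s - Δ = ((t - s) - ⟪Δ, k.fd s⟫) • k.fd s - q := by
    rw [hq]; module
  rw [this]
  refine (norm_sub_le _ _).trans (add_le_add ?_ hqle)
  rw [norm_smul, k.unit, mul_one]
  exact k.abs_sub_inner_le hC s t

theorem norm_fd_sub_le (x y : ℝ) :
    ‖k.fd x - k.fd y‖ ≤ 1 / RO k.f k.fd univ * |x - y| := by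
  wlog hxy : x ≤ y generalizing x y
  · rw [norm_sub_rev, abs_sub_comm]; exact this y x (by linarith)
  have hr := k.RO_pos
  obtain ⟨C, hC0, hC⟩ := k.exists_lipschitz_fd
  rw [norm_sub_rev, abs_sub_comm, abs_of_nonneg (sub_nonneg.2 hxy)]
  refine le_of_forall_pos_le_add fun ε hε => ?_
  obtain ⟨κ, hκ0, hκ⟩ : ∃ κ > 0, κ * (y - x) ≤ ε := by
    refine ⟨ε / (y - x + 1), div_pos hε (by linarith), ?_⟩
    rw [div_mul_eq_mul_div, div_le_iff₀ (by linarith)]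
    nlinarith
  have key := right_local_bound (fun x y => ‖k.fd y - k.fd x‖)
    (fun y => (1 / RO k.f k.fd univ + κ) * y)
    (fun x y z => by rw [add_comm]; exact norm_sub_le_norm_sub_add_norm_sub _ _ _) (by simp)
    (fun x => by have := k.continuous_fd; fun_prop) (by fun_prop) (fun s => ?_) hxy
  · nlinarith
  refine ⟨κ / C ^ 2, by positivity, fun t hst ht => ?_⟩
  have h0 : 0 < t - s := sub_pos.2 hst
  have h1 := k.norm_smul_fd_sub_le hC s t
  have h2 := k.norm_smul_fd_sub_le hC t s
  rw [abs_sub_comm s t] at h2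
  rw [abs_of_pos h0] at h1 h2
  have h3 : (t - s) * ‖k.fd t - k.fd s‖ ≤
      C ^ 2 * (t - s) ^ 3 + (t - s) ^ 2 / RO k.f k.fd univ := by
    have : (t - s) • (k.fd t - k.fd s) =
        -(((s - t) • k.fd t - (k.f s - k.f t)) + ((t - s) • k.fd s - (k.f t - k.f s))) := by
      module
    rw [← abs_of_pos h0, ← Real.norm_eq_abs, ← norm_smul, this, norm_neg, Real.norm_eq_abs,
      abs_of_pos h0]
    refine ((norm_add_le _ _).trans (add_le_add h2 h1)).trans (le_of_eq ?_)
    field_simp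
    ring
  have h4 : C ^ 2 * (t - s) ≤ κ := by
    have : t - s < κ / C ^ 2 := by linarith
    rw [lt_div_iff₀ (by positivity)] at this
    linarith
  have h5 : (t - s) * ‖k.fd t - k.fd s‖ ≤
      (t - s) * ((1 / RO k.f k.fd univ + κ) * (t - s)) := by
    refine h3.trans ?_
    have : (t - s) * ((1 / RO k.f k.fd univ + κ) * (t - s)) =
      κ * (t - s) ^ 2 + (t - s) ^ 2 / RO k.f k.fd univ := by ring
    rw [this]
    nlinarith [sq_nonneg (t - s)]
  have := le_of_mul_le_mul_left h5 h0
  linarith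

theorem angle_fd_le (x y : ℝ) :
    InnerProductGeometry.angle (k.fd x) (k.fd y) ≤ 1 / RO k.f k.fd univ * |x - y| :=
  angle_le_of_norm_sub_le k.unit k.norm_fd_sub_le x y

theorem curvAt_le (s : ℝ) : curvAt k.fd univ s ≤ 1 / RO k.f k.fd univ := by
  have hr := k.RO_pos
  exact csInf_le ⟨0, fun _ h => h.1⟩
    ⟨by positivity, 1, one_pos, fun x _ y _ _ _ _ => k.angle_fd_le x y⟩

theorem exists_lipschitz_lt {s : ℝ} (h : curvAt k.fd univ s < ⨆ s : ℝ, curvAt k.fd univ s) :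
    ∃ Λ < 1 / RO k.f k.fd univ, 0 ≤ Λ ∧ ∃ δ > 0, ∀ x y, |x - s| < δ → |y - s| < δ →
      ‖k.fd x - k.fd y‖ ≤ Λ * |x - y| := by
  have hr := k.RO_pos
  have hlt := h.trans_le (ciSup_le k.curvAt_le)
  obtain ⟨Λ, ⟨hΛ0, δ, hδ, H⟩, hΛ⟩ := exists_lt_of_csInf_lt (s := {Λ : ℝ | 0 ≤ Λ ∧ ∃ δ > 0,
      ∀ x ∈ univ, ∀ y ∈ univ, x ≠ y → |x - s| < δ → |y - s| < δ →
        InnerProductGeometry.angle (k.fd x) (k.fd y) ≤ Λ * |x - y|}) ⟨1 / RO k.f k.fd univ,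
    by positivity, 1, one_pos, fun x _ y _ _ _ _ => k.angle_fd_le x y⟩ hlt
  refine ⟨Λ, hΛ, hΛ0, δ, hδ, fun x y hx hy => ?_⟩
  rcases eq_or_ne x y with rfl | hxy
  · simp
  · exact (norm_sub_le_angle (k.unit x) (k.unit y)).trans
      (H x (mem_univ _) y (mem_univ _) hxy hx hy)

theorem Fk_eq_of_arc {b d : ℝ} {e u : Euc n} (hbd : b < d) (he : ‖e‖ = 1)
    (heu : ⟪e, u⟫ = 0) (h : ∀ s ∈ Icc b d, k.fd s =
      Real.cos (1 / RO k.f k.fd univ * (s - b)) • e +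
        Real.sin (1 / RO k.f k.fd univ * (s - b)) • u) :
    k.Fk = RO k.f k.fd univ := by
  have hr := k.RO_pos
  set ρ := 1 / RO k.f k.fd univ with hρ
  have hρ0 : 0 < ρ := by positivity
  have hcurv : ρ ≤ curvAt k.fd univ b := by
    refine le_csInf ⟨ρ, hρ0.le, 1, one_pos, fun x _ y _ _ _ _ => k.angle_fd_le x y⟩ ?_
    rintro Λ ⟨-, δ, hδ, H⟩
    obtain ⟨t, ht0, ht⟩ := exists_between (lt_min hδ (lt_min (sub_pos.2 hbd)
      (div_pos Real.pi_pos hρ0)))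
    simp only [lt_min_iff] at ht
    obtain ⟨ht1, ht2, ht3⟩ := ht
    rw [lt_div_iff₀ hρ0] at ht3
    have h1 := H b (mem_univ _) (b + t) (mem_univ _) (by linarith) (by simpa using hδ)
      (by simpa [abs_of_pos ht0] using ht1)
    have h2 : InnerProductGeometry.angle (k.fd b) (k.fd (b + t)) = ρ * t := by
      rw [InnerProductGeometry.angle, k.unit, k.unit, h b ⟨le_rfl, hbd.le⟩,
        h (b + t) ⟨by linarith, by linarith⟩]
      simp only [sub_self, mul_zero, Real.cos_zero, Real.sin_zero, one_smul, zero_smul, add_zero,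
        add_sub_cancel_left, inner_add_right, real_inner_smul_right, heu,
        real_inner_self_eq_norm_sq, he]
      norm_num
      exact Real.arccos_cos (by positivity) (by linarith)
    rw [h2] at h1
    have h3 : |b - (b + t)| = t := by rw [sub_add_cancel_left, abs_neg, abs_of_pos ht0]
    rw [h3] at h1
    exact le_of_mul_le_mul_right h1 ht0
  have hsup : k.supCurv = ρ := by
    apply le_antisymm (ciSup_le k.curvAt_le)
    exact hcurv.trans (le_ciSup (f := fun s => curvAt k.fd univ s)
      ⟨ρ, by rintro _ ⟨s, rfl⟩; exact k.curvAt_le s⟩ b)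
  rw [Fk, hsup, hρ]
  simp

theorem MDC_eq : MDC k.f k.fd =
    sInf {d : ℝ | ∃ x y : ℝ, k.IsDoubleCritical x y ∧ d = ‖k.f x - k.f y‖} := by
  simp only [MDC, IsDoubleCritical, and_assoc]

theorem mem_Ic_iff {x : ℝ} :
    x ∈ k.Ic ↔ ∃ y, k.IsDoubleCritical x y ∧ ‖k.f x - k.f y‖ = MDC k.f k.fd := by
  simp only [Ic, mem_ofPred_eq, IsDoubleCritical, and_assoc]

theorem MDC_le {x y : ℝ} (h : k.IsDoubleCritical x y) : MDC k.f k.fd ≤ ‖k.f x - k.f y‖ := by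
  rw [MDC_eq]
  exact csInf_le ⟨0, by rintro _ ⟨x, y, -, rfl⟩; exact norm_nonneg _⟩ ⟨x, y, h, rfl⟩

theorem two_mul_RO_le_MDC : 2 * RO k.f k.fd univ ≤ MDC k.f k.fd := by
  obtain ⟨x, y, h⟩ := k.exists_isDoubleCritical
  rw [MDC_eq]
  refine le_csInf ⟨_, x, y, h, rfl⟩ ?_
  rintro _ ⟨x, y, h, rfl⟩
  exact k.two_mul_RO_le h

theorem MDC_pos : 0 < MDC k.f k.fd := by
  have := k.RO_pos
  have := k.two_mul_RO_le_MDC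
  linarith

theorem Ic_nonempty : k.Ic.Nonempty := by
  have hf := k.continuous_f
  have hfd := k.continuous_fd
  have hr := k.RO_pos
  set S : Set (ℝ × ℝ) := (Icc 0 k.L ×ˢ Icc 0 k.L) ∩
    {z | ⟪k.f z.1 - k.f z.2, k.fd z.1⟫ = 0 ∧ ⟪k.f z.1 - k.f z.2, k.fd z.2⟫ = 0 ∧
      2 * RO k.f k.fd univ ≤ ‖k.f z.1 - k.f z.2‖} with hS
  have hSc : IsCompact S := by
    refine (isCompact_Icc.prod isCompact_Icc).inter_right ?_
    refine IsClosed.and ?_ (IsClosed.and ?_ ?_)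
    · exact isClosed_eq (by fun_prop) (by fun_prop)
    · exact isClosed_eq (by fun_prop) (by fun_prop)
    · exact isClosed_le (by fun_prop) (by fun_prop)
  have himg : {d : ℝ | ∃ x y : ℝ, k.IsDoubleCritical x y ∧ d = ‖k.f x - k.f y‖} =
      (fun z : ℝ × ℝ => ‖k.f z.1 - k.f z.2‖) '' S := by
    ext d
    constructor
    · rintro ⟨x, y, h, rfl⟩
      obtain ⟨i, hi⟩ := k.exists_int_mem_Ico 0 x
      obtain ⟨j, hj⟩ := k.exists_int_mem_Ico 0 y
      rw [zero_add] at hi hj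
      refine ⟨(x + i * k.L, y + j * k.L),
        ⟨⟨Ico_subset_Icc_self hi, Ico_subset_Icc_self hj⟩, ?_⟩, by simp only [f_add_int]⟩
      simp only [mem_ofPred_eq, f_add_int, fd_add_int]
      exact ⟨h.2.1, h.2.2, k.two_mul_RO_le h⟩
    · rintro ⟨⟨x, y⟩, ⟨-, h1, h2, h3⟩, rfl⟩
      simp only at h1 h2 h3
      refine ⟨x, y, ⟨fun h => ?_, h1, h2⟩, rfl⟩
      rw [h, sub_self, norm_zero] at h3
      linarith
  have hne : S.Nonempty := by
    obtain ⟨x, y, h⟩ := k.exists_isDoubleCritical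
    rw [← image_nonempty, ← himg]
    exact ⟨_, x, y, h, rfl⟩
  have hmem := (hSc.image (f := fun z : ℝ × ℝ => ‖k.f z.1 - k.f z.2‖) (by fun_prop)).sInf_mem
    (hne.image _)
  rw [← himg, ← MDC_eq] at hmem
  obtain ⟨x, y, h, hd⟩ := hmem
  exact ⟨x, k.mem_Ic_iff.2 ⟨y, h, hd.symm⟩⟩

theorem add_int_mem_Ic {x : ℝ} (m : ℤ) : x + m * k.L ∈ k.Ic ↔ x ∈ k.Ic := by
  simp only [Ic, mem_ofPred_eq, f_add_int, fd_add_int]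

theorem isClosed_Ic : IsClosed k.Ic := by
  have hf := k.continuous_f
  have hfd := k.continuous_fd
  rw [← isSeqClosed_iff_isClosed]
  intro x a hx hxa
  have : ∀ i, ∃ y ∈ Icc 0 k.L, k.IsDoubleCritical (x i) y ∧
      ‖k.f (x i) - k.f y‖ = MDC k.f k.fd := by
    intro i
    obtain ⟨y, hy1, hy2⟩ := k.mem_Ic_iff.1 (hx i)
    obtain ⟨j, hj⟩ := k.exists_int_mem_Ico 0 y
    rw [zero_add] at hj
    refine ⟨y + j * k.L, Ico_subset_Icc_self hj, ?_, by rwa [f_add_int]⟩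
    simpa using (k.isDoubleCritical_add_int (x i) y 0 j).2 hy1
  choose y hy hdc hd using this
  obtain ⟨b, -, φ, hφ, hlim⟩ := isCompact_Icc.tendsto_subseq hy
  have hl : Tendsto (fun i => (x (φ i), y (φ i))) atTop (𝓝 (a, b)) :=
    (hxa.comp hφ.tendsto_atTop).prodMk_nhds hlim
  have h1 : MDC k.f k.fd = ‖k.f a - k.f b‖ := by
    have hc : Continuous fun z : ℝ × ℝ => ‖k.f z.1 - k.f z.2‖ := by fun_prop
    refine tendsto_nhds_unique ?_ ((hc.tendsto (a, b)).comp hl)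
    simp [Function.comp_def, hd]
  have h2 : (0 : ℝ) = ⟪k.f a - k.f b, k.fd a⟫ := by
    have hc : Continuous fun z : ℝ × ℝ => ⟪k.f z.1 - k.f z.2, k.fd z.1⟫ := by fun_prop
    refine tendsto_nhds_unique ?_ ((hc.tendsto (a, b)).comp hl)
    simp [Function.comp_def, (hdc _).2.1]
  have h3 : (0 : ℝ) = ⟪k.f a - k.f b, k.fd b⟫ := by
    have hc : Continuous fun z : ℝ × ℝ => ⟪k.f z.1 - k.f z.2, k.fd z.2⟫ := by fun_prop
    refine tendsto_nhds_unique ?_ ((hc.tendsto (a, b)).comp hl)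
    simp [Function.comp_def, (hdc _).2.2]
  refine k.mem_Ic_iff.2 ⟨b, ⟨fun h => ?_, h2.symm, h3.symm⟩, h1.symm⟩
  have := k.MDC_pos
  rw [h1, h] at this
  simp at this

theorem exists_mem_Ic (α : ℝ) : ∃ x ∈ k.Ic, x ∈ Ico α (α + k.L) := by
  obtain ⟨x, hx⟩ := k.Ic_nonempty
  obtain ⟨m, hm⟩ := k.exists_int_mem_Ico α x
  exact ⟨_, (k.add_int_mem_Ic m).2 hx, hm⟩

theorem sub_lt_of_disjoint_Ic {α β : ℝ} (h : Disjoint (Icc α β) k.Ic) : β - α < k.L := by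
  by_contra! hle
  obtain ⟨x, hx, hx1, hx2⟩ := k.exists_mem_Ic α
  exact disjoint_left.1 h ⟨hx1, by linarith⟩ hx

theorem exists_mul_abs_sub_le :
    ∃ c > 0, ∀ x y, |x - y| ≤ k.L / 2 → c * |x - y| ≤ ‖k.f x - k.f y‖ := by
  have hf := k.continuous_f
  have hL := k.Lpos
  obtain ⟨C, hC0, hC⟩ := k.exists_lipschitz_fd
  have hnear : ∀ x y, |x - y| ≤ 1 / C → 1 / 2 * |x - y| ≤ ‖k.f x - k.f y‖ := by
    intro x y h
    have h1 := k.abs_sub_inner_le hC y x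
    have h2 : |⟪k.f x - k.f y, k.fd y⟫| ≤ ‖k.f x - k.f y‖ := by
      simpa [k.unit] using abs_real_inner_le_norm (k.f x - k.f y) (k.fd y)
    have h3 : C ^ 2 * |x - y| ^ 3 ≤ |x - y| := by
      rw [le_div_iff₀ hC0] at h
      have h4 : (|x - y| * C) ^ 2 ≤ 1 := pow_le_one₀ (by positivity) h
      nlinarith [abs_nonneg (x - y)]
    have h5 := abs_sub_abs_le_abs_sub (x - y) ⟪k.f x - k.f y, k.fd y⟫
    linarith
  set S : Set (ℝ × ℝ) := (Icc 0 k.L ×ˢ Icc (-(k.L / 2)) (k.L / 2)) ∩ {z | 1 / C ≤ |z.2|} with hS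
  have hSc : IsCompact S := (isCompact_Icc.prod isCompact_Icc).inter_right
    (isClosed_le (by fun_prop) (by fun_prop))
  obtain ⟨μ, hμ, hfar⟩ : ∃ μ > 0, ∀ z ∈ S, μ ≤ ‖k.f (z.1 + z.2) - k.f z.1‖ := by
    refine hSc.exists_forall_le' (a := 0) (f := fun z : ℝ × ℝ => ‖k.f (z.1 + z.2) - k.f z.1‖)
      (by fun_prop) ?_
    rintro ⟨x, t⟩ ⟨⟨-, ht1, ht2⟩, ht3⟩
    simp only [mem_ofPred_eq] at ht1 ht2 ht3 ⊢
    rw [norm_pos_iff, sub_ne_zero]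
    have hC1 : 0 < 1 / C := by positivity
    rcases lt_trichotomy t 0 with h | h | h
    · exact k.f_ne_of_lt (by linarith) (by linarith)
    · rw [h, abs_zero] at ht3; linarith
    · exact (k.f_ne_of_lt (by linarith) (by linarith)).symm
  refine ⟨min (1 / 2) (μ / k.L), lt_min (by norm_num) (by positivity), fun x y h => ?_⟩
  rcases le_total |x - y| (1 / C) with h1 | h1
  · exact (mul_le_mul_of_nonneg_right (min_le_left _ _) (abs_nonneg _)).trans (hnear x y h1)
  · obtain ⟨i, hi⟩ := k.exists_int_mem_Ico 0 y
    rw [zero_add] at hi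
    have h2 := hfar (y + i * k.L, x - y) ⟨⟨Ico_subset_Icc_self hi, abs_le.1 h⟩, h1⟩
    have h3 : y + i * k.L + (x - y) = x + i * k.L := by ring
    simp only [h3, f_add_int] at h2
    refine le_trans ?_ h2
    calc _ ≤ μ / k.L * |x - y| := mul_le_mul_of_nonneg_right (min_le_right _ _) (abs_nonneg _)
      _ ≤ μ / k.L * k.L := by gcongr; linarith
      _ = μ := by field_simp

/-- Injectivity on a period is stable under perturbations of the derivative. -/
theorem exists_injOn_of_norm_sub_le : ∃ c > 0, ∀ g g' : ℝ → Euc n, (∀ s, g (s + 1) = g s) →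
    (∀ s, HasDerivAt g (g' s) s) → (∀ s, ‖g' s - k.L • k.fd (k.L * s)‖ ≤ c) →
    InjOn g (Ico 0 1) := by
  have hL := k.Lpos
  obtain ⟨c, hc, H⟩ := k.exists_mul_abs_sub_le
  refine ⟨k.L * c / 2, by positivity, fun g g' hg hd hle x hx y hy hxy => ?_⟩
  by_contra hne
  set m := round (x - y) with hm
  have h1 : |x - (y + m)| ≤ 1 / 2 := by
    have := abs_sub_round (x - y)
    rwa [← hm, sub_sub] at this
  have h2 : 0 < |x - (y + m)| := by
    rw [abs_pos, sub_ne_zero]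
    intro h
    have h3 : (m : ℝ) < 1 := by linarith [hx.2, hy.1]
    have h4 : (-1 : ℝ) < m := by linarith [hx.1, hy.2]
    have h5 : m = 0 := by
      have h3' : m < 1 := by exact_mod_cast h3
      have h4' : -1 < m := by exact_mod_cast h4
      omega
    rw [h5] at h
    exact hne (by simpa using h)
  have hgm : g (y + m) = g y := by
    have := Function.Periodic.int_mul (f := g) (c := 1) hg m y
    simpa using this
  have hd2 : ∀ s, HasDerivAt (fun s => g s - k.f (k.L * s)) (g' s - k.L • k.fd (k.L * s)) s := by
    intro s
    refine (hd s).sub ?_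
    have := (k.deriv (k.L * s)).scomp s ((hasDerivAt_id s).const_mul k.L)
    simpa [Function.comp_def] using this
  have h6 := Convex.norm_image_sub_le_of_norm_hasDerivWithin_le (s := univ) (x := y + m) (y := x)
    (fun s _ => (hd2 s).hasDerivWithinAt) (fun s _ => hle s) convex_univ (mem_univ _)
    (mem_univ _)
  have h7 := H (k.L * x) (k.L * (y + m)) (by
    rw [← mul_sub, abs_mul, abs_of_pos hL]; nlinarith)
  have h8 : g x - k.f (k.L * x) - (g (y + m) - k.f (k.L * (y + m))) =
      -(k.f (k.L * x) - k.f (k.L * (y + m))) := by rw [hgm, hxy]; abel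
  rw [h8, norm_neg, Real.norm_eq_abs] at h6
  rw [← mul_sub, abs_mul, abs_of_pos hL] at h7
  have : 0 < k.L * c * |x - (y + m)| := by positivity
  linarith

end Knot

theorem hasDerivAt_integral {F : Type*} [NormedAddCommGroup F] [NormedSpace ℝ F] [CompleteSpace F]
    {g : ℝ → F} (hg : Continuous g) (a s : ℝ) :
    HasDerivAt (fun x => ∫ t in a..x, g t) (g s) s :=
  intervalIntegral.integral_hasDerivAt_right (hg.intervalIntegrable _ _)
    hg.stronglyMeasurable.stronglyMeasurableAtFilter hg.continuousAt

/-- Arclength reparametrization of a closed curve with tangent Lipschitz in arclength. -/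
theorem exists_knot_reparametrization {n : ℕ} {E V : ℝ → Euc n} {L ρ m : ℝ} (hL : 0 < L)
    (hρ : 0 ≤ ρ) (hm : 0 < m) (hE : ∀ s, E (s + L) = E s) (hV : ∀ s, V (s + L) = V s)
    (hd : ∀ s, HasDerivAt E (V s) s) (hc : Continuous V) (hVm : ∀ s, m ≤ ‖V s‖)
    (hlip : ∀ x y, x ≤ y → ‖‖V y‖⁻¹ • V y - ‖V x‖⁻¹ • V x‖ ≤ ρ * ∫ t in x..y, ‖V t‖)
    (hinj : InjOn E (Ico 0 L)) :
    ∃ (k : Knot n) (σ : ℝ → ℝ), Function.Surjective σ ∧ StrictMono σ ∧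
      (∀ s, σ s = ∫ t in (0)..s, ‖V t‖) ∧ k.L = σ L ∧ (∀ s, k.f (σ s) = E s) ∧
      (∀ s, k.fd (σ s) = ‖V s‖⁻¹ • V s) ∧ ∀ x y, ‖k.fd x - k.fd y‖ ≤ ρ * |x - y| := by
  have hn : Continuous fun s => ‖V s‖ := hc.norm
  have hi : ∀ a b, IntervalIntegrable (fun s => ‖V s‖) volume a b := hn.intervalIntegrable
  have hV0 : ∀ s, 0 < ‖V s‖ := fun s => hm.trans_le (hVm s)
  set σ : ℝ → ℝ := fun s => ∫ t in (0)..s, ‖V t‖ with hσ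
  have hσd : ∀ s, HasDerivAt σ ‖V s‖ s := hasDerivAt_integral hn 0
  have hσs : ∀ x y, σ y - σ x = ∫ t in x..y, ‖V t‖ := fun x y =>
    intervalIntegral.integral_interval_sub_left (hi _ _) (hi _ _)
  have hσm : ∀ x y, x ≤ y → m * (y - x) ≤ σ y - σ x := by
    intro x y hxy
    have := intervalIntegral.integral_mono_on (μ := volume) hxy intervalIntegrable_const (hi x y)
      (fun t _ => hVm t)
    rw [hσs]
    simpa [mul_comm] using this
  have hσmono : StrictMono σ := fun x y hxy => by
    have := hσm x y hxy.le
    nlinarith [mul_pos hm (sub_pos.2 hxy)]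
  have hσ0 : σ 0 = 0 := by simp [hσ]
  have hσc : Continuous σ := continuous_iff_continuousAt.2 fun s => (hσd s).continuousAt
  have hσsurj : Function.Surjective σ := by
    apply hσc.surjective
    · refine tendsto_atTop_mono' _ ?_ (tendsto_id.const_mul_atTop hm)
      filter_upwards [eventually_ge_atTop 0] with s hs
      have := hσm 0 s hs
      simp only [id]
      linarith
    · refine tendsto_atBot_mono' _ ?_ (tendsto_id.const_mul_atBot hm)
      filter_upwards [eventually_le_atBot 0] with s hs
      have := hσm s 0 hs
      simp only [id]
      linarith
  have hσper : ∀ s, σ (s + L) = σ s + σ L := by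
    intro s
    have h1 : Function.Periodic (fun t => ‖V t‖) L := fun t => by simp only [hV]
    have h2 := h1.intervalIntegral_add_eq s 0
    rw [zero_add, ← hσs, ← hσs, hσ0] at h2
    linarith
  have hσL : 0 < σ L := hσ0 ▸ hσmono hL
  set e := hσmono.orderIsoOfSurjective σ hσsurj
  set τ : ℝ → ℝ := fun x => e.symm x with hτ
  have hστ : ∀ x, σ (τ x) = x := fun x => e.apply_symm_apply x
  have hτσ : ∀ s, τ (σ s) = s := fun s => e.symm_apply_apply s
  have hτc : Continuous τ := e.symm.continuous
  have hτmono : StrictMono τ := e.symm.strictMono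
  have hτd : ∀ x, HasDerivAt τ ‖V (τ x)‖⁻¹ x := fun x =>
    HasDerivAt.of_local_left_inverse hτc.continuousAt (hσd _) (hV0 _).ne'
      (Eventually.of_forall hστ)
  have hτper : ∀ x, τ (x + σ L) = τ x + L := fun x => by
    apply hσmono.injective
    rw [hστ, hσper, hστ]
  have hlip2 : ∀ x y, ‖‖V (τ x)‖⁻¹ • V (τ x) - ‖V (τ y)‖⁻¹ • V (τ y)‖ ≤ ρ * |x - y| := by
    intro x y
    wlog hxy : x ≤ y generalizing x y
    · rw [norm_sub_rev, abs_sub_comm]; exact this y x (by linarith)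
    have := hlip _ _ (hτmono.monotone hxy)
    rw [← hσs, hστ, hστ] at this
    rwa [norm_sub_rev, abs_sub_comm, abs_of_nonneg (sub_nonneg.2 hxy)]
  refine ⟨{ L := σ L
            Lpos := hσL
            f := fun x => E (τ x)
            fd := fun x => ‖V (τ x)‖⁻¹ • V (τ x)
            per := fun x => by simp only [hτper, hE]
            perd := fun x => by simp only [hτper, hV]
            deriv := fun x => (hd (τ x)).scomp x (hτd x)
            unit := fun x => by
              rw [norm_smul, norm_inv, norm_norm, inv_mul_cancel₀ (hV0 _).ne']
            lipd := ⟨ρ.toNNReal, LipschitzWith.of_dist_le_mul fun x y => by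
              rw [dist_eq_norm, Real.dist_eq, Real.coe_toNNReal _ hρ]; exact hlip2 x y⟩
            inj := ?_ }, σ, hσsurj, hσmono, fun s => rfl, rfl, fun s => by simp only [hτσ],
            fun s => by simp only [hτσ], hlip2⟩
  have hmem : ∀ x ∈ Ico 0 (σ L), τ x ∈ Ico 0 L := fun x hx => by
    have h0 : τ 0 = 0 := by have := hτσ 0; rwa [hσ0] at this
    exact ⟨h0 ▸ hτmono.monotone hx.1, (hτσ L) ▸ hτmono hx.2⟩
  exact fun x hx y hy hxy => hτmono.injective (hinj (hmem x hx) (hmem y hy) hxy)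

theorem exists_periodic_extension {F : Type*} [TopologicalSpace F] {L : ℝ} (hL : 0 < L) (α : ℝ)
    {D₀ : ℝ → F} (hc : Continuous D₀) (h : D₀ α = D₀ (α + L)) :
    ∃ D : ℝ → F, Continuous D ∧ (∀ s, D (s + L) = D s) ∧ ∀ s ∈ Icc α (α + L), D s = D₀ s := by
  have : Fact (0 < L) := ⟨hL⟩
  refine ⟨fun s => AddCircle.liftIco L α D₀ (s : AddCircle L),
    (AddCircle.liftIco_continuous h hc.continuousOn).comp (AddCircle.continuous_mk' L),
    fun s => by simp, fun s hs => ?_⟩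
  rcases hs.2.lt_or_eq with h1 | h1
  · exact AddCircle.liftIco_coe_apply ⟨hs.1, h1⟩
  · rw [h1, ← h]
    simp only [AddCircle.coe_add_period]
    exact AddCircle.liftIco_coe_apply ⟨le_rfl, by linarith⟩

namespace Knot

variable {n : ℕ} (k : Knot n)

/-- `E` with derivative `V` is a closed `C¹` curve that is `ε`-close to the knot and agrees with it
outside `[α, β]` up to periods. -/
structure IsPerturbation (α β ε : ℝ) (E V : ℝ → Euc n) : Prop where
  per : ∀ s, E (s + k.L) = E s
  perd : ∀ s, V (s + k.L) = V s
  deriv : ∀ s, HasDerivAt E (V s) s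
  cont : Continuous V
  norm_V_sub_le : ∀ s, ‖V s - k.fd s‖ ≤ ε
  norm_E_sub_le : ∀ s, ‖E s - k.f s‖ ≤ ε * k.L
  E_eq : ∀ s ∈ Icc β (α + k.L), E s = k.f s
  V_eq : ∀ s ∈ Icc β (α + k.L), V s = k.fd s

theorem exists_isPerturbation {α β ε : ℝ} {N : ℝ → Euc n} (hαβ : α < β) (hβ : β < α + k.L)
    (hN : Continuous N) (hNα : ∀ s ≤ α, N s = k.fd s) (hNβ : ∀ s ≥ β, N s = k.fd s)
    (hint : ∫ s in α..β, N s = ∫ s in α..β, k.fd s) (hε : ∀ s, ‖N s - k.fd s‖ ≤ ε) :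
    ∃ E V, k.IsPerturbation α β ε E V ∧ ∀ s ∈ Icc α (α + k.L), V s = N s := by
  have hL := k.Lpos
  have hfd := k.continuous_fd
  have hε0 : 0 ≤ ε := (norm_nonneg _).trans (hε 0)
  obtain ⟨D, hDc, hDp, hD⟩ := exists_periodic_extension hL α (hN.sub hfd)
    (by simp [hNα α le_rfl, hNβ (α + k.L) hβ.le])
  have hDm : ∀ (m : ℤ) s, D (s + m * k.L) = D s := fun m s =>
    (Function.Periodic.int_mul (f := D) (c := k.L) hDp m) s
  have hi : ∀ a b, IntervalIntegrable D volume a b := hDc.intervalIntegrable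
  have hDε : ∀ s, ‖D s‖ ≤ ε := fun s => by
    obtain ⟨m, hm⟩ := k.exists_int_mem_Ico α s
    rw [← hDm m, hD _ (Ico_subset_Icc_self hm)]
    exact hε _
  have h0 : ∫ s in α..β, D s = 0 := by
    have : ∫ s in α..β, D s = ∫ s in α..β, (N s - k.fd s) := by
      apply intervalIntegral.integral_congr
      intro s hs
      rw [uIcc_of_le hαβ.le] at hs
      exact hD s ⟨hs.1, hs.2.trans hβ.le⟩
    rw [this, intervalIntegral.integral_sub (hN.intervalIntegrable _ _)
      (hfd.intervalIntegrable _ _), hint, sub_self]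
  have h1 : ∀ s ∈ Icc β (α + k.L), ∫ t in α..s, D t = 0 := by
    intro s hs
    rw [← intervalIntegral.integral_add_adjacent_intervals (hi α β) (hi β s), h0, zero_add]
    have : ∫ t in β..s, D t = ∫ t in β..s, (0 : Euc n) := by
      apply intervalIntegral.integral_congr
      intro t ht
      rw [uIcc_of_le hs.1] at ht
      simp only
      rw [hD t ⟨hαβ.le.trans ht.1, ht.2.trans hs.2⟩, Pi.sub_apply, hNβ t ht.1, sub_self]
    rw [this, intervalIntegral.integral_zero]
  have hper : ∀ s, ∫ t in α..(s + k.L), D t = ∫ t in α..s, D t := by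
    intro s
    have h2 := (show Function.Periodic D k.L from hDp).intervalIntegral_add_eq s α
    rw [h1 _ ⟨hβ.le, le_rfl⟩] at h2
    rw [← intervalIntegral.integral_add_adjacent_intervals (hi α s) (hi s _), h2, add_zero]
  refine ⟨fun s => k.f s + ∫ t in α..s, D t, fun s => k.fd s + D s, ⟨?_, ?_, ?_, ?_, ?_, ?_, ?_, ?_⟩,
    ?_⟩
  · intro s; simp only [k.per, hper]
  · intro s; simp only [k.perd, hDp]
  · exact fun s => (k.deriv s).add (hasDerivAt_integral hDc α s)
  · fun_prop
  · intro s; simpa using hDε s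
  · intro s
    obtain ⟨m, hm⟩ := k.exists_int_mem_Ico α s
    have h2 : ∫ t in α..s, D t = ∫ t in α..(s + m * k.L), D t :=
      ((Function.Periodic.int_mul (f := fun s => ∫ t in α..s, D t) (c := k.L) hper m) s).symm
    rw [add_sub_cancel_left, h2]
    refine (intervalIntegral.norm_integral_le_of_norm_le_const (C := ε) fun t _ => hDε t).trans ?_
    rw [abs_of_nonneg (by linarith [hm.1])]
    nlinarith [hm.2]
  · intro s hs; simp only [h1 s hs, add_zero]
  · intro s hs
    rw [hD s ⟨hαβ.le.trans hs.1, hs.2⟩, Pi.sub_apply, hNβ s hs.1]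
    simp
  · intro s hs
    simp only
    rw [hD s hs, Pi.sub_apply]
    abel

namespace IsPerturbation

variable {k} {α β ε : ℝ} {E V : ℝ → Euc n}

theorem E_add_int (h : k.IsPerturbation α β ε E V) (s : ℝ) (m : ℤ) : E (s + m * k.L) = E s :=
  (Function.Periodic.int_mul (f := E) (c := k.L) h.per m) s

theorem V_add_int (h : k.IsPerturbation α β ε E V) (s : ℝ) (m : ℤ) : V (s + m * k.L) = V s :=
  (Function.Periodic.int_mul (f := V) (c := k.L) h.perd m) s

theorem one_sub_le_norm (h : k.IsPerturbation α β ε E V) (s : ℝ) : 1 - ε ≤ ‖V s‖ := by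
  have h1 := h.norm_V_sub_le s
  have h2 := norm_sub_norm_le (k.fd s) (V s)
  rw [k.unit, norm_sub_rev] at h2
  linarith

theorem abs_norm_sub_one_le (h : k.IsPerturbation α β ε E V) (s : ℝ) : |‖V s‖ - 1| ≤ ε := by
  have h1 := h.norm_V_sub_le s
  have h2 := abs_norm_sub_norm_le (V s) (k.fd s)
  rw [k.unit] at h2
  linarith

/-- Nearby parameters do not satisfy the double critical condition. -/
theorem inner_ne_zero (h : k.IsPerturbation α β ε E V) {h₁ C : ℝ}
    (hC : ∀ x y, ‖k.fd x - k.fd y‖ ≤ C * |x - y|) (hC0 : 0 < C) (hh : C * h₁ ≤ 1 / 4) (hε : ε ≤ 1 / 8)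
    {x y : ℝ} (hxy : x ≠ y) (hy : |y - x| ≤ h₁) : ⟪E x - E y, V x⟫ ≠ 0 := by
  have hd : ∀ t, HasDerivAt (fun t => ⟪E t, V x⟫) ⟪V t, V x⟫ t := fun t => by
    simpa using (h.deriv t).inner ℝ (hasDerivAt_const t (V x))
  have hmono : StrictMonoOn (fun t => ⟪E t, V x⟫) (Icc (x - h₁) (x + h₁)) := by
    refine strictMonoOn_of_deriv_pos (convex_Icc _ _)
      (fun t _ => (hd t).continuousAt.continuousWithinAt) fun t ht => ?_
    rw [(hd t).deriv]
    have ht' := interior_subset ht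
    have h1 : ‖V x - V t‖ ≤ 2 * ε + C * h₁ := by
      have e1 : V x - V t = (V x - k.fd x) + (k.fd x - k.fd t) - (V t - k.fd t) := by abel
      have e2 : |x - t| ≤ h₁ := by rw [abs_sub_comm, abs_le]; constructor <;> linarith [ht'.1, ht'.2]
      rw [e1]
      have e3 := norm_sub_le ((V x - k.fd x) + (k.fd x - k.fd t)) (V t - k.fd t)
      have e4 := norm_add_le (V x - k.fd x) (k.fd x - k.fd t)
      have e5 := hC x t
      have e6 := mul_le_mul_of_nonneg_left e2 hC0.le
      linarith [h.norm_V_sub_le x, h.norm_V_sub_le t]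
    have h2 : ⟪V t, V x⟫ = ‖V x‖ ^ 2 - ⟪V x - V t, V x⟫ := by
      rw [inner_sub_left, real_inner_self_eq_norm_sq]; ring
    have h3 := real_inner_le_norm (V x - V t) (V x)
    have h4 := h.one_sub_le_norm x
    rw [h2]
    nlinarith [norm_nonneg (V x)]
  have hx0 : 0 ≤ h₁ := (abs_nonneg _).trans hy
  rw [abs_le] at hy
  intro h0
  rw [inner_sub_left, sub_eq_zero] at h0
  exact hxy (hmono.injOn ⟨by linarith, by linarith⟩ ⟨by linarith, by linarith⟩ h0)

end IsPerturbation

theorem exists_two_mul_RO_le {α β : ℝ} (hI : Disjoint (Icc α β) k.Ic) :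
    ∃ ε > 0, ∀ E V, k.IsPerturbation α β ε E V → ∀ x y, E x ≠ E y → ⟪E x - E y, V x⟫ = 0 →
      ⟪E x - E y, V y⟫ = 0 → 2 * RO k.f k.fd univ ≤ ‖E x - E y‖ := by
  have hL := k.Lpos
  have hf := k.continuous_f
  have hfd := k.continuous_fd
  have hβ : β < α + k.L := by have := k.sub_lt_of_disjoint_Ic hI; linarith
  obtain ⟨C, hC0, hC⟩ := k.exists_lipschitz_fd
  obtain ⟨h₁, hh0, hh1⟩ : ∃ h₁ > 0, C * h₁ ≤ 1 / 4 :=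
    ⟨1 / (4 * C), by positivity, by field_simp; norm_num⟩
  set r := RO k.f k.fd univ with hr
  set G : ℝ × ℝ → ℝ := fun z => |⟪k.f z.1 - k.f z.2, k.fd z.1⟫| + |⟪k.f z.1 - k.f z.2, k.fd z.2⟫| +
    max (‖k.f z.1 - k.f z.2‖ - 2 * r) 0 with hG
  have hGc : Continuous G := by fun_prop
  set S : Set (ℝ × ℝ) := (Icc α β ×ˢ Icc α (β + k.L)) ∩
    {z | h₁ ≤ z.2 - z.1 ∧ z.2 - z.1 ≤ k.L - h₁} with hS
  have hSc : IsCompact S := (isCompact_Icc.prod isCompact_Icc).inter_right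
    (IsClosed.and (isClosed_le (by fun_prop) (by fun_prop))
      (isClosed_le (by fun_prop) (by fun_prop)))
  obtain ⟨μ, hμ, hfar⟩ : ∃ μ > 0, ∀ z ∈ S, μ ≤ G z := by
    refine hSc.exists_forall_le' (a := 0) (f := G) hGc.continuousOn ?_
    rintro ⟨x, y⟩ ⟨⟨hx, -⟩, h1, h2⟩
    simp only at hx h1 h2
    have hne := k.f_ne_of_lt (x := x) (y := y) (by linarith) (by linarith)
    have ha := abs_nonneg ⟪k.f x - k.f y, k.fd x⟫
    have hb := abs_nonneg ⟪k.f x - k.f y, k.fd y⟫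
    have hc := le_max_right (‖k.f x - k.f y‖ - 2 * r) 0
    have hc' := le_max_left (‖k.f x - k.f y‖ - 2 * r) 0
    by_contra! hle
    simp only [hG] at hle
    have ha0 : ⟪k.f x - k.f y, k.fd x⟫ = 0 := abs_eq_zero.1 (by linarith)
    have hb0 : ⟪k.f x - k.f y, k.fd y⟫ = 0 := abs_eq_zero.1 (by linarith)
    have hdc : k.IsDoubleCritical x y := ⟨hne, ha0, hb0⟩
    have h3 := k.MDC_le hdc
    have h4 := k.two_mul_RO_le_MDC
    exact disjoint_left.1 hI hx (k.mem_Ic_iff.2 ⟨y, hdc, by linarith⟩)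
  obtain ⟨ε, hε0, hε1, hε2⟩ : ∃ ε > 0, ε ≤ 1 / 8 ∧ 12 * ε * k.L < μ := by
    refine ⟨min (1 / 8) (μ / (13 * k.L)), lt_min (by norm_num) (by positivity), min_le_left _ _, ?_⟩
    have : min (1 / 8) (μ / (13 * k.L)) ≤ μ / (13 * k.L) := min_le_right _ _
    rw [le_div_iff₀ (by positivity)] at this
    linarith
  refine ⟨ε, hε0, fun E V hP => ?_⟩
  have hVle : ∀ s, ‖V s‖ ≤ 2 := fun s => by
    have := abs_le.1 (hP.abs_norm_sub_one_le s)
    linarith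
  have key : ∀ x ∈ Icc α β, ∀ y, E x ≠ E y → ⟪E x - E y, V x⟫ = 0 →
      ⟪E x - E y, V y⟫ = 0 → 2 * r ≤ ‖E x - E y‖ := by
    intro x hx y hne h1 h2
    obtain ⟨m, hm⟩ := k.exists_int_mem_Ico x y
    rw [← hP.E_add_int y m] at hne h1 h2 ⊢
    rw [← hP.V_add_int y m] at h2
    set y' := y + m * k.L with hy'
    have hxy : x ≠ y' := fun h => hne (by rw [← h])
    have hlt : x < y' := lt_of_le_of_ne hm.1 hxy
    rcases le_or_gt (y' - x) h₁ with hc | hc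
    · exact absurd h1 (hP.inner_ne_zero hC hC0 hh1 hε1 hxy
        (by rwa [abs_of_pos (sub_pos.2 hlt)]))
    rcases le_or_gt (k.L - h₁) (y' - x) with hc' | hc'
    · have e := hP.E_add_int y' (-1)
      refine absurd h1 ?_
      rw [← e]
      push_cast
      refine hP.inner_ne_zero hC hC0 hh1 hε1 ?_ ?_
      · intro h; linarith [hm.2]
      · rw [abs_le]; constructor <;> linarith [hm.2]
    have hg := hfar (x, y') ⟨⟨hx, by constructor <;> linarith [hx.1, hx.2, hm.2]⟩, hc.le, hc'.le⟩
    have hΔ : ‖k.f x - k.f y'‖ ≤ k.L := (k.norm_f_sub_le x y').trans (by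
      rw [abs_sub_comm, abs_of_pos (sub_pos.2 hlt)]; linarith [hm.2])
    have hΔE : ‖(E x - E y') - (k.f x - k.f y')‖ ≤ 2 * ε * k.L := by
      have : (E x - E y') - (k.f x - k.f y') = (E x - k.f x) - (E y' - k.f y') := by abel
      rw [this]
      have := norm_sub_le (E x - k.f x) (E y' - k.f y')
      linarith [hP.norm_E_sub_le x, hP.norm_E_sub_le y']
    have hin : ∀ s, ⟪E x - E y', V s⟫ = 0 → |⟪k.f x - k.f y', k.fd s⟫| ≤ 5 * ε * k.L := by
      intro s hs
      have e1 : ⟪k.f x - k.f y', k.fd s⟫ = -(⟪(E x - E y') - (k.f x - k.f y'), V s⟫ +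
          ⟪k.f x - k.f y', V s - k.fd s⟫) := by
        rw [inner_sub_left (E x - E y'), hs, inner_sub_right]; ring
      rw [e1, abs_neg]
      refine (abs_add_le _ _).trans ?_
      have e2 := abs_real_inner_le_norm ((E x - E y') - (k.f x - k.f y')) (V s)
      have e3 := abs_real_inner_le_norm (k.f x - k.f y') (V s - k.fd s)
      have e4 : ‖(E x - E y') - (k.f x - k.f y')‖ * ‖V s‖ ≤ 2 * ε * k.L * 2 :=
        mul_le_mul hΔE (hVle s) (norm_nonneg _) (by positivity)
      have e5 : ‖k.f x - k.f y'‖ * ‖V s - k.fd s‖ ≤ k.L * ε :=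
        mul_le_mul hΔ (hP.norm_V_sub_le s) (norm_nonneg _) hL.le
      linarith
    by_contra! hlt2
    have e1 := hin x h1
    have e2 := hin y' h2
    have e3 : max (‖k.f x - k.f y'‖ - 2 * r) 0 ≤ 2 * ε * k.L := by
      refine max_le ?_ (by positivity)
      have := norm_sub_norm_le (k.f x - k.f y') (E x - E y')
      rw [norm_sub_rev (k.f x - k.f y')] at this
      linarith
    simp only [hG] at hg
    linarith
  intro x y hne h1 h2
  obtain ⟨i, hi⟩ := k.exists_int_mem_Ico α x
  obtain ⟨j, hj⟩ := k.exists_int_mem_Ico α y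
  rw [← hP.E_add_int x i, ← hP.E_add_int y j] at hne h1 h2 ⊢
  rw [← hP.V_add_int x i] at h1
  rw [← hP.V_add_int y j] at h2
  rcases le_or_gt (x + i * k.L) β with hxβ | hxβ
  · exact key _ ⟨hi.1, hxβ⟩ _ hne h1 h2
  rcases le_or_gt (y + j * k.L) β with hyβ | hyβ
  · rw [norm_sub_rev]
    refine key _ ⟨hj.1, hyβ⟩ _ hne.symm ?_ ?_ <;> rw [← neg_sub, inner_neg_left] <;> simp [h1, h2]
  rw [hP.V_eq _ ⟨hxβ.le, hi.2.le⟩] at h1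
  rw [hP.V_eq _ ⟨hyβ.le, hj.2.le⟩] at h2
  rw [hP.E_eq _ ⟨hxβ.le, hi.2.le⟩, hP.E_eq _ ⟨hyβ.le, hj.2.le⟩] at *
  exact k.two_mul_RO_le ⟨hne, h1, h2⟩

end Knot

/-- The unit-speed curve with tangent field `T` cannot be shortened, away from the parameters in
`I`, by small perturbations of the tangent field that keep the endpoints fixed and keep the
curvature at most `ρ`. -/
def IsLocallyShortest {F : Type*} [NormedAddCommGroup F] [NormedSpace ℝ F]
    (T : ℝ → F) (I : Set ℝ) (ρ : ℝ) : Prop :=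
  ∀ α β, α < β → Disjoint (Icc α β) I → ∃ ε > 0, ∀ N : ℝ → F, Continuous N →
    (∀ s ≤ α, N s = T s) → (∀ s ≥ β, N s = T s) → (∀ s, ‖N s - T s‖ ≤ ε) →
    ∫ s in α..β, N s = ∫ s in α..β, T s →
    (∀ x y, α ≤ x → x ≤ y → y ≤ β →
      ‖‖N y‖⁻¹ • N y - ‖N x‖⁻¹ • N x‖ ≤ ρ * ∫ t in x..y, ‖N t‖) →
    β - α ≤ ∫ s in α..β, ‖N s‖

namespace Knot

variable {n : ℕ} {k : Knot n}

namespace IsPerturbation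

variable {α β ε : ℝ} {E V : ℝ → Euc n}

theorem norm_pos (h : k.IsPerturbation α β ε E V) (hε : ε < 1) (s : ℝ) : 0 < ‖V s‖ := by
  have := h.one_sub_le_norm s
  linarith

theorem lipschitz (h : k.IsPerturbation α β ε E V) (hε : ε < 1) {ρ : ℝ}
    (hk : ∀ x y, ‖k.fd x - k.fd y‖ ≤ ρ * |x - y|)
    (hV : ∀ x y, α ≤ x → x ≤ y → y ≤ β →
      ‖‖V y‖⁻¹ • V y - ‖V x‖⁻¹ • V x‖ ≤ ρ * ∫ t in x..y, ‖V t‖) {x y : ℝ} (hxy : x ≤ y) :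
    ‖‖V y‖⁻¹ • V y - ‖V x‖⁻¹ • V x‖ ≤ ρ * ∫ t in x..y, ‖V t‖ := by
  have hVc := h.cont
  have hn : Continuous fun s => ‖V s‖ := hVc.norm
  have hne : ∀ s, ‖V s‖ ≠ 0 := fun s => (h.norm_pos hε s).ne'
  have hσ : ∀ x y, ρ * (∫ t in (0)..y, ‖V t‖) - ρ * (∫ t in (0)..x, ‖V t‖) =
      ρ * ∫ t in x..y, ‖V t‖ := fun x y => by
    rw [← mul_sub, intervalIntegral.integral_interval_sub_left (hn.intervalIntegrable _ _)
      (hn.intervalIntegrable _ _)]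
  have hnorm : Continuous fun s => ‖V s‖⁻¹ • V s := (hn.inv₀ hne).smul hVc
  rw [← hσ]
  refine right_local_bound (fun x y => ‖‖V y‖⁻¹ • V y - ‖V x‖⁻¹ • V x‖)
    (fun y => ρ * ∫ t in (0)..y, ‖V t‖)
    (fun x y z => by rw [add_comm]; exact norm_sub_le_norm_sub_add_norm_sub _ _ _) (by simp)
    (fun x => (hnorm.sub continuous_const).norm) ?_ (fun x => ?_) hxy
  · exact continuous_const.mul (continuous_iff_continuousAt.2 fun s =>
      (hasDerivAt_integral hn 0 s).continuousAt)
  obtain ⟨m, hm⟩ := k.exists_int_mem_Ico α x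
  have hshift : ∀ y, ∫ t in x..y, ‖V t‖ = ∫ t in (x + m * k.L)..(y + m * k.L), ‖V t‖ := by
    intro y
    rw [← intervalIntegral.integral_comp_add_right (fun t => ‖V t‖)]
    simp only [h.V_add_int]
  rcases lt_or_ge (x + m * k.L) β with hlt | hge
  · refine ⟨β - (x + m * k.L), by linarith, fun y hy1 hy2 => ?_⟩
    rw [hσ, hshift, ← h.V_add_int x m, ← h.V_add_int y m]
    exact hV _ _ hm.1 (by linarith) (by linarith)
  · refine ⟨α + k.L - (x + m * k.L), by linarith [hm.2], fun y hy1 hy2 => ?_⟩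
    have hmem : ∀ t ∈ Icc (x + m * k.L) (y + m * k.L), t ∈ Icc β (α + k.L) :=
      fun t ht => ⟨hge.trans ht.1, ht.2.trans (by linarith)⟩
    have hle : x + m * k.L ≤ y + m * k.L := by linarith
    have h1 : ∫ t in (x + m * k.L)..(y + m * k.L), ‖V t‖ = y - x := by
      have : ∫ t in (x + m * k.L)..(y + m * k.L), ‖V t‖ =
          ∫ t in (x + m * k.L)..(y + m * k.L), (1 : ℝ) := by
        apply intervalIntegral.integral_congr
        intro t ht
        rw [uIcc_of_le hle] at ht
        simp only
        rw [h.V_eq t (hmem t ht), k.unit]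
      rw [this]
      simp
    rw [hσ, hshift, ← h.V_add_int x m, ← h.V_add_int y m, h1,
      h.V_eq _ (hmem _ ⟨le_rfl, hle⟩), h.V_eq _ (hmem _ ⟨hle, le_rfl⟩), k.unit, k.unit]
    simp only [inv_one, one_smul]
    have := hk (y + m * k.L) (x + m * k.L)
    rwa [add_sub_add_right_eq_sub, abs_of_pos (by linarith)] at this

/-- The arclength reparametrization of a perturbation is `C¹`-close to the original knot. -/
theorem norm_sub_add_norm_sub_le (h : k.IsPerturbation α β ε E V) (hε : ε < 1) {ρ : ℝ}
    (hk : ∀ x y, ‖k.fd x - k.fd y‖ ≤ ρ * |x - y|) {η : Knot n} {σ : ℝ → ℝ}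
    (hσs : Function.Surjective σ) (hσm : StrictMono σ) (hσ : ∀ s, σ s = ∫ t in (0)..s, ‖V t‖)
    (hL : η.L = σ k.L) (hf : ∀ s, η.f (σ s) = E s) (hfd : ∀ s, η.fd (σ s) = ‖V s‖⁻¹ • V s)
    (s : ℝ) : ‖η.f (η.L * s) - k.f (k.L * s)‖ +
      ‖η.L • η.fd (η.L * s) - k.L • k.fd (k.L * s)‖ ≤ ε * (k.L * (6 + 2 * ρ * k.L)) := by
  have hkL := k.Lpos
  have hε0 : 0 ≤ ε := (norm_nonneg _).trans (h.norm_V_sub_le 0)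
  have hρ0 : 0 ≤ ρ := by simpa using (norm_nonneg _).trans (hk 1 0)
  have hs0 := Int.fract_nonneg s
  have hs1 := Int.fract_lt_one s
  have e1 : η.L * s = η.L * Int.fract s + ⌊s⌋ * η.L := by
    nth_rw 1 [← Int.fract_add_floor s]; ring
  have e2 : k.L * s = k.L * Int.fract s + ⌊s⌋ * k.L := by
    nth_rw 1 [← Int.fract_add_floor s]; ring
  rw [e1, e2, f_add_int, f_add_int, fd_add_int, fd_add_int]
  set q := Int.fract s with hq
  obtain ⟨x, hx⟩ := hσs (η.L * q)
  have hσ0 : σ 0 = 0 := by simp [hσ]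
  have hx0 : 0 ≤ x := by
    rw [← hσm.le_iff_le, hσ0, hx]
    exact mul_nonneg η.Lpos.le hs0
  have hx1 : x < k.L := by
    rw [← hσm.lt_iff_lt, hx, ← hL]
    nlinarith [η.Lpos]
  have hσx : ∀ x ∈ Icc 0 k.L, |σ x - x| ≤ ε * k.L := by
    intro x hx
    have e3 : σ x - x = ∫ t in (0)..x, (‖V t‖ - 1) := by
      rw [intervalIntegral.integral_sub (h.cont.norm.intervalIntegrable _ _)
        intervalIntegrable_const, hσ]
      simp
    rw [e3, ← Real.norm_eq_abs]
    refine (intervalIntegral.norm_integral_le_of_norm_le_const (C := ε)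
      fun t _ => h.abs_norm_sub_one_le t).trans ?_
    rw [sub_zero, abs_of_nonneg hx.1]
    exact mul_le_mul_of_nonneg_left hx.2 hε0
  have h1 := hσx x ⟨hx0, hx1.le⟩
  have h2 := hσx k.L ⟨hkL.le, le_rfl⟩
  rw [← hL] at h2
  have h3 : |x - k.L * q| ≤ 2 * (ε * k.L) := by
    have : x - k.L * q = (η.L - k.L) * q - (σ x - x) := by rw [hx]; ring
    rw [this]
    refine (abs_sub _ _).trans ?_
    rw [abs_mul, abs_of_nonneg hs0]
    nlinarith [abs_nonneg (η.L - k.L)]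
  rw [← hx, hf, hfd]
  have h4 : ‖E x - k.f (k.L * q)‖ ≤ 3 * (ε * k.L) := by
    have := norm_sub_le_norm_sub_add_norm_sub (E x) (k.f x) (k.f (k.L * q))
    linarith [h.norm_E_sub_le x, k.norm_f_sub_le x (k.L * q)]
  have hVx := h.norm_pos hε x
  have h5 : ‖‖V x‖⁻¹ • V x - V x‖ ≤ ε := by
    have : ‖V x‖⁻¹ • V x - V x = (1 - ‖V x‖) • (‖V x‖⁻¹ • V x) := by
      rw [sub_smul, smul_smul ‖V x‖, mul_inv_cancel₀ hVx.ne', one_smul, one_smul]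
    rw [this, norm_smul, norm_smul, norm_inv, norm_norm, inv_mul_cancel₀ hVx.ne', mul_one,
      Real.norm_eq_abs, abs_sub_comm]
    exact h.abs_norm_sub_one_le x
  have h6 : ‖‖V x‖⁻¹ • V x - k.fd (k.L * q)‖ ≤ 2 * ε + ρ * (2 * (ε * k.L)) := by
    have e3 := norm_sub_le_norm_sub_add_norm_sub (‖V x‖⁻¹ • V x) (V x) (k.fd (k.L * q))
    have e4 := norm_sub_le_norm_sub_add_norm_sub (V x) (k.fd x) (k.fd (k.L * q))
    have e5 := (hk x (k.L * q)).trans (mul_le_mul_of_nonneg_left h3 hρ0)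
    linarith [h.norm_V_sub_le x]
  have h7 : ‖η.L • (‖V x‖⁻¹ • V x) - k.L • k.fd (k.L * q)‖ ≤
      ε * k.L + k.L * (2 * ε + ρ * (2 * (ε * k.L))) := by
    have : η.L • (‖V x‖⁻¹ • V x) - k.L • k.fd (k.L * q) =
        (η.L - k.L) • (‖V x‖⁻¹ • V x) + k.L • (‖V x‖⁻¹ • V x - k.fd (k.L * q)) := by
      module
    rw [this]
    refine (norm_add_le _ _).trans (add_le_add ?_ ?_)
    · rw [norm_smul, norm_smul, norm_inv, norm_norm, inv_mul_cancel₀ hVx.ne', mul_one]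
      exact h2
    · rw [norm_smul, Real.norm_of_nonneg hkL.le]
      exact mul_le_mul_of_nonneg_left h6 hkL.le
  refine (add_le_add h4 h7).trans (le_of_eq ?_)
  ring

end IsPerturbation

theorem sameKnotClass_of_norm_sub_le {c : ℝ} (hc : ∀ g g' : ℝ → Euc n, (∀ s, g (s + 1) = g s) →
    (∀ s, HasDerivAt g (g' s) s) → (∀ s, ‖g' s - k.L • k.fd (k.L * s)‖ ≤ c) →
    InjOn g (Ico 0 1)) {η : Knot n}
    (h : ∀ s, ‖η.L • η.fd (η.L * s) - k.L • k.fd (k.L * s)‖ ≤ c) : SameKnotClass k η := by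
  have hf := k.continuous_f
  have hηf := η.continuous_f
  have hderiv : ∀ (κ : Knot n) s, HasDerivAt (fun s => κ.f (κ.L * s)) (κ.L • κ.fd (κ.L * s)) s := by
    intro κ s
    have := (κ.deriv (κ.L * s)).scomp s ((hasDerivAt_id s).const_mul κ.L)
    simpa [Function.comp_def] using this
  have hper : ∀ (κ : Knot n) s, κ.f (κ.L * (s + 1)) = κ.f (κ.L * s) := by
    intro κ s
    rw [mul_add, mul_one, κ.per]
  refine ⟨fun t s => (1 - t) • k.f (k.L * s) + t • η.f (η.L * s), ?_, ?_, ?_, ?_, ?_⟩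
  · exact Continuous.continuousOn (by fun_prop)
  · intro t s
    simp only [hper]
  · intro s; simp
  · intro s; simp
  · intro t ht
    refine hc _ (fun s => (1 - t) • (k.L • k.fd (k.L * s)) + t • (η.L • η.fd (η.L * s)))
      (fun s => by simp only [hper])
      (fun s => ((hderiv k s).const_smul (1 - t)).add ((hderiv η s).const_smul t)) fun s => ?_
    have : (1 - t) • (k.L • k.fd (k.L * s)) + t • (η.L • η.fd (η.L * s)) - k.L • k.fd (k.L * s) =
        t • (η.L • η.fd (η.L * s) - k.L • k.fd (k.L * s)) := by module
    rw [this, norm_smul, Real.norm_of_nonneg ht.1]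
    exact (mul_le_of_le_one_left (norm_nonneg _) ht.2).trans (h s)

theorem isLocallyShortest_of_relativelyExtremal (hext : RelativelyExtremal k) :
    IsLocallyShortest k.fd k.Ic (1 / RO k.f k.fd univ) := by
  intro α β hαβ hI
  have hL := k.Lpos
  have hr := k.RO_pos
  set r := RO k.f k.fd univ with hrdef
  have hρ : 0 < 1 / r := by positivity
  have hβ : β < α + k.L := by have := k.sub_lt_of_disjoint_Ic hI; linarith
  obtain ⟨c, hc0, hc⟩ := k.exists_injOn_of_norm_sub_le
  obtain ⟨ε₁, hε₁, hdc⟩ := k.exists_two_mul_RO_le hI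
  obtain ⟨ε₂, hε₂, hmin⟩ := hext
  set A := k.L * (6 + 2 * (1 / r) * k.L) with hA
  have hA0 : 0 < A := by positivity
  obtain ⟨ε, hε0, h1, h2, h3, h4, h5⟩ : ∃ ε > 0, ε ≤ 1 / 2 ∧ ε ≤ ε₁ ∧ k.L * ε ≤ c ∧ ε * A ≤ c ∧
      ε * A < ε₂ := by
    refine ⟨min (1 / 2) (min ε₁ (min (c / k.L) (min (c / A) (ε₂ / (2 * A))))), by positivity,
      min_le_left _ _, (min_le_right _ _).trans (min_le_left _ _), ?_, ?_, ?_⟩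
    · rw [← le_div_iff₀' hL]
      exact (min_le_right _ _).trans ((min_le_right _ _).trans (min_le_left _ _))
    · rw [← le_div_iff₀ hA0]
      exact (min_le_right _ _).trans ((min_le_right _ _).trans ((min_le_right _ _).trans
        (min_le_left _ _)))
    · rw [← lt_div_iff₀ hA0]
      refine ((min_le_right _ _).trans ((min_le_right _ _).trans ((min_le_right _ _).trans
        (min_le_right _ _)))).trans_lt ?_
      exact div_lt_div_of_pos_left hε₂ hA0 (by linarith)
  refine ⟨ε, hε0, fun N hN hNα hNβ hNε hint hlip => ?_⟩
  obtain ⟨E, V, hP, hVN⟩ := k.exists_isPerturbation hαβ hβ hN hNα hNβ hint hNε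
  have hVN' : ∀ x y, α ≤ x → x ≤ y → y ≤ β → ∫ t in x..y, ‖N t‖ = ∫ t in x..y, ‖V t‖ := by
    intro x y hx hxy hy
    apply intervalIntegral.integral_congr
    intro t ht
    rw [uIcc_of_le hxy] at ht
    simp only
    rw [hVN t ⟨hx.trans ht.1, by linarith [ht.2]⟩]
  have hlipV : ∀ x y, x ≤ y → ‖‖V y‖⁻¹ • V y - ‖V x‖⁻¹ • V x‖ ≤ 1 / r * ∫ t in x..y, ‖V t‖ := by
    intro x y hxy
    refine hP.lipschitz (by linarith) k.norm_fd_sub_le (fun x y hx hxy hy => ?_) hxy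
    rw [hVN x ⟨hx, by linarith⟩, hVN y ⟨by linarith, by linarith⟩, ← hVN' x y hx hxy hy]
    exact hlip x y hx hxy hy
  have hinj : InjOn E (Ico 0 k.L) := by
    have := hc (fun s => E (k.L * s)) (fun s => k.L • V (k.L * s))
      (fun s => by rw [mul_add, mul_one, hP.per])
      (fun s => by
        have := (hP.deriv (k.L * s)).scomp s ((hasDerivAt_id s).const_mul k.L)
        simpa [Function.comp_def] using this)
      (fun s => by
        rw [← smul_sub, norm_smul, Real.norm_of_nonneg hL.le]
        exact (mul_le_mul_of_nonneg_left (hP.norm_V_sub_le _) hL.le).trans h3)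
    have hmem : ∀ x ∈ Ico 0 k.L, x / k.L ∈ Ico (0 : ℝ) 1 := fun x hx =>
      ⟨div_nonneg hx.1 hL.le, (div_lt_one hL).2 hx.2⟩
    intro x hx y hy hxy
    have h6 := this (hmem x hx) (hmem y hy) (by
      simp only [mul_div_cancel₀ _ hL.ne']; exact hxy)
    rwa [div_left_inj' hL.ne'] at h6
  obtain ⟨η, σ, hσs, hσm, hσ, hηL, hηf, hηfd, hηlip⟩ := exists_knot_reparametrization hL hρ.le
    (m := 1 / 2) (by norm_num) hP.per hP.perd hP.deriv hP.cont
    (fun s => by have := hP.one_sub_le_norm s; linarith) hlipV hinj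
  have hclose := hP.norm_sub_add_norm_sub_le (by linarith) k.norm_fd_sub_le hσs hσm hσ hηL hηf hηfd
  have hclass : SameKnotClass k η := sameKnotClass_of_norm_sub_le hc fun s =>
    (le_add_of_nonneg_left (norm_nonneg _)).trans ((hclose s).trans h4)
  have hrope := hmin η hclass fun s => (hclose s).trans_lt h5
  have hηr := η.RO_pos
  have hRO : r ≤ RO η.f η.fd univ := by
    by_contra! hlt
    obtain ⟨-, x, y, hxy, hd⟩ := η.exists_isDoubleCritical_of_RO_lt hρ
      (angle_le_of_norm_sub_le η.unit hηlip) (by rwa [one_div_one_div])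
    obtain ⟨x, rfl⟩ := hσs x
    obtain ⟨y, rfl⟩ := hσs y
    obtain ⟨hne, hx, hy⟩ := hxy
    simp only [hηf, hηfd, real_inner_smul_right] at hne hx hy hd
    have hV : ∀ s, ‖V s‖⁻¹ ≠ 0 := fun s => inv_ne_zero (hP.norm_pos (by linarith) s).ne'
    have hP' : k.IsPerturbation α β ε₁ E V :=
      { hP with
        norm_V_sub_le := fun s => (hP.norm_V_sub_le s).trans h2
        norm_E_sub_le := fun s => (hP.norm_E_sub_le s).trans
          (mul_le_mul_of_nonneg_right h2 hL.le) }
    have := hdc E V hP' x y hne ((mul_eq_zero.1 hx).resolve_left (hV x))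
      ((mul_eq_zero.1 hy).resolve_left (hV y))
    linarith
  have hLle : k.L ≤ η.L := by
    have h6 : k.L / r ≤ η.L / r := hrope.trans (div_le_div_of_nonneg_left η.Lpos.le hr hRO)
    exact (div_le_div_iff_of_pos_right hr).1 h6
  have hi : ∀ a b, IntervalIntegrable (fun t => ‖V t‖) volume a b :=
    hP.cont.norm.intervalIntegrable
  have hper : Function.Periodic (fun t => ‖V t‖) k.L := fun t => by simp only [hP.perd]
  have h6 := hper.intervalIntegral_add_eq 0 α
  rw [zero_add, ← hσ, ← hηL, ← intervalIntegral.integral_add_adjacent_intervals (hi α β) (hi β _),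
    ← hVN' α β le_rfl hαβ.le le_rfl] at h6
  have h7 : ∫ t in β..(α + k.L), ‖V t‖ = α + k.L - β := by
    have : ∫ t in β..(α + k.L), ‖V t‖ = ∫ t in β..(α + k.L), (1 : ℝ) := by
      apply intervalIntegral.integral_congr
      intro t ht
      rw [uIcc_of_le hβ.le] at ht
      simp only
      rw [hP.V_eq t ht, k.unit]
    rw [this]
    simp
  linarith

end Knot

section Shortest

/-- A tent function supported in `[α, β]`. -/
def bump (α β s : ℝ) : ℝ := max 0 ((s - α) * (β - s))

theorem continuous_bump (α β : ℝ) : Continuous (bump α β) := by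
  unfold bump; fun_prop

theorem bump_nonneg (α β s : ℝ) : 0 ≤ bump α β s := le_max_left _ _

theorem bump_of_le {α β s : ℝ} (hαβ : α ≤ β) (h : s ≤ α) : bump α β s = 0 :=
  max_eq_left (mul_nonpos_of_nonpos_of_nonneg (by linarith) (by linarith))

theorem bump_of_ge {α β s : ℝ} (hαβ : α ≤ β) (h : β ≤ s) : bump α β s = 0 :=
  max_eq_left (mul_nonpos_of_nonneg_of_nonpos (by linarith) (by linarith))

theorem bump_of_mem {α β s : ℝ} (h : s ∈ Icc α β) : bump α β s = (s - α) * (β - s) :=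
  max_eq_right (mul_nonneg (sub_nonneg.2 h.1) (sub_nonneg.2 h.2))

theorem bump_le {α β : ℝ} (s : ℝ) : bump α β s ≤ (β - α) ^ 2 := by
  refine max_le (sq_nonneg _) ?_
  nlinarith [sq_nonneg (s - α + (s - β)), sq_nonneg (β - α)]

theorem bump_pos {α β s : ℝ} (h : s ∈ Ioo α β) : 0 < bump α β s :=
  lt_max_of_lt_right (mul_pos (sub_pos.2 h.1) (sub_pos.2 h.2))

theorem abs_bump_sub_le {α β x y : ℝ} (hx : x ∈ Icc α β) (hy : y ∈ Icc α β) :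
    |bump α β x - bump α β y| ≤ (β - α) * |x - y| := by
  rw [bump_of_mem hx, bump_of_mem hy]
  have : (x - α) * (β - x) - (y - α) * (β - y) = ((β - x) - (y - α)) * (x - y) := by ring
  rw [this, abs_mul]
  refine mul_le_mul_of_nonneg_right (abs_le.2 ⟨?_, ?_⟩) (abs_nonneg _) <;>
    linarith [hx.1, hx.2, hy.1, hy.2]

theorem integral_bump_pos {α β : ℝ} (h : α < β) : 0 < ∫ s in α..β, bump α β s :=
  intervalIntegral.integral_pos h (continuous_bump α β).continuousOn
    (fun s _ => bump_nonneg α β s)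
    ⟨(α + β) / 2, ⟨by linarith, by linarith⟩, bump_pos ⟨by linarith, by linarith⟩⟩

theorem eq_zero_of_integral_nonpos {g : ℝ → ℝ} {α β : ℝ} (hαβ : α < β)
    (hg : ContinuousOn g (Icc α β)) (h0 : ∀ s ∈ Icc α β, 0 ≤ g s) (h : ∫ s in α..β, g s ≤ 0) :
    ∀ s ∈ Icc α β, g s = 0 := by
  intro s hs
  by_contra hne
  exact absurd (intervalIntegral.integral_pos hαβ hg
    (fun x hx => h0 x (Ioc_subset_Icc_self hx)) ⟨s, hs, (h0 s hs).lt_of_ne' hne⟩) (not_lt.2 h)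

theorem continuous_of_norm_sub_le {F : Type*} [NormedAddCommGroup F] {T : ℝ → F} {ρ : ℝ}
    (h : ∀ x y, ‖T x - T y‖ ≤ ρ * |x - y|) : Continuous T := by
  have hρ0 : 0 ≤ ρ := by simpa using (norm_nonneg _).trans (h 1 0)
  have : LipschitzWith (Real.toNNReal ρ) T := LipschitzWith.of_dist_le_mul fun a b => by
    rw [dist_eq_norm, Real.dist_eq, Real.coe_toNNReal _ hρ0]; exact h a b
  exact this.continuous

variable {F : Type*} [NormedAddCommGroup F] [InnerProductSpace ℝ F]

theorem norm_add_le_one_add {e v : F} (he : ‖e‖ = 1) : ‖e + v‖ ≤ 1 + ⟪e, v⟫ + ‖v‖ ^ 2 := by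
  have h1 := norm_add_sq_real e v
  have h2 : -‖v‖ ≤ ⟪e, v⟫ := by
    have := neg_le_of_abs_le (abs_real_inner_le_norm e v)
    rwa [he, one_mul] at this
  rw [he] at h1
  have h3 : 0 ≤ 1 + ⟪e, v⟫ + ‖v‖ ^ 2 := by nlinarith [sq_nonneg (‖v‖ - 1 / 2)]
  refine (pow_le_pow_iff_left₀ (norm_nonneg _) h3 two_ne_zero).1 ?_
  rw [h1]
  nlinarith [sq_nonneg (⟪e, v⟫ + ‖v‖ ^ 2), norm_nonneg v]

variable [CompleteSpace F]

/-- A locally shortest curve is straight where its curvature is less than `ρ`. -/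
theorem IsLocallyShortest.eq_of_lipschitz_lt {T : ℝ → F} {I : Set ℝ} {ρ Λ α β : ℝ}
    (h : IsLocallyShortest T I ρ) (hTc : Continuous T) (hT : ∀ s, ‖T s‖ = 1) (hαβ : α < β)
    (hI : Disjoint (Icc α β) I) (hΛ : Λ < ρ) (hΛ0 : 0 ≤ Λ)
    (hL : ∀ x ∈ Icc α β, ∀ y ∈ Icc α β, ‖T x - T y‖ ≤ Λ * |x - y|) :
    ∃ e, ∀ s ∈ Ioo α β, T s = e := by
  obtain ⟨ε, hε, hS⟩ := h α β hαβ hI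
  set ψ := bump α β with hψ
  have hψc : Continuous ψ := continuous_bump α β
  have hψ0 : ∀ s, 0 ≤ ψ s := bump_nonneg α β
  set ℓ := β - α with hℓ
  have hℓ0 : 0 < ℓ := sub_pos.2 hαβ
  have hψ1 : ∀ s, ψ s ≤ ℓ ^ 2 := fun s => bump_le s
  set J := ∫ s in α..β, ψ s with hJ
  have hJ0 : 0 < J := integral_bump_pos hαβ
  set c : F := J⁻¹ • ∫ s in α..β, ψ s • T s with hc
  have hψT : ∀ a b, IntervalIntegrable (fun s => ψ s • T s) volume a b :=
    (hψc.smul hTc).intervalIntegrable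
  have hJc : ∫ s in α..β, ψ s • T s = J • c := by
    rw [hc, smul_smul, mul_inv_cancel₀ hJ0.ne', one_smul]
  have hc1 : ‖c‖ ≤ 1 := by
    rw [hc, norm_smul, norm_inv, Real.norm_of_nonneg hJ0.le, inv_mul_le_iff₀ hJ0, mul_one]
    refine (intervalIntegral.norm_integral_le_integral_norm hαβ.le).trans (le_of_eq ?_)
    apply intervalIntegral.integral_congr
    intro s _
    simp only [norm_smul, hT, mul_one, Real.norm_of_nonneg (hψ0 s)]
  have hρ : 0 < ρ := hΛ0.trans_lt hΛ
  obtain ⟨η, hη0, h1, h2, h3⟩ : ∃ η > 0, 2 * (η * ℓ ^ 2) ≤ 1 / 2 ∧ 2 * (η * ℓ ^ 2) ≤ ε ∧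
      Λ + η * (2 * ℓ + 4 * ρ * ℓ ^ 2) ≤ ρ := by
    refine ⟨min (1 / (4 * ℓ ^ 2)) (min (ε / (2 * ℓ ^ 2)) ((ρ - Λ) / (2 * ℓ + 4 * ρ * ℓ ^ 2))),
      ?_, ?_, ?_, ?_⟩
    · have := sub_pos.2 hΛ
      positivity
    · have := min_le_left (1 / (4 * ℓ ^ 2))
        (min (ε / (2 * ℓ ^ 2)) ((ρ - Λ) / (2 * ℓ + 4 * ρ * ℓ ^ 2)))
      rw [le_div_iff₀ (by positivity)] at this
      linarith
    · have := (min_le_right (1 / (4 * ℓ ^ 2)) _).trans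
        (min_le_left (ε / (2 * ℓ ^ 2)) ((ρ - Λ) / (2 * ℓ + 4 * ρ * ℓ ^ 2)))
      rw [le_div_iff₀ (by positivity)] at this
      linarith
    · have := (min_le_right (1 / (4 * ℓ ^ 2)) _).trans
        (min_le_right (ε / (2 * ℓ ^ 2)) ((ρ - Λ) / (2 * ℓ + 4 * ρ * ℓ ^ 2)))
      rw [le_div_iff₀ (by positivity)] at this
      linarith
  have hηψ : ∀ s, η * ψ s ≤ η * ℓ ^ 2 := fun s => mul_le_mul_of_nonneg_left (hψ1 s) hη0.le
  have hηψ0 : ∀ s, 0 ≤ η * ψ s := fun s => mul_nonneg hη0.le (hψ0 s)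
  set N : ℝ → F := fun s => T s + (η * ψ s) • (c - T s) with hN
  have hcT : ∀ s, ‖c - T s‖ ≤ 2 := fun s => by
    have := norm_sub_le c (T s)
    rw [hT] at this; linarith
  have hNT : ∀ s, ‖N s - T s‖ ≤ 2 * (η * ℓ ^ 2) := fun s => by
    simp only [hN, add_sub_cancel_left, norm_smul, Real.norm_of_nonneg (hηψ0 s)]
    nlinarith [hηψ s, hηψ0 s, hcT s, norm_nonneg (c - T s)]
  have hNc : Continuous N := by fun_prop
  have hNm : ∀ s, 1 - 2 * (η * ℓ ^ 2) ≤ ‖N s‖ := fun s => by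
    have := norm_sub_norm_le (T s) (N s)
    rw [norm_sub_rev, hT] at this
    linarith [hNT s]
  have hlen := hS N hNc
    (fun s hs => by simp only [hN, hψ, bump_of_le hαβ.le hs, mul_zero, zero_smul, add_zero])
    (fun s hs => by simp only [hN, hψ, bump_of_ge hαβ.le hs, mul_zero, zero_smul, add_zero])
    (fun s => (hNT s).trans h2) ?_ ?_
  · have hle : ∫ s in α..β, ‖N s‖ ≤ ∫ s in α..β, (1 - η * (1 - ‖c‖) * ψ s) := by
      refine intervalIntegral.integral_mono_on hαβ.le (hNc.norm.intervalIntegrable _ _)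
        ((by fun_prop : Continuous fun s => 1 - η * (1 - ‖c‖) * ψ s).intervalIntegrable _ _)
        fun s _ => ?_
      have e1 : N s = (1 - η * ψ s) • T s + (η * ψ s) • c := by simp only [hN]; module
      rw [e1]
      refine (norm_add_le _ _).trans (le_of_eq ?_)
      rw [norm_smul, norm_smul, hT, Real.norm_of_nonneg (hηψ0 s), Real.norm_of_nonneg]
      · ring
      · linarith [hηψ s]
    rw [intervalIntegral.integral_sub intervalIntegrable_const
      ((hψc.const_mul _).intervalIntegrable _ _), intervalIntegral.integral_const_mul,
      intervalIntegral.integral_const, smul_eq_mul, mul_one, ← hJ] at hle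
    have hc2 : 1 ≤ ‖c‖ := by
      by_contra! hlt
      have : 0 < η * (1 - ‖c‖) * J := mul_pos (mul_pos hη0 (sub_pos.2 hlt)) hJ0
      linarith
    have hc3 : ‖c‖ = 1 := le_antisymm hc1 hc2
    have hz := eq_zero_of_integral_nonpos (g := fun s => ψ s * (1 - ⟪T s, c⟫)) hαβ
      (Continuous.continuousOn (by fun_prop)) (fun s _ => ?_) (le_of_eq ?_)
    · refine ⟨c, fun s hs => ?_⟩
      have hz := (mul_eq_zero.1 (hz s (Ioo_subset_Icc_self hs))).resolve_left (bump_pos hs).ne'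
      exact (inner_eq_one_iff_of_norm_eq_one (𝕜 := ℝ) (hT s) hc3).1 (by linarith)
    · refine mul_nonneg (hψ0 s) (sub_nonneg.2 ?_)
      have := real_inner_le_norm (T s) c
      rwa [hT, hc3, one_mul] at this
    · have e1 : ∫ s in α..β, ψ s * (1 - ⟪T s, c⟫) =
          ∫ s in α..β, (ψ s - ⟪c, ψ s • T s⟫) := by
        apply intervalIntegral.integral_congr
        intro s _
        simp only [real_inner_smul_right, real_inner_comm c]
        ring
      have e2 : ∫ s in α..β, ⟪c, ψ s • T s⟫ = J := by
        have := (innerSL ℝ c).intervalIntegral_comp_comm (hψT α β)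
        simp only [innerSL_apply_apply] at this
        rw [this, hJc, real_inner_smul_right, real_inner_self_eq_norm_sq, hc3]
        simp
      rw [e1, intervalIntegral.integral_sub (hψc.intervalIntegrable _ _)
        ((by fun_prop : Continuous fun s => ⟪c, ψ s • T s⟫).intervalIntegrable _ _), e2, ← hJ,
        sub_self]
  · have e1 : ∫ s in α..β, N s =
        ∫ s in α..β, (T s + (η • ψ s • c - η • ψ s • T s)) := by
      apply intervalIntegral.integral_congr
      intro s _
      simp only [hN]
      module
    rw [e1, intervalIntegral.integral_add (hTc.intervalIntegrable _ _)
      ((by fun_prop : Continuous fun s => η • ψ s • c - η • ψ s • T s).intervalIntegrable _ _),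
      intervalIntegral.integral_sub
      ((by fun_prop : Continuous fun s => η • ψ s • c).intervalIntegrable _ _)
      ((by fun_prop : Continuous fun s => η • ψ s • T s).intervalIntegrable _ _),
      intervalIntegral.integral_smul, intervalIntegral.integral_smul, hJc,
      intervalIntegral.integral_smul_const, ← hJ, sub_self, add_zero]
  · intro x y hx hxy hy
    have hm : 0 < 1 - 2 * (η * ℓ ^ 2) := by linarith
    have e1 : N y - N x = (1 - η * ψ y) • (T y - T x) + (η * (ψ y - ψ x)) • (c - T x) := by
      simp only [hN]; module
    have hx' : x ∈ Icc α β := ⟨hx, hxy.trans hy⟩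
    have hy' : y ∈ Icc α β := ⟨hx.trans hxy, hy⟩
    have e2 : ‖N y - N x‖ ≤ (Λ + 2 * η * ℓ) * (y - x) := by
      have a1 := hL y hy' x hx'
      have a2 := abs_bump_sub_le hy' hx'
      rw [abs_of_nonneg (sub_nonneg.2 hxy)] at a1 a2
      rw [e1]
      refine (norm_add_le _ _).trans ?_
      rw [norm_smul, norm_smul, norm_mul, Real.norm_of_nonneg hη0.le, Real.norm_eq_abs (ψ y - ψ x),
        Real.norm_of_nonneg (by linarith [hηψ y])]
      have a3 : (1 - η * ψ y) * ‖T y - T x‖ ≤ Λ * (y - x) := by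
        nlinarith [hηψ0 y, norm_nonneg (T y - T x)]
      have a4 : η * |ψ y - ψ x| * ‖c - T x‖ ≤ η * (ℓ * (y - x)) * 2 := by
        have := hcT x
        gcongr
      linarith
    have e3 : (1 - 2 * (η * ℓ ^ 2)) * (y - x) ≤ ∫ t in x..y, ‖N t‖ := by
      have := intervalIntegral.integral_mono_on hxy intervalIntegrable_const
        (hNc.norm.intervalIntegrable (μ := volume) x y) fun t _ => hNm t
      rw [intervalIntegral.integral_const, smul_eq_mul] at this
      linarith
    refine (norm_normalize_sub_le hm (hNm y) (hNm x)).trans ?_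
    rw [div_le_iff₀ hm]
    have e4 : ρ * ((1 - 2 * (η * ℓ ^ 2)) * (y - x)) * (1 - 2 * (η * ℓ ^ 2)) ≤
        ρ * (∫ t in x..y, ‖N t‖) * (1 - 2 * (η * ℓ ^ 2)) := by gcongr
    refine (e2.trans ?_).trans e4
    have e5 : Λ + 2 * η * ℓ ≤ ρ * (1 - 2 * (η * ℓ ^ 2)) ^ 2 := by
      nlinarith [mul_nonneg hρ.le (sq_nonneg (2 * (η * ℓ ^ 2)))]
    nlinarith [mul_le_mul_of_nonneg_right e5 (sub_nonneg.2 hxy)]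

end Shortest

section Shortest

variable {F : Type*} [NormedAddCommGroup F] [InnerProductSpace ℝ F] [CompleteSpace F]

/-- First variation at a line segment preceding a modified piece: the segment absorbs the change
of the endpoint. -/
theorem IsLocallyShortest.exists_inner_le {T : ℝ → F} {I : Set ℝ} {ρ a b m₁ : ℝ} {e : F}
    (h : IsLocallyShortest T I ρ) (hρ : 0 < ρ) (hTL : ∀ x y, ‖T x - T y‖ ≤ ρ * |x - y|) (hab : a < b)
    (hbm : b < m₁) (hI : Disjoint (Icc a m₁) I) (he : ‖e‖ = 1) (hTe : ∀ s ∈ Icc a b, T s = e) :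
    ∃ ε > 0, ∃ K > 0, ∀ m ∈ Icc b m₁, ∀ S : ℝ → F, (∀ s, ‖S s‖ = 1) →
      (∀ x y, ‖S x - S y‖ ≤ ρ * |x - y|) →
      (∀ s ≤ b, S s = T s) → (∀ s ≥ m, S s = T s) → (∀ s ∈ Icc b m, ‖S s - T s‖ ≤ ε) →
      ∫ s in b..m, ⟪e, S s - T s⟫ ≤ K * ‖∫ s in b..m, (T s - S s)‖ ^ 2 := by
  obtain ⟨ε, hε, hS⟩ := h a m₁ (hab.trans hbm) hI
  set ℓ := b - a with hℓ
  have hℓ0 : 0 < ℓ := sub_pos.2 hab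
  set ψ := bump a b with hψ
  have hψc : Continuous ψ := continuous_bump a b
  have hψ0 : ∀ s, 0 ≤ ψ s := bump_nonneg a b
  have hψ1 : ∀ s, ψ s ≤ ℓ ^ 2 := fun s => bump_le s
  set J := ∫ s in a..b, ψ s with hJ
  have hJ0 : 0 < J := integral_bump_pos hab
  set D := m₁ - b with hD
  have hD0 : 0 < D := sub_pos.2 hbm
  obtain ⟨ε', hε', h1, h2, h3⟩ : ∃ ε' > 0, ε' ≤ ε / 2 ∧ ℓ ^ 2 * (ε' * D / J) ≤ min (ε / 2) (1 / 2)
      ∧ ℓ * (ε' * D / J) ≤ ρ / 4 := by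
    refine ⟨min (ε / 2) (min (min (ε / 2) (1 / 2) * J / (ℓ ^ 2 * D)) (ρ / 4 * J / (ℓ * D))),
      by positivity, min_le_left _ _, ?_, ?_⟩
    · have := (min_le_right (ε / 2) _).trans
        (min_le_left (min (ε / 2) (1 / 2) * J / (ℓ ^ 2 * D)) (ρ / 4 * J / (ℓ * D)))
      rw [le_div_iff₀ (by positivity)] at this
      rw [← mul_div_assoc, div_le_iff₀ hJ0]
      linarith
    · have := (min_le_right (ε / 2) _).trans
        (min_le_right (min (ε / 2) (1 / 2) * J / (ℓ ^ 2 * D)) (ρ / 4 * J / (ℓ * D)))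
      rw [le_div_iff₀ (by positivity)] at this
      rw [← mul_div_assoc, div_le_iff₀ hJ0]
      linarith
  refine ⟨ε', hε', (J⁻¹ ^ 2 * ∫ s in a..b, ψ s ^ 2), ?_, ?_⟩
  · have : 0 < ∫ s in a..b, ψ s ^ 2 := intervalIntegral.integral_pos hab
      (hψc.pow 2).continuousOn (fun s _ => sq_nonneg _)
      ⟨(a + b) / 2, ⟨by linarith, by linarith⟩, pow_pos (bump_pos ⟨by linarith, by linarith⟩) 2⟩
    positivity
  intro m hm S hS1 hSL hSb hSm hSε
  have hSc := continuous_of_norm_sub_le hSL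
  have hTc := continuous_of_norm_sub_le hTL
  set w := ∫ s in b..m, (T s - S s) with hw
  set v := J⁻¹ • w with hv
  have hSε' : ∀ s, ‖S s - T s‖ ≤ ε' := by
    intro s
    rcases le_total s b with hs | hs
    · rw [hSb s hs]; simpa using hε'.le
    rcases le_total m s with hs' | hs'
    · rw [hSm s hs']; simpa using hε'.le
    · exact hSε s ⟨hs, hs'⟩
  have hwn : ‖w‖ ≤ ε' * D := by
    refine (intervalIntegral.norm_integral_le_of_norm_le_const (C := ε')
      fun s _ => by rw [norm_sub_rev]; exact hSε' s).trans ?_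
    rw [abs_of_nonneg (by linarith [hm.1])]
    exact mul_le_mul_of_nonneg_left (by linarith [hm.2]) hε'.le
  have hvn : ‖v‖ ≤ ε' * D / J := by
    rw [hv, norm_smul, norm_inv, Real.norm_of_nonneg hJ0.le, inv_mul_eq_div]
    gcongr
  set N : ℝ → F := fun s => S s + ψ s • v with hN
  have hNc : Continuous N := by fun_prop
  have hψv : ∀ s, ‖ψ s • v‖ ≤ min (ε / 2) (1 / 2) := fun s => by
    rw [norm_smul, Real.norm_of_nonneg (hψ0 s)]
    exact (mul_le_mul (hψ1 s) hvn (norm_nonneg _) (by positivity)).trans h2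
  have hNb : ∀ s, b ≤ s → N s = S s := fun s hs => by
    simp only [hN, hψ, bump_of_ge hab.le hs, zero_smul, add_zero]
  have hNe : ∀ s ∈ Icc a b, N s = e + ψ s • v := fun s hs => by
    simp only [hN, hSb s hs.2, hTe s hs]
  have hint : ∀ {f : ℝ → F}, Continuous f → ∀ a b, IntervalIntegrable f volume a b :=
    fun h => h.intervalIntegrable
  have hTS : ∀ x y, m ≤ x → x ≤ y → ∫ s in x..y, S s = ∫ s in x..y, T s := by
    intro x y hx hxy
    apply intervalIntegral.integral_congr
    intro s hs
    rw [uIcc_of_le hxy] at hs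
    exact hSm s (hx.trans hs.1)
  have hNn1 : ∀ x y, b ≤ x → x ≤ y → ∫ t in x..y, ‖N t‖ = y - x := by
    intro x y hx hxy
    have : ∫ t in x..y, ‖N t‖ = ∫ t in x..y, (1 : ℝ) := by
      apply intervalIntegral.integral_congr
      intro s hs
      rw [uIcc_of_le hxy] at hs
      simp only [hNb s (hx.trans hs.1), hS1]
    rw [this]; simp
  have hN2 : ∀ s, 1 / 2 ≤ ‖N s‖ := fun s => by
    have e1 := norm_sub_norm_le (S s) (N s)
    have e2 : S s - N s = -(ψ s • v) := by simp [hN]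
    rw [e2, norm_neg, hS1] at e1
    linarith [(hψv s).trans (min_le_right _ _)]
  have hlen := hS N hNc
    (fun s hs => by
      simp only [hN, hψ, bump_of_le hab.le hs, zero_smul, add_zero, hSb s (hs.trans hab.le)])
    (fun s hs => by rw [hNb s (hbm.le.trans hs), hSm s (hm.2.trans hs)])
    (fun s => ?_) ?_ ?_
  · have hsplit := intervalIntegral.integral_add_adjacent_intervals
      (hNc.norm.intervalIntegrable (μ := volume) a b) (hNc.norm.intervalIntegrable b m₁)
    rw [← hsplit, hNn1 b m₁ le_rfl hbm.le] at hlen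
    have hle : ∫ s in a..b, ‖N s‖ ≤
        ∫ s in a..b, (1 + (ψ s * ⟪e, v⟫ + ψ s ^ 2 * ‖v‖ ^ 2)) := by
      refine intervalIntegral.integral_mono_on hab.le (hNc.norm.intervalIntegrable _ _)
        ((by fun_prop : Continuous fun s => 1 + (ψ s * ⟪e, v⟫ + ψ s ^ 2 * ‖v‖ ^ 2)
          ).intervalIntegrable _ _) fun s hs => ?_
      rw [hNe s hs]
      refine (norm_add_le_one_add he).trans (le_of_eq ?_)
      rw [real_inner_smul_right, norm_smul, mul_pow, Real.norm_eq_abs, sq_abs, add_assoc]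
    rw [intervalIntegral.integral_add intervalIntegrable_const
      ((by fun_prop : Continuous fun s => ψ s * ⟪e, v⟫ + ψ s ^ 2 * ‖v‖ ^ 2).intervalIntegrable _ _),
      intervalIntegral.integral_add
      ((by fun_prop : Continuous fun s => ψ s * ⟪e, v⟫).intervalIntegrable _ _)
      ((by fun_prop : Continuous fun s => ψ s ^ 2 * ‖v‖ ^ 2).intervalIntegrable _ _),
      intervalIntegral.integral_mul_const, intervalIntegral.integral_mul_const, ← hJ,
      intervalIntegral.integral_const, smul_eq_mul, mul_one, hv, real_inner_smul_right, norm_smul,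
      mul_pow, norm_inv, Real.norm_of_nonneg hJ0.le, mul_inv_cancel_left₀ hJ0.ne'] at hle
    have hG : ∫ s in b..m, ⟪e, S s - T s⟫ = -⟪e, w⟫ := by
      have := (innerSL ℝ e).intervalIntegral_comp_comm
        ((by fun_prop : Continuous fun s => S s - T s).intervalIntegrable (μ := volume) b m)
      simp only [innerSL_apply_apply] at this
      rw [this, hw, ← inner_neg_right, ← intervalIntegral.integral_neg]
      simp only [neg_sub]
    rw [hG]
    linarith
  · have e1 : N s - T s = (S s - T s) + ψ s • v := by simp only [hN]; abel
    rw [e1]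
    have := (hψv s).trans (min_le_left _ _)
    linarith [norm_add_le (S s - T s) (ψ s • v), hSε' s]
  · have e1 : ∫ s in a..b, N s = (∫ s in a..b, T s) + w := by
      have : ∫ s in a..b, N s = ∫ s in a..b, (T s + ψ s • v) := by
        apply intervalIntegral.integral_congr
        intro s hs
        rw [uIcc_of_le hab.le] at hs
        simp only [hN, hSb s hs.2]
      rw [this, intervalIntegral.integral_add (hint hTc _ _) (hint (by fun_prop) _ _),
        intervalIntegral.integral_smul_const, ← hJ, hv, smul_smul, mul_inv_cancel₀ hJ0.ne', one_smul]
    have e2 : ∫ s in b..m₁, N s = (∫ s in b..m₁, T s) - w := by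
      have : ∫ s in b..m₁, N s = ∫ s in b..m₁, S s := by
        apply intervalIntegral.integral_congr
        intro s hs
        rw [uIcc_of_le hbm.le] at hs
        exact hNb s hs.1
      rw [this, ← intervalIntegral.integral_add_adjacent_intervals (hint hSc b m) (hint hSc m m₁),
        ← intervalIntegral.integral_add_adjacent_intervals (hint hTc b m) (hint hTc m m₁),
        hTS m m₁ le_rfl hm.2, hw,
        intervalIntegral.integral_sub (hint hTc _ _) (hint hSc _ _)]
      abel
    rw [← intervalIntegral.integral_add_adjacent_intervals (hint hNc a b) (hint hNc b m₁), e1, e2,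
      ← intervalIntegral.integral_add_adjacent_intervals (hint hTc a b) (hint hTc b m₁)]
    abel
  · have hl : ∀ x y, a ≤ x → x ≤ y → y ≤ b →
        ‖‖N y‖⁻¹ • N y - ‖N x‖⁻¹ • N x‖ ≤ ρ * ∫ t in x..y, ‖N t‖ := by
      intro x y hx hxy hy
      refine (norm_normalize_sub_le one_half_pos (hN2 y) (hN2 x)).trans ?_
      have hx' : x ∈ Icc a b := ⟨hx, hxy.trans hy⟩
      have hy' : y ∈ Icc a b := ⟨hx.trans hxy, hy⟩
      have e1 : N y - N x = (ψ y - ψ x) • v := by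
        rw [hNe x hx', hNe y hy']; module
      have e2 : ‖N y - N x‖ ≤ ρ / 4 * (y - x) := by
        rw [e1, norm_smul, Real.norm_eq_abs]
        have := abs_bump_sub_le hy' hx'
        rw [abs_of_nonneg (sub_nonneg.2 hxy)] at this
        have h4 : ℓ * (y - x) * (ε' * D / J) = ℓ * (ε' * D / J) * (y - x) := by ring
        refine (mul_le_mul this hvn (norm_nonneg _) (by
          have := sub_nonneg.2 hxy; positivity)).trans ?_
        rw [← hℓ, h4]
        exact mul_le_mul_of_nonneg_right h3 (sub_nonneg.2 hxy)
      have e3 : 1 / 2 * (y - x) ≤ ∫ t in x..y, ‖N t‖ := by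
        have := intervalIntegral.integral_mono_on hxy intervalIntegrable_const
          (hNc.norm.intervalIntegrable (μ := volume) x y) fun t _ => hN2 t
        rw [intervalIntegral.integral_const, smul_eq_mul] at this
        linarith
      rw [div_le_iff₀ one_half_pos]
      nlinarith [mul_le_mul_of_nonneg_left e3 hρ.le]
    have hr : ∀ x y, b ≤ x → x ≤ y →
        ‖‖N y‖⁻¹ • N y - ‖N x‖⁻¹ • N x‖ ≤ ρ * ∫ t in x..y, ‖N t‖ := by
      intro x y hx hxy
      rw [hNn1 x y hx hxy, hNb x hx, hNb y (hx.trans hxy), hS1, hS1]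
      have := hSL y x
      rw [abs_of_nonneg (sub_nonneg.2 hxy)] at this
      simpa using this
    intro x y hx hxy hy
    rcases le_total y b with hyb | hyb
    · exact hl x y hx hxy hyb
    rcases le_total b x with hxb | hxb
    · exact hr x y hxb hxy
    · rw [← intervalIntegral.integral_add_adjacent_intervals
        (hNc.norm.intervalIntegrable (μ := volume) x b) (hNc.norm.intervalIntegrable b y), mul_add,
        add_comm]
      exact (norm_sub_le_norm_sub_add_norm_sub _ (‖N b‖⁻¹ • N b) _).trans
        (add_le_add (hr b y le_rfl hyb) (hl x b hx hxb le_rfl))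

end Shortest

section Ramp

theorem norm_sub_le_glue {F : Type*} [NormedAddCommGroup F] {A B : ℝ → F} {ρ c : ℝ}
    (hA : ∀ x y, ‖A x - A y‖ ≤ ρ * |x - y|) (hB : ∀ x y, ‖B x - B y‖ ≤ ρ * |x - y|)
    (hAB : A c = B c) (x y : ℝ) :
    ‖(if x ≤ c then A x else B x) - (if y ≤ c then A y else B y)‖ ≤ ρ * |x - y| := by
  have key : ∀ x y, x ≤ c → c < y → ‖A x - B y‖ ≤ ρ * |x - y| := by
    intro x y hx hy
    have h1 := hA x c
    have h2 := hB c y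
    rw [abs_sub_comm, abs_of_nonneg (by linarith)] at h1 h2
    rw [abs_sub_comm, abs_of_nonneg (by linarith)]
    have := norm_sub_le_norm_sub_add_norm_sub (A x) (A c) (B y)
    rw [hAB] at this h1
    linarith
  split_ifs with h1 h2 h2
  · exact hA x y
  · exact key x y h1 (not_le.1 h2)
  · rw [norm_sub_rev, abs_sub_comm]
    exact key y x h2 (not_le.1 h1)
  · exact hB x y

variable {F : Type*} [NormedAddCommGroup F] [InnerProductSpace ℝ F]

/-- The point at angle `φ` from `e` on the unit circle spanned by `e` and `u`. -/
noncomputable def circ (e u : F) (φ : ℝ) : F := Real.cos φ • e + Real.sin φ • u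

theorem circ_zero (e u : F) : circ e u 0 = e := by simp [circ]

theorem continuous_circ (e u : F) : Continuous (circ e u) := by
  unfold circ; fun_prop

theorem inner_circ {e u : F} (he : ‖e‖ = 1) (heu : ⟪e, u⟫ = 0) (φ : ℝ) :
    ⟪e, circ e u φ⟫ = Real.cos φ := by
  simp only [circ, inner_add_right, real_inner_smul_right, real_inner_self_eq_norm_sq, he, heu]
  ring

theorem inner_circ_circ {e u : F} (he : ‖e‖ = 1) (hu : ‖u‖ = 1) (heu : ⟪e, u⟫ = 0) (φ θ : ℝ) :
    ⟪circ e u φ, circ e u θ⟫ = Real.cos (φ - θ) := by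
  have hue : ⟪u, e⟫ = 0 := by rw [real_inner_comm]; exact heu
  simp only [circ, inner_add_right, inner_add_left, real_inner_smul_right, real_inner_smul_left,
    real_inner_self_eq_norm_sq, he, hu, heu, hue, Real.cos_sub]
  ring

theorem norm_circ {e u : F} (he : ‖e‖ = 1) (hu : ‖u‖ = 1) (heu : ⟪e, u⟫ = 0) (φ : ℝ) :
    ‖circ e u φ‖ = 1 := by
  have := inner_circ_circ he hu heu φ φ
  rw [real_inner_self_eq_norm_sq, sub_self, Real.cos_zero] at this
  exact (pow_eq_one_iff_of_nonneg (norm_nonneg _) two_ne_zero).1 this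

theorem norm_circ_sub_circ_le {e u : F} (he : ‖e‖ = 1) (hu : ‖u‖ = 1) (heu : ⟪e, u⟫ = 0)
    (φ θ : ℝ) : ‖circ e u φ - circ e u θ‖ ≤ |φ - θ| := by
  refine (pow_le_pow_iff_left₀ (norm_nonneg _) (abs_nonneg _) two_ne_zero).1 ?_
  rw [norm_sub_sq_real, norm_circ he hu heu, norm_circ he hu heu, inner_circ_circ he hu heu, sq_abs]
  have := Real.one_sub_sq_div_two_le_cos (x := φ - θ)
  linarith

theorem norm_circ_sub_circ_le' (e u u' : F) (φ : ℝ) :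
    ‖circ e u φ - circ e u' φ‖ ≤ ‖u - u'‖ := by
  have : circ e u φ - circ e u' φ = Real.sin φ • (u - u') := by simp only [circ]; module
  rw [this, norm_smul]
  exact mul_le_of_le_one_left (norm_nonneg _) (Real.abs_sin_le_one φ)

/-- Every unit vector lies on a unit half circle starting at `e`. -/
theorem exists_eq_circ (hF : ∀ e : F, ‖e‖ = 1 → ∃ u : F, ‖u‖ = 1 ∧ ⟪e, u⟫ = 0) {e p : F}
    (he : ‖e‖ = 1) (hp : ‖p‖ = 1) :
    ∃ u : F, ‖u‖ = 1 ∧ ⟪e, u⟫ = 0 ∧ p = circ e u (InnerProductGeometry.angle e p) := by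
  set θ := InnerProductGeometry.angle e p with hθ
  have hc : ⟪e, p⟫ = Real.cos θ := by
    rw [hθ, InnerProductGeometry.cos_angle, he, hp]; simp
  have hn : ‖p - Real.cos θ • e‖ ^ 2 = Real.sin θ ^ 2 := by
    rw [norm_sub_sq_real, real_inner_smul_right, real_inner_comm, hc, norm_smul, hp, he,
      Real.norm_eq_abs, mul_one, sq_abs, Real.sin_sq]
    ring
  have hs : 0 ≤ Real.sin θ := Real.sin_nonneg_of_nonneg_of_le_pi
    (InnerProductGeometry.angle_nonneg _ _) (InnerProductGeometry.angle_le_pi _ _)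
  rcases hs.eq_or_lt with h0 | h0
  · obtain ⟨u, hu, heu⟩ := hF e he
    refine ⟨u, hu, heu, ?_⟩
    rw [← h0, zero_pow two_ne_zero] at hn
    have := norm_eq_zero.1 ((pow_eq_zero_iff two_ne_zero).1 hn)
    rw [circ, ← h0, zero_smul, add_zero]
    exact sub_eq_zero.1 this
  · have hn' : ‖p - Real.cos θ • e‖ = Real.sin θ :=
      (pow_left_inj₀ (norm_nonneg _) hs two_ne_zero).1 hn
    refine ⟨(Real.sin θ)⁻¹ • (p - Real.cos θ • e), ?_, ?_, ?_⟩
    · rw [norm_smul, hn', norm_inv, Real.norm_of_nonneg hs, inv_mul_cancel₀ h0.ne']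
    · rw [real_inner_smul_right, inner_sub_right, real_inner_smul_right,
        real_inner_self_eq_norm_sq, he, hc]
      ring
    · rw [circ, smul_smul, mul_inv_cancel₀ h0.ne', one_smul]
      abel

/-- Comparison of a unit vector `x` with the point `circ e u φ` of the great circle through `e`
and `circ e u θ`. -/
theorem sin_mul_one_sub_inner_le {e u x : F} {θ φ : ℝ} (he : ‖e‖ = 1) (heu : ⟪e, u⟫ = 0)
    (hφ0 : 0 ≤ φ) (hφπ : φ ≤ Real.pi)
    (hx : φ = 0 ∨ Real.cos (θ - φ) ≤ ⟪x, circ e u θ⟫) :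
    Real.sin θ * (1 - ⟪x, circ e u φ⟫) ≤ Real.sin (θ - φ) * ⟪e, circ e u φ - x⟫ := by
  rw [inner_sub_right, inner_circ he heu, real_inner_comm x e]
  simp only [circ, inner_add_right, real_inner_smul_right] at hx ⊢
  rcases hx with rfl | hx
  · simp
  · have e1 : Real.sin θ = Real.sin (θ - φ) * Real.cos φ + Real.cos (θ - φ) * Real.sin φ := by
      rw [← Real.sin_add]; ring_nf
    have e2 := mul_le_mul_of_nonneg_left hx (Real.sin_nonneg_of_nonneg_of_le_pi hφ0 hφπ)
    have e3 : Real.sin (θ - φ) * ⟪x, e⟫ =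
        (Real.sin θ * Real.cos φ - Real.cos θ * Real.sin φ) * ⟪x, e⟫ := by rw [Real.sin_sub]
    linarith

/-- Replacing a piece of a curve on the unit sphere by waiting at its initial point and then moving
at full speed along a great circle to its final point. -/
theorem exists_ramp (hF : ∀ e : F, ‖e‖ = 1 → ∃ u : F, ‖u‖ = 1 ∧ ⟪e, u⟫ = 0) {T : ℝ → F}
    {ρ b m : ℝ} {e : F} (hρ : 0 < ρ) (hT : ∀ s, ‖T s‖ = 1)
    (hL : ∀ x y, ‖T x - T y‖ ≤ ρ * |x - y|) (hbm : b ≤ m) (he : T b = e)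
    (hπ : InnerProductGeometry.angle e (T m) < Real.pi) :
    ∃ (θ : ℝ) (u : F) (S : ℝ → F), θ = InnerProductGeometry.angle e (T m) ∧
      θ ≤ ρ * (m - b) ∧ ‖u‖ = 1 ∧ ⟪e, u⟫ = 0 ∧
      (∀ s, ‖S s‖ = 1) ∧ (∀ x y, ‖S x - S y‖ ≤ ρ * |x - y|) ∧
      (∀ s ≤ b, S s = T s) ∧ (∀ s ≥ m, S s = T s) ∧
      (∀ s ∈ Icc b m, S s = circ e u (max 0 (θ - ρ * (m - s)))) ∧
      (∀ s ∈ Icc b m, 0 ≤ ⟪e, S s - T s⟫) ∧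
      (∀ s ∈ Icc b m, Real.sin θ * ‖S s - T s‖ ^ 2 ≤
        2 * Real.sin (θ - max 0 (θ - ρ * (m - s))) * ⟪e, S s - T s⟫) ∧
      (θ ≤ Real.pi / 2 → ∀ s ∈ Icc b m, ‖S s - T s‖ ^ 2 ≤ 2 * ⟪e, S s - T s⟫) := by
  have he1 : ‖e‖ = 1 := by rw [← he, hT]
  obtain ⟨u, hu, heu, hp⟩ := exists_eq_circ hF he1 (hT m)
  set θ := InnerProductGeometry.angle e (T m) with hθ
  have hθ0 : 0 ≤ θ := InnerProductGeometry.angle_nonneg _ _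
  have hang := angle_le_of_norm_sub_le hT hL
  have hθm : θ ≤ ρ * (m - b) := by
    have := hang b m
    rwa [he, abs_sub_comm, abs_of_nonneg (by linarith)] at this
  set φ : ℝ → ℝ := fun s => max 0 (θ - ρ * (m - s)) with hφ
  have hφb : φ b = 0 := max_eq_left (by linarith)
  have hφm : φ m = θ := by simp [hφ, hθ0]
  have hφ0 : ∀ s, 0 ≤ φ s := fun s => le_max_left _ _
  have hφθ : ∀ s ≤ m, φ s ≤ θ := fun s hs =>
    max_le hθ0 (by linarith [mul_nonneg hρ.le (sub_nonneg.2 hs)])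
  have hφL : ∀ x y, |φ x - φ y| ≤ ρ * |x - y| := fun x y => by
    refine (abs_max_sub_max_le_max _ _ _ _).trans ?_
    rw [sub_self, abs_zero, max_eq_right (abs_nonneg _)]
    have : θ - ρ * (m - x) - (θ - ρ * (m - y)) = ρ * (x - y) := by ring
    rw [this, abs_mul, abs_of_pos hρ]
  set S : ℝ → F := fun s => if s ≤ b then T s else if s ≤ m then circ e u (φ s) else T s with hS
  have hcL : ∀ x y, ‖circ e u (φ x) - circ e u (φ y)‖ ≤ ρ * |x - y| := fun x y =>
    (norm_circ_sub_circ_le he1 hu heu _ _).trans (hφL x y)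
  have hSL : ∀ x y, ‖S x - S y‖ ≤ ρ * |x - y| :=
    norm_sub_le_glue hL (norm_sub_le_glue hcL hL (by rw [hφm, hp]))
      (by rw [if_pos hbm, hφb, circ_zero, he])
  have hSb : ∀ s ≤ b, S s = T s := fun s hs => if_pos hs
  have hSm : ∀ s ≥ m, S s = T s := by
    intro s hs
    rcases hs.eq_or_lt with rfl | hs
    · simp only [hS, le_refl, hφm, ← hp, ite_self]
    · simp only [hS, if_neg (not_le.2 hs), ite_self]
  have hSφ : ∀ s ∈ Icc b m, S s = circ e u (φ s) := by
    intro s hs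
    rcases hs.1.eq_or_lt with rfl | h
    · rw [hSb _ le_rfl, hφb, circ_zero, he]
    · simp only [hS, if_neg (not_le.2 h), if_pos hs.2]
  have hS1 : ∀ s, ‖S s‖ = 1 := by
    intro s
    simp only [hS]
    split_ifs
    exacts [hT s, norm_circ he1 hu heu _, hT s]
  have hsq : ∀ s, ‖S s - T s‖ ^ 2 = 2 * (1 - ⟪T s, S s⟫) := fun s => by
    rw [norm_sub_sq_real, hS1, hT, real_inner_comm]; ring
  have hmain : ∀ s ∈ Icc b m, Real.sin θ * (1 - ⟪T s, S s⟫) ≤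
      Real.sin (θ - φ s) * ⟪e, S s - T s⟫ := by
    intro s hs
    rw [hSφ s hs]
    refine sin_mul_one_sub_inner_le he1 heu (hφ0 s) ((hφθ s hs.2).trans hπ.le) ?_
    rcases (hφ0 s).eq_or_lt with h | h
    · exact Or.inl h.symm
    · right
      have h1 : φ s = θ - ρ * (m - s) := by
        rcases max_choice 0 (θ - ρ * (m - s)) with h2 | h2
        · exact absurd h2 h.ne'
        · exact h2
      rw [← hp]
      refine cos_le_inner_of_angle_le (hT s) (hT m) ?_ (by linarith [hφ0 s])
      have := hang s m
      rw [abs_sub_comm, abs_of_nonneg (by linarith [hs.2])] at this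
      linarith
  have h1T : ∀ s, 0 ≤ 1 - ⟪T s, S s⟫ := fun s => by
    have := real_inner_le_norm (T s) (S s)
    rw [hT, hS1] at this
    linarith
  have heT : ∀ s, ⟪e, T s⟫ ≤ 1 := fun s => by
    have := real_inner_le_norm e (T s)
    rwa [he1, hT, one_mul] at this
  have hcase : ∀ s ∈ Icc b m, φ s = 0 ∨ φ s = θ ∧ S s = T s ∨ 0 < Real.sin (θ - φ s) ∧
      0 < Real.sin θ := by
    intro s hs
    rcases (hφ0 s).eq_or_lt with h | h
    · exact Or.inl h.symm
    rcases (hφθ s hs.2).eq_or_lt with h' | h'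
    · refine Or.inr (Or.inl ⟨h', ?_⟩)
      have h1 : φ s = θ - ρ * (m - s) := by
        rcases max_choice 0 (θ - ρ * (m - s)) with h2 | h2
        · exact absurd h2 h.ne'
        · exact h2
      refine hSm s ?_
      have : ρ * (m - s) = 0 := by linarith
      have := (mul_eq_zero.1 this).resolve_left hρ.ne'
      change m ≤ s
      linarith
    · exact Or.inr (Or.inr ⟨Real.sin_pos_of_pos_of_lt_pi (by linarith) (by linarith),
        Real.sin_pos_of_pos_of_lt_pi (by linarith) hπ⟩)
  have hg : ∀ s ∈ Icc b m, 0 ≤ ⟪e, S s - T s⟫ := by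
    intro s hs
    rcases hcase s hs with h | h | ⟨h, h'⟩
    · rw [hSφ s hs, h, circ_zero, inner_sub_right, real_inner_self_eq_norm_sq, he1]
      linarith [heT s]
    · rw [h.2]; simp
    · exact nonneg_of_mul_nonneg_right ((mul_nonneg h'.le (h1T s)).trans (hmain s hs)) h
  refine ⟨θ, u, S, rfl, hθm, hu, heu, hS1, hSL, hSb, hSm, hSφ, hg, ?_, ?_⟩
  · intro s hs
    have := hmain s hs
    rw [hsq]
    linarith
  · intro hθ2 s hs
    rw [hsq]
    suffices 1 - ⟪T s, S s⟫ ≤ ⟪e, S s - T s⟫ by linarith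
    rcases hcase s hs with h | h | ⟨h, h'⟩
    · rw [hSφ s hs, h, circ_zero, inner_sub_right, real_inner_self_eq_norm_sq, he1,
        real_inner_comm (T s) e]
      norm_num
    · rw [h.2, real_inner_self_eq_norm_sq, hT]; simp
    · have h1 : Real.sin (θ - φ s) ≤ Real.sin θ := Real.sin_le_sin_of_le_of_le_pi_div_two
        (by linarith [hφθ s hs.2, Real.pi_pos]) hθ2 (by linarith [hφ0 s])
      have h2 := (hmain s hs).trans (mul_le_mul_of_nonneg_right h1 (hg s hs))
      exact le_of_mul_le_mul_left h2 h'

end Ramp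

section Shortest

theorem norm_integral_sq_le {F : Type*} [NormedAddCommGroup F] [NormedSpace ℝ F] {f : ℝ → F}
    {a b : ℝ} (hf : Continuous f) (hab : a < b) :
    ‖∫ s in a..b, f s‖ ^ 2 ≤ (b - a) * ∫ s in a..b, ‖f s‖ ^ 2 := by
  have hℓ : 0 < b - a := sub_pos.2 hab
  set A := ∫ s in a..b, ‖f s‖ with hA
  have h1 : ‖∫ s in a..b, f s‖ ^ 2 ≤ A ^ 2 :=
    pow_le_pow_left₀ (norm_nonneg _) (intervalIntegral.norm_integral_le_integral_norm hab.le) 2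
  have h2 : 0 ≤ ∫ s in a..b, (‖f s‖ ^ 2 + (-(2 * (A / (b - a))) * ‖f s‖ + (A / (b - a)) ^ 2)) := by
    refine intervalIntegral.integral_nonneg hab.le fun s _ => ?_
    nlinarith [sq_nonneg (‖f s‖ - A / (b - a))]
  rw [intervalIntegral.integral_add
    ((by fun_prop : Continuous fun s => ‖f s‖ ^ 2).intervalIntegrable _ _)
    ((by fun_prop : Continuous fun s => -(2 * (A / (b - a))) * ‖f s‖ + (A / (b - a)) ^ 2
      ).intervalIntegrable _ _),
    intervalIntegral.integral_add
    ((by fun_prop : Continuous fun s => -(2 * (A / (b - a))) * ‖f s‖).intervalIntegrable _ _)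
    intervalIntegrable_const, intervalIntegral.integral_const_mul, ← hA,
    intervalIntegral.integral_const, smul_eq_mul] at h2
  refine h1.trans ?_
  have h3 : (b - a) * (-(2 * (A / (b - a))) * A + (b - a) * (A / (b - a)) ^ 2) = -A ^ 2 := by
    field_simp; ring
  have h4 := mul_nonneg hℓ.le h2
  rw [mul_add, h3] at h4
  linarith

variable {F : Type*} [NormedAddCommGroup F] [InnerProductSpace ℝ F] [CompleteSpace F]

/-- A line segment of a locally shortest curve that stops being straight continues as an arc of
curvature `ρ`. -/
theorem IsLocallyShortest.exists_eq_circ_start {T : ℝ → F} {I : Set ℝ} {ρ a b m₁ : ℝ} {e : F}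
    (h : IsLocallyShortest T I ρ) (hF : ∀ e : F, ‖e‖ = 1 → ∃ u : F, ‖u‖ = 1 ∧ ⟪e, u⟫ = 0)
    (hρ : 0 < ρ) (hT : ∀ s, ‖T s‖ = 1)
    (hL : ∀ x y, ‖T x - T y‖ ≤ ρ * |x - y|) (hab : a < b)
    (hbm : b < m₁) (hI : Disjoint (Icc a m₁) I) (hTe : ∀ s ∈ Icc a b, T s = e)
    (hne : ∀ δ > 0, ∃ s ∈ Ioo b (b + δ), T s ≠ e) :
    ∃ δ > 0, ∃ u : F, ‖u‖ = 1 ∧ ⟪e, u⟫ = 0 ∧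
      ∀ s ∈ Icc b (b + δ), T s = circ e u (ρ * (s - b)) := by
  have hTb : T b = e := hTe b ⟨hab.le, le_rfl⟩
  have he : ‖e‖ = 1 := by rw [← hTb, hT]
  obtain ⟨ε, hε, K, hK, hvar⟩ := h.exists_inner_le hρ hL hab hbm hI he hTe
  obtain ⟨δ, hδ, h1, h2, h3, h4⟩ : ∃ δ > 0, δ ≤ m₁ - b ∧ 2 * ρ * δ ≤ ε ∧ ρ * δ ≤ Real.pi / 2 ∧
      K * (2 * δ) ≤ 1 / 2 := by
    have := Real.pi_pos
    have := sub_pos.2 hbm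
    refine ⟨min (m₁ - b) (min (ε / (2 * ρ)) (min (Real.pi / 2 / ρ) (1 / 2 / (2 * K)))),
      by positivity, min_le_left _ _, ?_, ?_, ?_⟩
    · rw [← le_div_iff₀' (by positivity)]
      exact (min_le_right _ _).trans (min_le_left _ _)
    · rw [← le_div_iff₀' (by positivity)]
      exact (min_le_right _ _).trans ((min_le_right _ _).trans (min_le_left _ _))
    · have := (min_le_right (m₁ - b) _).trans ((min_le_right (ε / (2 * ρ)) _).trans
        (min_le_right (Real.pi / 2 / ρ) (1 / 2 / (2 * K))))
      rw [le_div_iff₀ (by positivity)] at this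
      linarith
  have hbm' : b ≤ b + δ := by linarith
  have hang := angle_le_of_norm_sub_le hT hL b (b + δ)
  rw [abs_sub_comm, add_sub_cancel_left, abs_of_pos hδ, hTb] at hang
  obtain ⟨θ, u, S, hθ, hθm, hu, heu, hS1, hSL, hSb, hSm, hSφ, hg, -, hsq⟩ :=
    exists_ramp hF hρ hT hL hbm' hTb (by linarith [Real.pi_pos])
  rw [add_sub_cancel_left] at hθm
  have hSc := continuous_of_norm_sub_le hSL
  have hTc := continuous_of_norm_sub_le hL
  have hsq := hsq (by linarith)
  have hSε : ∀ s ∈ Icc b (b + δ), ‖S s - T s‖ ≤ ε := by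
    intro s hs
    have e1 := hSL s b
    have e2 := hL b s
    rw [abs_of_nonneg (sub_nonneg.2 hs.1)] at e1
    rw [abs_sub_comm, abs_of_nonneg (sub_nonneg.2 hs.1)] at e2
    rw [hSb b le_rfl] at e1
    have e3 := norm_sub_le_norm_sub_add_norm_sub (S s) (T b) (T s)
    nlinarith [mul_le_mul_of_nonneg_left (show s - b ≤ δ by linarith [hs.2]) hρ.le]
  have hv := hvar (b + δ) ⟨hbm', by linarith⟩ S hS1 hSL hSb hSm hSε
  set G := ∫ s in b..(b + δ), ⟪e, S s - T s⟫ with hG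
  have hgc : Continuous fun s => ⟪e, S s - T s⟫ := by fun_prop
  have hG0 : 0 ≤ G := intervalIntegral.integral_nonneg hbm' hg
  have hw := norm_integral_sq_le (hTc.sub hSc) (show b < b + δ by linarith)
  rw [add_sub_cancel_left] at hw
  simp only [Pi.sub_apply] at hw
  have hI2 : ∫ s in b..(b + δ), ‖T s - S s‖ ^ 2 ≤ 2 * G := by
    rw [hG, ← intervalIntegral.integral_const_mul]
    refine intervalIntegral.integral_mono_on hbm'
      ((by fun_prop : Continuous fun s => ‖T s - S s‖ ^ 2).intervalIntegrable _ _)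
      ((hgc.const_mul 2).intervalIntegrable _ _) fun s hs => ?_
    rw [norm_sub_rev]
    exact hsq s hs
  have hGK : G ≤ K * (2 * δ) * G := by
    have e1 := hw.trans (mul_le_mul_of_nonneg_left hI2 hδ.le)
    have e2 := mul_le_mul_of_nonneg_left e1 hK.le
    linarith
  have hG1 : G ≤ 0 := by nlinarith
  have hg0 := eq_zero_of_integral_nonpos (show b < b + δ by linarith) hgc.continuousOn hg hG1
  have hTS : ∀ s ∈ Icc b (b + δ), T s = circ e u (max 0 (θ - ρ * (b + δ - s))) := by
    intro s hs
    rw [← hSφ s hs]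
    have e1 := hsq s hs
    have e2 := hg0 s hs
    rw [e2, mul_zero] at e1
    have e3 := pow_eq_zero_iff two_ne_zero |>.1 (le_antisymm e1 (sq_nonneg _))
    exact (sub_eq_zero.1 (norm_eq_zero.1 e3)).symm
  have hθ' : ρ * δ ≤ θ := by
    by_contra! hlt
    obtain ⟨s, hs, hse⟩ := hne (min δ ((ρ * δ - θ) / ρ))
      (lt_min hδ (div_pos (sub_pos.2 hlt) hρ))
    have e1 := hs.2.trans_le (add_le_add_right (min_le_right _ _) b)
    have e2 := hs.2.trans_le (add_le_add_right (min_le_left _ _) b)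
    refine hse ?_
    rw [hTS s ⟨hs.1.le, e2.le⟩, max_eq_left, circ_zero]
    have : (s - b) * ρ < ρ * δ - θ := by
      rw [← lt_div_iff₀ hρ]; linarith
    linarith
  refine ⟨δ, hδ, u, hu, heu, fun s hs => ?_⟩
  have : θ - ρ * (b + δ - s) = ρ * (s - b) := by rw [le_antisymm hθm hθ']; ring
  rw [hTS s hs, this, max_eq_right (mul_nonneg hρ.le (sub_nonneg.2 hs.1))]

theorem cos_sub_sub_cos_ge {x t c : ℝ} (ht : 0 ≤ t) (htπ : t ≤ Real.pi)
    (hc : 0 ≤ c) (h : c ≤ Real.sin (x - t / 2)) :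
    2 * c / Real.pi * t ≤ Real.cos (x - t) - Real.cos x := by
  have e1 : Real.cos (x - t) - Real.cos x = 2 * Real.sin (t / 2) * Real.sin (x - t / 2) := by
    rw [Real.cos_sub_cos, show (x - t + x) / 2 = x - t / 2 by ring,
      show (x - t - x) / 2 = -(t / 2) by ring, Real.sin_neg]
    ring
  have e2 := Real.mul_le_sin (x := t / 2) (by linarith) (by linarith)
  rw [e1]
  have e3 : 2 / Real.pi * (t / 2) * c ≤ Real.sin (t / 2) * Real.sin (x - t / 2) := by
    have := Real.pi_pos
    gcongr
    exact (by positivity : 0 ≤ 2 / Real.pi * (t / 2)).trans e2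
  have e4 : 2 * c / Real.pi * t = 2 * (2 / Real.pi * (t / 2) * c) := by ring
  rw [e4]
  linarith

theorem exists_pos_le_sin {ω : ℝ} (h0 : 0 < ω) (hπ : ω < Real.pi) :
    ∃ c > 0, c ≤ 1 ∧ ∀ x ∈ Icc (ω / 4) ((Real.pi + ω) / 2), c ≤ Real.sin x := by
  obtain ⟨x, hx, hmin⟩ := isCompact_Icc.exists_isMinOn
    (⟨ω, by linarith, by linarith⟩ : (Icc (ω / 4) ((Real.pi + ω) / 2)).Nonempty)
    Real.continuous_sin.continuousOn
  exact ⟨Real.sin x, Real.sin_pos_of_pos_of_lt_pi (by linarith [hx.1]) (by linarith [hx.2]),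
    Real.sin_le_one x, fun y hy => hmin hy⟩

end Shortest

section Shortest

variable {F : Type*} [NormedAddCommGroup F] [InnerProductSpace ℝ F]

/-- Estimates for the delay `t` and the direction `u'` of the competitor to an arc of length `ω`,
in terms of the distance at the end of the arc. -/
theorem norm_sub_sq_le_of_end {e u u' : F} {ω t σ c : ℝ} (he : ‖e‖ = 1) (hu : ‖u‖ = 1)
    (heu : ⟪e, u⟫ = 0) (hc : 0 < c) (hc1 : c ≤ 1) (ht : 0 ≤ t) (htσ : t ≤ 2 * σ)
    (hcω : c ≤ Real.sin (ω - t))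
    (h : c * ‖circ e u' (ω - t) - circ e u ω‖ ^ 2 ≤ 2 * σ * t) :
    c ^ 3 * ‖u' - u‖ ^ 2 ≤ 8 * σ * t := by
  set q := ‖circ e u' (ω - t) - circ e u ω‖ with hq
  have h1 : c * ‖u' - u‖ ≤ q + t := by
    have e1 : circ e u' (ω - t) - circ e u (ω - t) = Real.sin (ω - t) • (u' - u) := by
      simp only [circ]; module
    have e2 := norm_sub_le_norm_sub_add_norm_sub (circ e u' (ω - t)) (circ e u ω)
      (circ e u (ω - t))
    have e3 := norm_circ_sub_circ_le he hu heu ω (ω - t)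
    rw [e1, norm_smul, Real.norm_of_nonneg (hc.le.trans hcω)] at e2
    rw [sub_sub_cancel, abs_of_nonneg ht] at e3
    have e4 := mul_le_mul_of_nonneg_right hcω (norm_nonneg (u' - u))
    linarith
  have h2 : (c * ‖u' - u‖) ^ 2 ≤ 2 * q ^ 2 + 2 * t ^ 2 := by
    have e1 := pow_le_pow_left₀ (by positivity) h1 2
    nlinarith [sq_nonneg (q - t)]
  have h3 : t ^ 2 ≤ 2 * σ * t := by nlinarith
  have h4 := mul_le_mul_of_nonneg_left h2 hc.le
  have h5 : c * t ^ 2 ≤ 2 * σ * t := (mul_le_of_le_one_left (sq_nonneg t) hc1).trans h3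
  nlinarith

variable [CompleteSpace F]

set_option maxHeartbeats 1600000 in
/-- An arc of curvature `ρ` following a line segment of a locally shortest curve can be continued
up to length `π / ρ`. -/
theorem IsLocallyShortest.exists_eq_circ_extend {T : ℝ → F} {I : Set ℝ} {ρ a b d m₁ : ℝ} {e u : F}
    (h : IsLocallyShortest T I ρ) (hF : ∀ e : F, ‖e‖ = 1 → ∃ u : F, ‖u‖ = 1 ∧ ⟪e, u⟫ = 0)
    (hρ : 0 < ρ) (hT : ∀ s, ‖T s‖ = 1)
    (hL : ∀ x y, ‖T x - T y‖ ≤ ρ * |x - y|) (hab : a < b) (hbd : b < d)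
    (hdm : d < m₁) (hI : Disjoint (Icc a m₁) I) (hTe : ∀ s ∈ Icc a b, T s = e)
    (hu : ‖u‖ = 1) (heu : ⟪e, u⟫ = 0) (hTu : ∀ s ∈ Icc b d, T s = circ e u (ρ * (s - b)))
    (hπ : ρ * (d - b) < Real.pi) :
    ∃ δ > 0, ∀ s ∈ Icc b (d + δ), T s = circ e u (ρ * (s - b)) := by
  have hTb : T b = e := hTe b ⟨hab.le, le_rfl⟩
  have he : ‖e‖ = 1 := by rw [← hTb, hT]
  obtain ⟨ε, hε, K, hK, hvar⟩ := h.exists_inner_le hρ hL hab (hbd.trans hdm) hI he hTe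
  set ℓ := d - b with hℓ
  have hℓ0 : 0 < ℓ := sub_pos.2 hbd
  set ω := ρ * ℓ with hω
  have hω0 : 0 < ω := mul_pos hρ hℓ0
  obtain ⟨c, hc0, hc1, hc⟩ := exists_pos_le_sin hω0 hπ
  have hpi := Real.pi_pos
  set A := 8 * ρ / c ^ 3 with hA
  have hA0 : 0 < A := by positivity
  set B := 2 * A + 4 * ρ with hB
  have hB0 : 0 < B := by positivity
  set C := 2 * ℓ * B * Real.pi / c + 4 / c with hC
  have hC0 : 0 < C := by positivity
  obtain ⟨δ, hδ, h1, h2, h3, h4, h5⟩ : ∃ δ > 0, δ ≤ m₁ - d ∧ ρ * δ ≤ ω / 8 ∧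
      ρ * δ ≤ (Real.pi - ω) / 2 ∧ (2 * ρ * B + 1 + 2 * ρ) * δ ≤ ε ∧ K * C * δ ≤ 1 / 2 := by
    have := sub_pos.2 hdm
    have := sub_pos.2 hπ
    refine ⟨min (m₁ - d) (min (ω / 8 / ρ) (min ((Real.pi - ω) / 2 / ρ)
      (min (ε / (2 * ρ * B + 1 + 2 * ρ)) (1 / 2 / (K * C))))),
      by positivity, min_le_left _ _, ?_, ?_, ?_, ?_⟩
    · rw [← le_div_iff₀' (by positivity)]
      exact (min_le_right _ _).trans (min_le_left _ _)
    · rw [← le_div_iff₀' (by positivity)]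
      exact (min_le_right _ _).trans ((min_le_right _ _).trans (min_le_left _ _))
    · rw [← le_div_iff₀' (by positivity)]
      exact (min_le_right _ _).trans ((min_le_right _ _).trans ((min_le_right _ _).trans
        (min_le_left _ _)))
    · rw [← le_div_iff₀' (by positivity)]
      exact (min_le_right _ _).trans ((min_le_right _ _).trans ((min_le_right _ _).trans
        (min_le_right _ _)))
  set m := d + δ with hm
  have hdm' : d ≤ m := by linarith
  have hbm : b ≤ m := by linarith
  have hmb : ρ * (m - b) = ω + ρ * δ := by rw [hω, hm, hℓ]; ring
  have hang := angle_le_of_norm_sub_le hT hL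
  have hup := hang b m
  rw [abs_sub_comm, abs_of_nonneg (by linarith), hTb, hmb] at hup
  obtain ⟨θ, u', S, hθ, hθm, hu', heu', hS1, hSL, hSb, hSm, hSφ, hg, hsq, -⟩ :=
    exists_ramp hF hρ hT hL hbm hTb (by linarith)
  rw [hmb] at hθm
  have hTd : T d = circ e u ω := hTu d ⟨hbd.le, le_rfl⟩
  have hlow : ω ≤ θ + ρ * δ := by
    have e1 := InnerProductGeometry.angle_le_angle_add_angle e (T m) (T d)
    have e2 := hang m d
    rw [abs_of_nonneg (by linarith), hm, add_sub_cancel_left] at e2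
    have e3 : InnerProductGeometry.angle e (T d) = ω := by
      rw [hTd, InnerProductGeometry.angle, inner_circ he heu, he, norm_circ he hu heu, mul_one,
        div_one, Real.arccos_cos hω0.le hπ.le]
    rw [e3, ← hθ] at e1
    linarith
  set t := ω + ρ * δ - θ with ht
  have ht0 : 0 ≤ t := by linarith
  have ht1 : t ≤ 2 * (ρ * δ) := by linarith
  have hφ : ∀ s, θ - ρ * (m - s) = ρ * (s - b) - t := fun s => by
    rw [ht, hω, hm, hℓ]; ring
  simp only [hφ] at hSφ hsq
  have hcθ : c ≤ Real.sin θ := hc θ ⟨by linarith, by linarith⟩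
  have hSc := continuous_of_norm_sub_le hSL
  have hTc := continuous_of_norm_sub_le hL
  have hgc : Continuous fun s => ⟪e, S s - T s⟫ := by fun_prop
  have hmem : ∀ s ∈ Icc b d, s ∈ Icc b m := fun s hs => ⟨hs.1, hs.2.trans hdm'⟩
  have hdm2 : d ∈ Icc b m := ⟨hbd.le, hdm'⟩
  have hsq1 : ∀ s ∈ Icc b m, c * ‖S s - T s‖ ^ 2 ≤ 2 * ⟪e, S s - T s⟫ := by
    intro s hs
    refine (mul_le_mul_of_nonneg_right hcθ (sq_nonneg _)).trans ((hsq s hs).trans ?_)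
    exact mul_le_mul_of_nonneg_right
      (mul_le_of_le_one_right zero_le_two (Real.sin_le_one _)) (hg s hs)
  have hSd : S d = circ e u' (ω - t) := by
    rw [hSφ d hdm2, max_eq_right]
    change 0 ≤ ω - t
    linarith
  have hV : ‖u' - u‖ ^ 2 ≤ A * (δ * t) := by
    have e1 : c ^ 3 * ‖u' - u‖ ^ 2 ≤ 8 * (ρ * δ) * t := by
      refine norm_sub_sq_le_of_end he hu heu hc0 hc1 ht0 ht1 (hc _ ⟨by linarith, by linarith⟩)
        (ω := ω) ?_
      have e2 := hsq d hdm2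
      have e3 : θ - max 0 (ρ * (d - b) - t) = ρ * δ := by
        rw [max_eq_right (by change 0 ≤ ω - t; linarith)]
        change θ - (ω - t) = ρ * δ
        rw [ht]; ring
      have e4 : ⟪e, S d - T d⟫ ≤ t := by
        rw [hSd, hTd, inner_sub_right, inner_circ he heu', inner_circ he heu,
          ← inner_circ he heu (ω - t), ← inner_circ he heu ω, ← inner_sub_right]
        refine (real_inner_le_norm _ _).trans ?_
        rw [he, one_mul]
        have := norm_circ_sub_circ_le he hu heu (ω - t) ω
        rwa [sub_sub_cancel_left, abs_neg, abs_of_nonneg ht0] at this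
      rw [e3] at e2
      have e5 : 2 * Real.sin (ρ * δ) * ⟪e, S d - T d⟫ ≤ 2 * (ρ * δ) * t := by
        have e6 := Real.sin_le (mul_nonneg hρ.le hδ.le)
        have e7 := hg d hdm2
        have e8 : 0 ≤ ρ * δ := by positivity
        gcongr
      rw [← hSd, ← hTd]
      exact (mul_le_mul_of_nonneg_right hcθ (sq_nonneg _)).trans (e2.trans e5)
    rw [hA, div_mul_eq_mul_div, le_div_iff₀ (by positivity)]
    linarith
  have hbdest : ∀ s ∈ Icc b d, ‖S s - T s‖ ^ 2 ≤ B * (δ * t) := by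
    intro s hs
    have e1 : ‖S s - T s‖ ≤ ‖u' - u‖ + t := by
      rw [hSφ s (hmem s hs), hTu s hs]
      set x := ρ * (s - b) with hx
      have hx0 : 0 ≤ x := mul_nonneg hρ.le (sub_nonneg.2 hs.1)
      refine (norm_sub_le_norm_sub_add_norm_sub _ (circ e u (max 0 (x - t))) _).trans
        (add_le_add (norm_circ_sub_circ_le' _ _ _ _)
          ((norm_circ_sub_circ_le he hu heu _ _).trans (abs_le.2 ⟨?_, ?_⟩)))
      · linarith [le_max_right 0 (x - t)]
      · linarith [max_le hx0 (show x - t ≤ x by linarith)]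
    have e2 := pow_le_pow_left₀ (norm_nonneg _) e1 2
    have e3 : t * t ≤ 2 * (ρ * δ) * t := mul_le_mul_of_nonneg_right ht1 ht0
    have e4 : (‖u' - u‖ + t) ^ 2 = 2 * ‖u' - u‖ ^ 2 + 2 * (t * t) - (‖u' - u‖ - t) ^ 2 := by ring
    have e5 : B * (δ * t) = 2 * (A * (δ * t)) + 2 * (2 * (ρ * δ) * t) := by rw [hB]; ring
    linarith [sq_nonneg (‖u' - u‖ - t)]
  have hbdest' : ∀ s ∈ Icc b d, ‖S s - T s‖ ≤ (2 * ρ * B + 1) * δ := by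
    intro s hs
    refine (pow_le_pow_iff_left₀ (norm_nonneg _) (by positivity) two_ne_zero).1
      ((hbdest s hs).trans ?_)
    have e1 : B * (δ * t) ≤ B * (δ * (2 * (ρ * δ))) := by gcongr
    have e2 : ((2 * ρ * B + 1) * δ) ^ 2 = (2 * ρ * B * δ) ^ 2 + 2 * (ρ * B * δ ^ 2) + δ ^ 2 +
        B * (δ * (2 * (ρ * δ))) := by ring
    have e3 : 0 < ρ * B * δ ^ 2 := by positivity
    linarith [sq_nonneg (2 * ρ * B * δ), sq_nonneg δ]
  have hSε : ∀ s ∈ Icc b m, ‖S s - T s‖ ≤ ε := by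
    intro s hs
    rcases le_total s d with hsd | hsd
    · have := hbdest' s ⟨hs.1, hsd⟩
      have e1 := mul_pos hρ hδ
      linarith
    · have e0 := hbdest' d ⟨hbd.le, le_rfl⟩
      have e1 := hSL s d
      have e2 := hL d s
      rw [abs_of_nonneg (sub_nonneg.2 hsd)] at e1
      rw [abs_sub_comm, abs_of_nonneg (sub_nonneg.2 hsd)] at e2
      have e3 := norm_sub_le_norm_sub_add_norm_sub (S s) (S d) (T s)
      have e4 := norm_sub_le_norm_sub_add_norm_sub (S d) (T d) (T s)
      have e5 := mul_le_mul_of_nonneg_left (show s - d ≤ δ by linarith [hs.2]) hρ.le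
      linarith
  have hv := hvar m ⟨hbm, by linarith⟩ S hS1 hSL hSb hSm hSε
  set G₁ := ∫ s in b..d, ⟪e, S s - T s⟫ with hG1
  set G₂ := ∫ s in d..m, ⟪e, S s - T s⟫ with hG2
  have hG : ∫ s in b..m, ⟪e, S s - T s⟫ = G₁ + G₂ :=
    (intervalIntegral.integral_add_adjacent_intervals (hgc.intervalIntegrable _ _)
      (hgc.intervalIntegrable _ _)).symm
  have hG20 : 0 ≤ G₂ := intervalIntegral.integral_nonneg hdm' fun s hs =>
    hg s ⟨hbd.le.trans hs.1, hs.2⟩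
  have hTS : Continuous fun s => T s - S s := hTc.sub hSc
  have hG1t : ℓ * c / Real.pi * t ≤ G₁ := by
    set p := b + ℓ / 2 with hp
    have hbp : b ≤ p := by linarith
    have hpd : p ≤ d := by linarith
    have e1 : 0 ≤ ∫ s in b..p, ⟪e, S s - T s⟫ := intervalIntegral.integral_nonneg hbp fun s hs =>
      hg s ⟨hs.1, by linarith [hs.2]⟩
    have e2 : ∫ s in p..d, (2 * c / Real.pi * t) ≤ ∫ s in p..d, ⟪e, S s - T s⟫ := by
      refine intervalIntegral.integral_mono_on hpd intervalIntegrable_const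
        (hgc.intervalIntegrable _ _) fun s hs => ?_
      have hs' : s ∈ Icc b d := ⟨hbp.trans hs.1, hs.2⟩
      have hx1 : ω / 2 ≤ ρ * (s - b) := by
        have := mul_le_mul_of_nonneg_left (show ℓ / 2 ≤ s - b by linarith [hs.1]) hρ.le
        rw [hω]; linarith
      have hx2 : ρ * (s - b) ≤ ω :=
        mul_le_mul_of_nonneg_left (show s - b ≤ ℓ by linarith [hs.2]) hρ.le
      rw [hSφ s (hmem s hs'), hTu s hs', inner_sub_right, inner_circ he heu', inner_circ he heu,
        max_eq_right (by linarith)]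
      exact cos_sub_sub_cos_ge ht0 (by linarith) hc0.le (hc _ ⟨by linarith, by linarith⟩)
    rw [intervalIntegral.integral_const, smul_eq_mul] at e2
    rw [hG1, ← intervalIntegral.integral_add_adjacent_intervals
      (hgc.intervalIntegrable b p) (hgc.intervalIntegrable p d)]
    have e3 : (d - p) * (2 * c / Real.pi * t) = ℓ * c / Real.pi * t := by
      rw [hp, show d - (b + ℓ / 2) = ℓ / 2 by rw [hℓ]; ring]; ring
    linarith
  have hκ : 0 < ℓ * c / Real.pi := by positivity
  have hG10 : 0 ≤ G₁ := (mul_nonneg hκ.le ht0).trans hG1t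
  have hw : ‖∫ s in b..m, (T s - S s)‖ ^ 2 ≤ C * δ * (G₁ + G₂) := by
    rw [← intervalIntegral.integral_add_adjacent_intervals
      (hTS.intervalIntegrable b d) (hTS.intervalIntegrable d m)]
    have hsqc : Continuous fun s => ‖T s - S s‖ ^ 2 := by fun_prop
    have e1 := norm_integral_sq_le hTS hbd
    have e2 := norm_integral_sq_le hTS (show d < m by linarith)
    have e3 : ∫ s in b..d, ‖T s - S s‖ ^ 2 ≤ ℓ * (B * (δ * t)) := by
      have := intervalIntegral.integral_mono_on hbd.le (hsqc.intervalIntegrable _ _)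
        (intervalIntegrable_const (μ := volume) (c := B * (δ * t))) fun s hs => by
          rw [norm_sub_rev]; exact hbdest s hs
      rwa [intervalIntegral.integral_const, smul_eq_mul] at this
    have e4 : ∫ s in d..m, ‖T s - S s‖ ^ 2 ≤ 2 / c * G₂ := by
      rw [hG2, ← intervalIntegral.integral_const_mul]
      refine intervalIntegral.integral_mono_on hdm' (hsqc.intervalIntegrable _ _)
        ((hgc.const_mul _).intervalIntegrable _ _) fun s hs => ?_
      rw [norm_sub_rev, div_mul_eq_mul_div, le_div_iff₀ hc0, mul_comm]
      exact hsq1 s ⟨hbd.le.trans hs.1, hs.2⟩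
    have e5 := e1.trans (mul_le_mul_of_nonneg_left e3 hℓ0.le)
    have hmd : m - d = δ := by rw [hm]; ring
    rw [hmd] at e2
    have e6 := e2.trans (mul_le_mul_of_nonneg_left e4 hδ.le)
    set w₁ := ∫ s in b..d, (T s - S s)
    set w₂ := ∫ s in d..m, (T s - S s)
    have e7 : ‖w₁ + w₂‖ ^ 2 ≤ 2 * ‖w₁‖ ^ 2 + 2 * ‖w₂‖ ^ 2 := by
      have := pow_le_pow_left₀ (norm_nonneg _) (norm_add_le w₁ w₂) 2
      nlinarith [sq_nonneg (‖w₁‖ - ‖w₂‖)]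
    have e8 : t ≤ Real.pi / (ℓ * c) * G₁ := by
      rw [div_mul_eq_mul_div, le_div_iff₀ (by positivity)]
      rw [div_mul_eq_mul_div, div_le_iff₀ hpi] at hG1t
      linarith
    have e9 : 2 * (ℓ * (ℓ * (B * (δ * t)))) ≤ 2 * ℓ * B * Real.pi / c * δ * G₁ := by
      have : 2 * ℓ * B * Real.pi / c * δ * G₁ =
          2 * (ℓ * (ℓ * (B * (δ * (Real.pi / (ℓ * c) * G₁))))) := by
        field_simp
      rw [this]
      gcongr
    have e10 : 0 ≤ 2 * ℓ * B * Real.pi / c * δ * G₂ := by positivity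
    have e11 : 0 ≤ 4 / c * δ * G₁ := by positivity
    have e12 : 2 * (δ * (2 / c * G₂)) = 4 / c * δ * G₂ := by ring
    have e13 : C * δ * (G₁ + G₂) = 2 * ℓ * B * Real.pi / c * δ * G₁ + 4 / c * δ * G₂ +
        2 * ℓ * B * Real.pi / c * δ * G₂ + 4 / c * δ * G₁ := by rw [hC]; ring
    linarith
  have hGle : G₁ + G₂ ≤ 0 := by
    rw [hG] at hv
    have e1 := mul_le_mul_of_nonneg_left hw hK.le
    have e2 := mul_le_mul_of_nonneg_right h5 (add_nonneg hG10 hG20)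
    linarith
  have ht00 : t = 0 := by
    have e1 : ℓ * c / Real.pi * t ≤ ℓ * c / Real.pi * 0 := by rw [mul_zero]; linarith
    exact le_antisymm (le_of_mul_le_mul_left e1 hκ) ht0
  have huu : u' = u := by
    rw [ht00, mul_zero, mul_zero] at hV
    exact sub_eq_zero.1 (norm_eq_zero.1 ((pow_eq_zero_iff two_ne_zero).1
      (le_antisymm hV (sq_nonneg _))))
  have hg0 := eq_zero_of_integral_nonpos (show b < m by linarith) hgc.continuousOn hg
    (hG.le.trans hGle)
  refine ⟨δ, hδ, fun s hs => ?_⟩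
  have e1 := hsq1 s hs
  rw [hg0 s hs, mul_zero] at e1
  have e2 : ‖S s - T s‖ ^ 2 ≤ 0 := nonpos_of_mul_nonpos_right e1 hc0
  have e3 := sub_eq_zero.1 (norm_eq_zero.1 ((pow_eq_zero_iff two_ne_zero).1
    (le_antisymm e2 (sq_nonneg _))))
  rw [← e3, hSφ s hs, ht00, huu, sub_zero, max_eq_right (mul_nonneg hρ.le (sub_nonneg.2 hs.1))]

end Shortest

section FirstExit

theorem exists_first_exit {F : Type*} [TopologicalSpace F] [T2Space F] {T G : ℝ → F} {I : Set ℝ}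
    {p q : ℝ} (hT : Continuous T) (hG : Continuous G) (hI : IsClosed I) (hpq : p ≤ q)
    (hp : T p = G p) :
    ∃ b ∈ Icc p q, (∀ s ∈ Icc p b, T s = G s) ∧ (∀ s ∈ Ico p b, s ∉ I) ∧
      (b = q ∨ b ∈ I ∨ ∀ δ > 0, ∃ s ∈ Ioo b (b + δ), T s ≠ G s) := by
  set S := {x | x ∈ Icc p q ∧ (x = q ∨ x ∈ I ∨ T x ≠ G x)} with hS
  have hqS : q ∈ S := ⟨⟨hpq, le_rfl⟩, Or.inl rfl⟩
  have hbdd : BddBelow S := ⟨p, fun x hx => hx.1.1⟩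
  have hb1 : p ≤ sInf S := le_csInf ⟨q, hqS⟩ fun x hx => hx.1.1
  have hb2 : sInf S ≤ q := csInf_le hbdd hqS
  have hlt : ∀ s ∈ Ico p (sInf S), s ∉ I ∧ T s = G s := by
    intro s hs
    have h1 := notMem_of_lt_csInf hs.2 hbdd
    refine ⟨fun h => h1 ⟨⟨hs.1, (hs.2.trans_le hb2).le⟩, Or.inr (Or.inl h)⟩, ?_⟩
    by_contra h
    exact h1 ⟨⟨hs.1, (hs.2.trans_le hb2).le⟩, Or.inr (Or.inr h)⟩
  have hle : ∀ s ∈ Icc p (sInf S), T s = G s := by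
    rcases hb1.eq_or_lt with h | h
    · intro s hs
      rw [← h, Icc_self, mem_singleton_iff] at hs
      rw [hs, hp]
    · have h1 : closure (Ico p (sInf S)) ⊆ {s | T s = G s} :=
        closure_minimal (fun s hs => (hlt s hs).2) (isClosed_eq hT hG)
      rw [closure_Ico h.ne] at h1
      exact fun s hs => h1 hs
  refine ⟨sInf S, ⟨hb1, hb2⟩, hle, fun s hs => (hlt s hs).1, ?_⟩
  by_contra! hcon
  obtain ⟨h1, h2, δ, hδ, h3⟩ := hcon
  obtain ⟨η, hη, h4⟩ := Metric.isOpen_iff.1 hI.isOpen_compl _ h2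
  have h5 : sInf S < q := lt_of_le_of_ne hb2 h1
  obtain ⟨x, hx, hx1⟩ := exists_lt_of_csInf_lt ⟨q, hqS⟩
    (show sInf S < sInf S + min δ (min η (q - sInf S)) by
      have := sub_pos.2 h5
      have : 0 < min δ (min η (q - sInf S)) := by positivity
      linarith)
  have hx0 : sInf S ≤ x := csInf_le hbdd hx
  have hxδ : x < sInf S + δ := hx1.trans_le (by gcongr; exact min_le_left _ _)
  have hxη : x < sInf S + η := hx1.trans_le (by
    gcongr; exact (min_le_right _ _).trans (min_le_left _ _))
  have hxq : x < q := hx1.trans_le (by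
    have : min δ (min η (q - sInf S)) ≤ q - sInf S := (min_le_right _ _).trans (min_le_right _ _)
    linarith)
  rcases hx.2 with h | h | h
  · exact hxq.ne h
  · refine h4 (show x ∈ Metric.ball (sInf S) η from ?_) h
    rw [Metric.mem_ball, Real.dist_eq, abs_of_nonneg (by linarith)]
    linarith
  · rcases hx0.eq_or_lt with h6 | h6
    · rw [← h6] at h
      exact h (hle _ ⟨hb1, le_rfl⟩)
    · exact h (h3 x ⟨h6, hxδ⟩)

theorem exists_disjoint_Icc_of_notMem {I : Set ℝ} {a b : ℝ} (hI : IsClosed I)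
    (hab : ∀ s ∈ Icc a b, s ∉ I) (h : a ≤ b) : ∃ m > b, Disjoint (Icc a m) I := by
  obtain ⟨η, hη, h4⟩ := Metric.isOpen_iff.1 hI.isOpen_compl _ (hab b ⟨h, le_rfl⟩)
  refine ⟨b + η / 2, by linarith, disjoint_left.2 fun s hs => ?_⟩
  rcases le_or_gt s b with h1 | h1
  · exact hab s ⟨hs.1, h1⟩
  · refine h4 (show s ∈ Metric.ball b η from ?_)
    rw [Metric.mem_ball, Real.dist_eq, abs_of_nonneg (by linarith)]
    linarith [hs.2]

end FirstExit

section Shortest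

variable {F : Type*} [NormedAddCommGroup F] [InnerProductSpace ℝ F]

theorem IsLocallyShortest.comp_neg {T : ℝ → F} {I : Set ℝ} {ρ : ℝ}
    (h : IsLocallyShortest T I ρ) : IsLocallyShortest (fun s => T (-s)) (-I) ρ := by
  intro α β hαβ hI
  obtain ⟨ε, hε, H⟩ := h (-β) (-α) (neg_lt_neg hαβ) (disjoint_left.2 fun s hs hsI =>
    disjoint_left.1 hI (show -s ∈ Icc α β from ⟨by linarith [hs.2], by linarith [hs.1]⟩)
      (by simpa using hsI))
  refine ⟨ε, hε, fun N hN hNα hNβ hNε hint hlip => ?_⟩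
  have := H (fun s => N (-s)) (by fun_prop)
    (fun s hs => by simpa using hNβ (-s) (by linarith))
    (fun s hs => by simpa using hNα (-s) (by linarith))
    (fun s => by simpa using hNε (-s))
    (by
      rw [intervalIntegral.integral_comp_neg, neg_neg, neg_neg, hint,
        intervalIntegral.integral_comp_neg])
    (fun x y hx hxy hy => by
      rw [norm_sub_rev, intervalIntegral.integral_comp_neg (fun t => ‖N t‖)]
      exact hlip (-y) (-x) (by linarith) (by linarith) (by linarith))
  rw [intervalIntegral.integral_comp_neg (fun t => ‖N t‖), neg_neg, neg_neg] at this
  linarith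

variable [CompleteSpace F]

/-- To the right of a line segment, a locally shortest curve consists of a longer line segment and
an arc of curvature `ρ`, which has length `π / ρ` or ends at the obstacle `I`. -/
theorem IsLocallyShortest.exists_segment_arc {T : ℝ → F} {I : Set ℝ} {ρ a s₀ s₁ q : ℝ} {e : F}
    (h : IsLocallyShortest T I ρ) (hF : ∀ e : F, ‖e‖ = 1 → ∃ u : F, ‖u‖ = 1 ∧ ⟪e, u⟫ = 0)
    (hρ : 0 < ρ) (hT : ∀ s, ‖T s‖ = 1) (hL : ∀ x y, ‖T x - T y‖ ≤ ρ * |x - y|)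
    (hI : IsClosed I) (ha : a < s₀) (hs : s₀ < s₁) (hTe : ∀ s ∈ Icc a s₁, T s = e)
    (haI : ∀ s ∈ Icc a s₀, s ∉ I) (hq : q ∈ I) (hsq : s₀ < q) :
    ∃ b d u, s₀ < b ∧ b ≤ d ∧ ‖u‖ = 1 ∧ ⟪e, u⟫ = 0 ∧ (∀ s ∈ Icc s₀ b, T s = e) ∧
      (∀ s ∈ Icc b d, T s = circ e u (ρ * (s - b))) ∧ (∀ s ∈ Ico s₀ d, s ∉ I) ∧
      (d = b + Real.pi / ρ ∨ d ∈ I) := by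
  have hTc := continuous_of_norm_sub_le hL
  have hTs : T s₀ = e := hTe s₀ ⟨ha.le, hs.le⟩
  have he : ‖e‖ = 1 := by rw [← hTs, hT]
  have hpi := div_pos Real.pi_pos hρ
  obtain ⟨b, hb, hTb, hbI, hex⟩ := exists_first_exit hTc (continuous_const (y := e)) hI hsq.le hTs
  have hsb : s₀ < b := by
    rcases hb.1.eq_or_lt with h1 | h1
    · exfalso
      rw [← h1] at hex
      rcases hex with h2 | h2 | h2
      · exact hsq.ne h2
      · exact haI s₀ ⟨ha.le, le_rfl⟩ h2
      · obtain ⟨s, hs2, hs3⟩ := h2 (s₁ - s₀) (sub_pos.2 hs)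
        exact hs3 (hTe s ⟨ha.le.trans hs2.1.le, by linarith [hs2.2]⟩)
    · exact h1
  by_cases hbI' : b ∈ I
  · obtain ⟨u, hu, heu⟩ := hF e he
    refine ⟨b, b, u, hsb, le_rfl, hu, heu, hTb, fun s hs => ?_, hbI, Or.inr hbI'⟩
    rw [Icc_self, mem_singleton_iff] at hs
    rw [hs, sub_self, mul_zero, circ_zero, hTb b ⟨hsb.le, le_rfl⟩]
  have hne := (hex.resolve_left fun h1 => hbI' (h1 ▸ hq)).resolve_left hbI'
  have hTab : ∀ s ∈ Icc a b, T s = e := by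
    intro s hs2
    rcases le_total s s₀ with h1 | h1
    · exact hTe s ⟨hs2.1, h1.trans hs.le⟩
    · exact hTb s ⟨h1, hs2.2⟩
  have hnI : ∀ d, (∀ s ∈ Icc b d, s ∉ I) → ∀ s ∈ Icc a d, s ∉ I := by
    intro d hd s hs2
    rcases le_total s s₀ with h1 | h1
    · exact haI s ⟨hs2.1, h1⟩
    · rcases lt_or_ge s b with h3 | h3
      · exact hbI s ⟨h1, h3⟩
      · exact hd s ⟨h3, hs2.2⟩
  have hab := ha.trans hsb
  obtain ⟨m₁, hm₁, hdis⟩ := exists_disjoint_Icc_of_notMem hI (hnI b fun s hs => by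
    rw [Icc_self, mem_singleton_iff] at hs; rwa [hs]) hab.le
  obtain ⟨δ, hδ, u, hu, heu, hTu⟩ :=
    h.exists_eq_circ_start hF hρ hT hL hab hm₁ hdis hTab hne
  have hGc : Continuous fun s => circ e u (ρ * (s - b)) :=
    (continuous_circ e u).comp (by fun_prop)
  obtain ⟨d, hd, hTd, hdI, hex2⟩ := exists_first_exit hTc hGc hI
    (show b ≤ b + Real.pi / ρ by linarith) (hTu b ⟨le_rfl, by linarith⟩)
  refine ⟨b, d, u, hsb, hd.1, hu, heu, hTb, hTd, fun s hs => ?_, ?_⟩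
  · rcases lt_or_ge s b with h3 | h3
    · exact hbI s ⟨hs.1, h3⟩
    · exact hdI s ⟨h3, hs.2⟩
  · by_contra! hcon
    have hex3 := (hex2.resolve_left hcon.1).resolve_left hcon.2
    have hbd : b < d := by
      rcases hd.1.eq_or_lt with h1 | h1
      · exfalso
        rw [← h1] at hex3
        obtain ⟨s, hs2, hs3⟩ := hex3 δ hδ
        exact hs3 (hTu s ⟨hs2.1.le, hs2.2.le⟩)
      · exact h1
    have hdπ : d < b + Real.pi / ρ := lt_of_le_of_ne hd.2 hcon.1
    obtain ⟨m₂, hm₂, hdis2⟩ := exists_disjoint_Icc_of_notMem hI (hnI d fun s hs => by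
      rcases hs.2.eq_or_lt with h1 | h1
      · rw [h1]; exact hcon.2
      · exact hdI s ⟨hs.1, h1⟩) (hab.trans hbd).le
    obtain ⟨δ₂, hδ₂, hTd2⟩ := h.exists_eq_circ_extend hF hρ hT hL hab hbd hm₂ hdis2 hTab hu heu
      hTd (by
        rw [← lt_div_iff₀' hρ]
        linarith)
    obtain ⟨s, hs2, hs3⟩ := hex3 δ₂ hδ₂
    exact hs3 (hTd2 s ⟨hd.1.trans hs2.1.le, hs2.2.le⟩)

end Shortest

section Orthogonal

variable {n : ℕ}

theorem exists_unit_orthogonal (hn : 2 ≤ n) (e : Euc n) : ∃ u : Euc n, ‖u‖ = 1 ∧ ⟪e, u⟫ = 0 := by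
  have h1 : (ℝ ∙ e)ᗮ ≠ ⊥ := by
    intro h
    have h2 := (ℝ ∙ e).finrank_add_finrank_orthogonal
    rw [h, finrank_bot, finrank_euclideanSpace_fin] at h2
    have h3 : Module.finrank ℝ (ℝ ∙ e) ≤ 1 := (finrank_span_le_card {e}).trans (by simp)
    omega
  obtain ⟨v, hv, hv0⟩ := Submodule.exists_mem_ne_zero_of_ne_bot h1
  refine ⟨‖v‖⁻¹ • v, norm_smul_inv_norm hv0, ?_⟩
  rw [inner_smul_right, Submodule.mem_orthogonal_singleton_iff_inner_right.1 hv, mul_zero]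

theorem isArcR_self {e u : Euc n} (he : ‖e‖ = 1) (hu : ‖u‖ = 1) (heu : ⟪e, u⟫ = 0) (r : ℝ)
    (f : ℝ → Euc n) (a : ℝ) : IsArcR r f a a := by
  refine ⟨f a - r • e, e, u, a, he, hu, heu, fun s hs => ?_⟩
  rw [Icc_self, mem_singleton_iff] at hs
  simp [hs]

theorem isArcR_of_hasDerivAt {f fd : ℝ → Euc n} {e u : Euc n} {p q r s₁ : ℝ}
    (hf : ∀ s, HasDerivAt f (fd s) s) (hr : 0 < r) (he : ‖e‖ = 1) (hu : ‖u‖ = 1)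
    (hue : ⟪u, e⟫ = 0) (h : ∀ s ∈ Icc p q,
      fd s = Real.cos ((s - s₁) / r) • e - Real.sin ((s - s₁) / r) • u) :
    IsArcR r f p q := by
  set G : ℝ → Euc n := fun s =>
    (r * Real.cos ((s - s₁) / r)) • u + (r * Real.sin ((s - s₁) / r)) • e with hG
  have hGd : ∀ s, HasDerivAt G
      (Real.cos ((s - s₁) / r) • e - Real.sin ((s - s₁) / r) • u) s := by
    intro s
    have h0 : HasDerivAt (fun s => (s - s₁) / r) (1 / r) s :=
      ((hasDerivAt_id s).sub_const s₁).div_const r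
    have h1 := ((h0.cos.const_mul r).smul_const u).add ((h0.sin.const_mul r).smul_const e)
    refine h1.congr_deriv ?_
    have h2 : r * (-Real.sin ((s - s₁) / r) * (1 / r)) = -Real.sin ((s - s₁) / r) := by
      field_simp
    have h3 : r * (Real.cos ((s - s₁) / r) * (1 / r)) = Real.cos ((s - s₁) / r) := by
      field_simp
    rw [h2, h3]
    module
  refine ⟨f p - G p, u, e, s₁, hu, he, hue, fun s hs => ?_⟩
  have hd : ∀ s ∈ Icc p q, HasDerivAt (fun s => f s - G s) 0 s := by
    intro s hs
    have h1 := (hf s).sub (hGd s)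
    rwa [h s hs, sub_self] at h1
  have h2 := constant_of_has_deriv_right_zero
    (fun s hs => (hd s hs).continuousAt.continuousWithinAt)
    (fun s hs => (hd s ⟨hs.1, hs.2.le⟩).hasDerivWithinAt) s hs
  rw [add_assoc]
  exact sub_eq_iff_eq_add.1 h2

end Orthogonal

namespace Knot

variable {n : ℕ} (k : Knot n)

theorem Fk_eq_of_fd_eq {e u : Euc n} {p q s₁ : ℝ} (hpq : p < q) (he : ‖e‖ = 1) (hu : ‖u‖ = 1)
    (hue : ⟪u, e⟫ = 0) (h : ∀ s ∈ Icc p q, k.fd s =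
      Real.cos ((s - s₁) / RO k.f k.fd univ) • e - Real.sin ((s - s₁) / RO k.f k.fd univ) • u) :
    k.Fk = RO k.f k.fd univ := by
  set r := RO k.f k.fd univ with hr
  set θ := (p - s₁) / r with hθ
  have heu : ⟪e, -u⟫ = 0 := by rw [inner_neg_right, real_inner_comm, hue, neg_zero]
  refine k.Fk_eq_of_arc (e := circ e (-u) θ) (u := circ (-u) (-e) θ) hpq
    (norm_circ he (by rwa [norm_neg]) heu θ) ?_ fun s hs => ?_
  · simp only [circ, inner_add_left, inner_add_right, inner_smul_left, inner_smul_right,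
      inner_neg_left, inner_neg_right, real_inner_self_eq_norm_sq, he, hu, hue,
      real_inner_comm u e]
    simp
    ring
  · rw [h s hs, show (s - s₁) / r = θ + 1 / r * (s - p) by rw [hθ]; ring, Real.cos_add,
      Real.sin_add]
    simp only [circ]
    module

theorem isArcR_of_fd_eq {e u : Euc n} {p q s₁ : ℝ} (hpq : p ≤ q) (he : ‖e‖ = 1) (hu : ‖u‖ = 1)
    (hue : ⟪u, e⟫ = 0) (h : ∀ s ∈ Icc p q, k.fd s =
      Real.cos ((s - s₁) / RO k.f k.fd univ) • e - Real.sin ((s - s₁) / RO k.f k.fd univ) • u) :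
    IsArcR k.Fk k.f p q := by
  rcases hpq.eq_or_lt with rfl | hlt
  · exact isArcR_self hu he hue _ _ _
  · rw [k.Fk_eq_of_fd_eq hlt he hu hue h]
    exact isArcR_of_hasDerivAt k.deriv k.RO_pos he hu hue h

end Knot

/-- For a relatively extremal knot with `κγ(s₀) < sup κγ` and `s₀ ∉ I_c`,
there are `c ≤ a < s₀ < b ≤ d` with `d - c ≤ L` such that `γ` is a line segment on `[a,b]`,
planar circular arcs of radius `F_k(γ)` on `[c,a]` and `[b,d]`, and each arc either has
length at least `π·F_k(γ)` or ends at a minimal double critical point. -/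
theorem statement_3 {n : ℕ} (hn : 2 ≤ n) (γ : Knot n)
    (hext : RelativelyExtremal γ) (s₀ : ℝ)
    (hs : curvAt γ.fd Set.univ s₀ < ⨆ s : ℝ, curvAt γ.fd Set.univ s)
    (hnc : s₀ ∉ γ.Ic) :
    ∃ c a b d : ℝ, c ≤ a ∧ a < s₀ ∧ s₀ < b ∧ b ≤ d ∧ d - c ≤ γ.L ∧
      (∀ s ∈ Set.Icc a b, γ.fd s = γ.fd a) ∧
      IsArcR γ.Fk γ.f c a ∧ IsArcR γ.Fk γ.f b d ∧
      (Real.pi * γ.Fk ≤ a - c ∨ c ∈ γ.Ic) ∧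
      (Real.pi * γ.Fk ≤ d - b ∨ d ∈ γ.Ic) := by
  have hr := γ.RO_pos
  have hshort := Knot.isLocallyShortest_of_relativelyExtremal hext
  have hlip := γ.norm_fd_sub_le
  have hF : ∀ e : Euc n, ‖e‖ = 1 → ∃ u : Euc n, ‖u‖ = 1 ∧ ⟪e, u⟫ = 0 := fun e _ =>
    exists_unit_orthogonal hn e
  have hIc := γ.isClosed_Ic
  obtain ⟨Λ, hΛ, hΛ0, δ, hδ, hΛL⟩ := γ.exists_lipschitz_lt hs
  obtain ⟨η, hη, hηI⟩ := Metric.isOpen_iff.1 hIc.isOpen_compl _ hnc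
  obtain ⟨m, hm, hmδ, hmη⟩ : ∃ m > 0, m < δ ∧ m < η := by
    refine ⟨min δ η / 2, by positivity, ?_, ?_⟩
    · linarith [min_le_left δ η]
    · linarith [min_le_right δ η]
  have hnear : ∀ s ∈ Icc (s₀ - m) (s₀ + m), s ∉ γ.Ic := fun s hs =>
    hηI (show s ∈ Metric.ball s₀ η by
      rw [Metric.mem_ball, Real.dist_eq, abs_lt]; constructor <;> linarith [hs.1, hs.2])
  have hnear' : ∀ s ∈ Icc (s₀ - m) (s₀ + m), |s - s₀| < δ := fun s hs => by
    rw [abs_lt]; constructor <;> linarith [hs.1, hs.2]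
  obtain ⟨e, hTe⟩ := hshort.eq_of_lipschitz_lt γ.continuous_fd γ.unit
    (show s₀ - m < s₀ + m by linarith) (disjoint_left.2 hnear) hΛ hΛ0
    fun x hx y hy => hΛL x y (hnear' x hx) (hnear' y hy)
  have he : ‖e‖ = 1 := by rw [← hTe s₀ ⟨by linarith, by linarith⟩, γ.unit]
  obtain ⟨q, hq, hq1, -⟩ := γ.exists_mem_Ic s₀
  obtain ⟨b, d, u, hsb, hbd, hu, heu, hTb, hTd, hdI, hd⟩ := hshort.exists_segment_arc hF
    (by positivity) γ.unit hlip hIc (show s₀ - m / 2 < s₀ by linarith)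
    (show s₀ < s₀ + m / 2 by linarith) (fun s hs => hTe s ⟨by linarith [hs.1], by linarith [hs.2]⟩)
    (fun s hs => hnear s ⟨by linarith [hs.1], by linarith [hs.2]⟩) hq
    (lt_of_le_of_ne hq1 fun h => hnc (h ▸ hq))
  obtain ⟨q', hq', -, hq2⟩ := γ.exists_mem_Ic (s₀ - γ.L)
  obtain ⟨b', d', u', hsb', hbd', hu', heu', hTb', hTd', hdI', hd'⟩ :=
    hshort.comp_neg.exists_segment_arc hF
    (by positivity) (fun s => γ.unit (-s))
    (fun x y => (hlip (-x) (-y)).trans_eq (by rw [neg_sub_neg, abs_sub_comm]))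
    hIc.neg (show -s₀ - m / 2 < -s₀ by linarith)
    (show -s₀ < -s₀ + m / 2 by linarith)
    (fun s hs => hTe (-s) ⟨by linarith [hs.2], by linarith [hs.1]⟩)
    (fun s hs h => hnear (-s) ⟨by linarith [hs.2], by linarith [hs.1]⟩ h)
    (show -q' ∈ -γ.Ic by simpa using hq') (by linarith)
  have hright : ∀ s ∈ Icc b d, γ.fd s = Real.cos ((s - b) / RO γ.f γ.fd univ) • e -
      Real.sin ((s - b) / RO γ.f γ.fd univ) • (-u) := by
    intro s hs
    rw [hTd s hs, circ, one_div_mul_eq_div]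
    module
  have hleft : ∀ s ∈ Icc (-d') (-b'), γ.fd s =
      Real.cos ((s - -b') / RO γ.f γ.fd univ) • e -
        Real.sin ((s - -b') / RO γ.f γ.fd univ) • u' := by
    intro s hs
    have h1 := hTd' (-s) ⟨by linarith [hs.2], by linarith [hs.1]⟩
    rw [neg_neg, circ, one_div_mul_eq_div, show -s - b' = -(s - -b') by ring, neg_div,
      Real.cos_neg, Real.sin_neg] at h1
    rw [h1]
    module
  have hue' : ⟪u', e⟫ = 0 := by rw [real_inner_comm, heu']
  have hue : ⟪-u, e⟫ = 0 := by rw [inner_neg_left, real_inner_comm, heu, neg_zero]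
  have hnu : ‖-u‖ = 1 := by rwa [norm_neg]
  have hpi : 0 < Real.pi * RO γ.f γ.fd univ := mul_pos Real.pi_pos hr
  have hTa : ∀ s ∈ Icc (-b') b, γ.fd s = e := by
    intro s hs
    rcases le_total s s₀ with h | h
    · simpa using hTb' (-s) ⟨by linarith, by linarith [hs.1]⟩
    · exact hTb s ⟨h, hs.2⟩
  refine ⟨-d', -b', b, d, neg_le_neg hbd', by linarith, hsb, hbd, ?_, fun s hs => ?_,
    γ.isArcR_of_fd_eq (neg_le_neg hbd') he hu' hue' hleft,
    γ.isArcR_of_fd_eq hbd he hnu hue hright, ?_, ?_⟩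
  · by_contra! hlt
    obtain ⟨α, hα1, hα2⟩ := exists_between (show -d' < d - γ.L by linarith)
    obtain ⟨x, hx, hx1, hx2⟩ := γ.exists_mem_Ic α
    rcases le_total x s₀ with h | h
    · exact hdI' (-x) ⟨by linarith, by linarith⟩ (by simpa using hx)
    · exact hdI x ⟨h, by linarith⟩ hx
  · rw [hTa s hs, hTa (-b') ⟨le_rfl, by linarith⟩]
  · rcases hd' with h | h
    · rw [div_div_eq_mul_div, div_one] at h
      rw [γ.Fk_eq_of_fd_eq (by linarith) he hu' hue' hleft]
      exact Or.inl (by linarith)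
    · exact Or.inr h
  · rcases hd with h | h
    · rw [div_div_eq_mul_div, div_one] at h
      rw [γ.Fk_eq_of_fd_eq (by linarith) he hnu hue hright]
      exact Or.inl (by linarith)
    · exact Or.inr h
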